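/- Let p be a prime, let M be a connected topological n-manifold, and let G be an elementary abelian p-group acting continuously and effectively on M. Let H ∈ Stab(G,M) be maximal with respect to inclusion among the stabilizer subgroups of the action. Then the rank of H is at most n, and there exists a complete flag of subgroups {1} = H_0 < H_1 < … < H_{rank(H)} = H with rank(H_i) = i for each i, such that every H_i belongs to Stab(G,M). -/

import Mathlib

set_option linter.unusedSectionVars false

namespace SmithFlag

open Module

section Bor

variable {k E : Type} [Field k] [AddCommGroup E] [Module k E]

/-- Prepend a term to a sequence. -/
def cs (a : E) (x : ℕ → E) : ℕ → E
  | 0 => a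
  | j + 1 => x j

@[simp] lemma cs_zero (a : E) (x : ℕ → E) : cs a x 0 = a := rfl
@[simp] lemma cs_succ (a : E) (x : ℕ → E) (j : ℕ) : cs a x (j + 1) = x j := rfl

lemma cs_eta (x : ℕ → E) : cs (x 0) (fun j => x (j + 1)) = x := by
  funext j; cases j <;> rfl

lemma cs_sub (a b : E) (x y : ℕ → E) : cs a x - cs b y = cs (a - b) (x - y) := by
  funext j; cases j <;> rfl

lemma cs_add (a b : E) (x y : ℕ → E) : cs a x + cs b y = cs (a + b) (x + y) := by
  funext j; cases j <;> rfl

/-- The differential of the Borel-type complex. -/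
def BD (d r0 r1 : End k E) : End k (ℕ → E) :=
  LinearMap.pi fun j => ((-1 : k) ^ j) • d ∘ₗ LinearMap.proj j +
    (if Even j then r0 else r1) ∘ₗ LinearMap.proj (j + 1)

lemma BD_apply (d r0 r1 : End k E) (x : ℕ → E) (j : ℕ) :
    BD d r0 r1 x j = ((-1 : k) ^ j) • d (x j) + (if Even j then r0 else r1) (x (j + 1)) := rfl

lemma BD_cs (d r0 r1 : End k E) (a : E) (x : ℕ → E) :
    BD d r0 r1 (cs a x) = cs (d a + r0 (x 0)) (BD (-d) r1 r0 x) := by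
  funext j
  cases j with
  | zero => simp [BD_apply]
  | succ j =>
    simp only [BD_apply, cs_succ, Nat.even_add_one, pow_succ]
    by_cases h : Even j <;> simp [h]

/-- The graded pieces of the Borel-type complex. -/
def BP (P : ℤ → Submodule k E) (q : ℤ) : Submodule k (ℕ → E) where
  carrier := {x | ∀ j : ℕ, x j ∈ P (q - j)}
  add_mem' hx hy j := add_mem (hx j) (hy j)
  zero_mem' _ := zero_mem _
  smul_mem' c _ hx j := (P _).smul_mem c (hx j)

lemma cs_mem_BP {P : ℤ → Submodule k E} {q : ℤ} {a : E} {x : ℕ → E} :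
    cs a x ∈ BP P q ↔ a ∈ P q ∧ x ∈ BP P (q - 1) := by
  constructor
  · intro h
    refine ⟨by simpa using h 0, fun j => ?_⟩
    have := h (j + 1)
    have e : q - ((j + 1 : ℕ) : ℤ) = q - 1 - j := by push_cast; ring
    rwa [e] at this
  · rintro ⟨h0, h⟩ j
    cases j with
    | zero => simpa using h0
    | succ j =>
      have e : q - ((j + 1 : ℕ) : ℤ) = q - 1 - j := by push_cast; ring
      rw [e]; exact h j

/-- Two operators on a complex with the identities needed to form `BD`, and a graded subcomplex
concentrated in nonnegative degrees. -/
structure Dat (d r0 r1 : End k E) (P : ℤ → Submodule k E) : Prop where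
  neg : ∀ q < 0, P q = ⊥
  d_mem : ∀ q, ∀ x ∈ P q, d x ∈ P (q - 1)
  r0_mem : ∀ q, ∀ x ∈ P q, r0 x ∈ P q
  r1_mem : ∀ q, ∀ x ∈ P q, r1 x ∈ P q
  dd : ∀ x, d (d x) = 0
  r01 : ∀ x, r0 (r1 x) = 0
  r10 : ∀ x, r1 (r0 x) = 0
  c0 : ∀ x, d (r0 x) = r0 (d x)
  c1 : ∀ x, d (r1 x) = r1 (d x)

variable {d r0 r1 : End k E} {P P' : ℤ → Submodule k E}

lemma Dat.shift (h : Dat d r0 r1 P) : Dat (-d) r1 r0 P where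
  neg := h.neg
  d_mem q x hx := by simpa using h.d_mem q x hx
  r0_mem := h.r1_mem
  r1_mem := h.r0_mem
  dd x := by simp [h.dd]
  r01 := h.r10
  r10 := h.r01
  c0 x := by simp [h.c1]
  c1 x := by simp [h.c0]

lemma BP_neg (h : ∀ q < 0, P q = ⊥) (q : ℤ) (hq : q < 0) : BP P q = ⊥ := by
  rw [eq_bot_iff]
  intro x hx
  refine (Submodule.mem_bot k).2 (funext fun j => ?_)
  have := hx j
  rw [h _ (by omega)] at this
  simpa using this

lemma BD_mem (h : Dat d r0 r1 P) (q : ℤ) (x : ℕ → E) (hx : x ∈ BP P q) :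
    BD d r0 r1 x ∈ BP P (q - 1) := by
  intro j
  rw [BD_apply]
  have e : q - 1 - (j : ℤ) = q - j - 1 := by ring
  have e' : q - 1 - (j : ℤ) = q - ((j + 1 : ℕ) : ℤ) := by push_cast; ring
  refine add_mem (Submodule.smul_mem _ _ ?_) ?_
  · rw [e]; exact h.d_mem _ _ (hx j)
  · rw [e']
    split_ifs
    · exact h.r0_mem _ _ (hx _)
    · exact h.r1_mem _ _ (hx _)

lemma BD_BD (h : Dat d r0 r1 P) (x : ℕ → E) : BD d r0 r1 (BD d r0 r1 x) = 0 := by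
  funext j
  simp only [BD_apply, Nat.even_add_one, pow_succ]
  by_cases hj : Even j <;> simp [hj, h.dd, h.r01, h.r10, h.c0, h.c1]

lemma Dat.bor (h : Dat d r0 r1 P) {f0 f1 : End k E}
    (m0 : ∀ q, ∀ x ∈ P q, f0 x ∈ P q) (m1 : ∀ q, ∀ x ∈ P q, f1 x ∈ P q)
    (f01 : ∀ x, f0 (f1 x) = 0) (f10 : ∀ x, f1 (f0 x) = 0)
    (hd0 : ∀ x, d (f0 x) = f0 (d x)) (hd1 : ∀ x, d (f1 x) = f1 (d x))
    (h00 : ∀ x, r0 (f0 x) = f0 (r0 x)) (h10 : ∀ x, r1 (f0 x) = f0 (r1 x))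
    (h01 : ∀ x, r0 (f1 x) = f1 (r0 x)) (h11 : ∀ x, r1 (f1 x) = f1 (r1 x)) :
    Dat (BD d r0 r1) (f0.compLeft ℕ) (f1.compLeft ℕ) (BP P) where
  neg := BP_neg h.neg
  d_mem := BD_mem h
  r0_mem q x hx j := m0 _ _ (hx j)
  r1_mem q x hx j := m1 _ _ (hx j)
  dd := BD_BD h
  r01 x := funext fun j => f01 _
  r10 x := funext fun j => f10 _
  c0 x := by
    funext j
    simp only [BD_apply, LinearMap.compLeft_apply, Function.comp]
    split_ifs <;> simp [hd0, h00, h10]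
  c1 x := by
    funext j
    simp only [BD_apply, LinearMap.compLeft_apply, Function.comp]
    split_ifs <;> simp [hd1, h01, h11]

/-- Vanishing of the relative homology of `(P, P')` in degree `q`. -/
def RelEx (d : End k E) (P P' : ℤ → Submodule k E) (q : ℤ) : Prop :=
  ∀ x ∈ P q, d x ∈ P' (q - 1) → ∃ y ∈ P (q + 1), x - d y ∈ P' q

lemma RelEx.neg {q : ℤ} (h : RelEx d P P' q) : RelEx (-d) P P' q := by
  intro x hx hd
  obtain ⟨y, hy, hy'⟩ := h x hx (by simpa using hd)
  exact ⟨-y, neg_mem hy, by simpa using hy'⟩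

lemma relEx_bor_aux (N : ℕ) : ∀ (q : ℤ) (_ : q < N) {d r0 r1 : End k E}
    (_ : Dat d r0 r1 P) (_ : Dat d r0 r1 P')
    (_ : ∀ i ≤ q, RelEx d P P' i), RelEx (BD d r0 r1) (BP P) (BP P') q := by
  induction N with
  | zero =>
    intro q hq d r0 r1 h h' _ x hx _
    rw [BP_neg h.neg q (by simpa using hq), Submodule.mem_bot] at hx
    exact ⟨0, zero_mem _, by simp [hx]⟩
  | succ N ih =>
    intro q hq d r0 r1 h h' hex x hx hdx
    rw [← cs_eta x] at hx hdx ⊢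
    set x0 := x 0
    set x' := fun j => x (j + 1)
    obtain ⟨h0, hx'⟩ := cs_mem_BP.1 hx
    rw [BD_cs] at hdx
    obtain ⟨hd0, hd'⟩ := cs_mem_BP.1 hdx
    obtain ⟨w, hw, hw'⟩ := ih (q - 1) (by push_cast at hq; omega) h.shift h'.shift
      (fun i hi => (hex i (by omega)).neg) x' hx' hd'
    have e : q - 1 + 1 = q := by ring
    rw [e] at hw
    have hw0 : w 0 ∈ P q := by simpa using hw 0
    have hp0 : (x' - BD (-d) r1 r0 w) 0 ∈ P' (q - 1) := by simpa using hw' 0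
    have key : d (x0 - r0 (w 0)) ∈ P' (q - 1) := by
      have : d (x0 - r0 (w 0)) = (d x0 + r0 (x' 0)) - r0 ((x' - BD (-d) r1 r0 w) 0) := by
        simp only [map_sub, Pi.sub_apply, BD_apply]
        simp [h.r01, h.c0]
        abel
      rw [this]
      exact sub_mem hd0 (h'.r0_mem _ _ hp0)
    obtain ⟨y, hy, hy'⟩ := hex q le_rfl (x0 - r0 (w 0)) (sub_mem h0 (h.r0_mem _ _ hw0)) key
    refine ⟨cs y w, cs_mem_BP.2 ⟨hy, by rwa [show q + 1 - 1 = q by ring]⟩, ?_⟩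
    rw [BD_cs, cs_sub]
    refine cs_mem_BP.2 ⟨?_, hw'⟩
    have : x0 - (d y + r0 (w 0)) = x0 - r0 (w 0) - d y := by abel
    rwa [this]

lemma relEx_bor (h : Dat d r0 r1 P) (h' : Dat d r0 r1 P') {q : ℤ}
    (hex : ∀ i ≤ q, RelEx d P P' i) : RelEx (BD d r0 r1) (BP P) (BP P') q :=
  relEx_bor_aux (q + 1).toNat q (by omega) h h' hex

lemma Dat.bot (h : Dat d r0 r1 P) : Dat d r0 r1 (fun _ => ⊥) where
  neg _ _ := rfl
  d_mem q x hx := by simp_all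
  r0_mem q x hx := by simp_all
  r1_mem q x hx := by simp_all
  dd := h.dd
  r01 := h.r01
  r10 := h.r10
  c0 := h.c0
  c1 := h.c1

lemma BP_bot : BP (fun _ => (⊥ : Submodule k E)) = fun _ => ⊥ := by
  funext q
  rw [eq_bot_iff]
  intro x hx
  exact (Submodule.mem_bot k).2 (funext fun j => by simpa using hx j)

/-- The homology of `P` is one-dimensional, concentrated in degree `m` and generated by `z`. -/
structure OneDim (d : End k E) (P : ℤ → Submodule k E) (m : ℤ) (z : E) : Prop where
  mem : z ∈ P m
  cyc : d z = 0
  nb : ∀ y ∈ P (m + 1), d y ≠ z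
  ex : ∀ q ≠ m, ∀ x ∈ P q, d x = 0 → ∃ y ∈ P (q + 1), d y = x
  gen : ∀ x ∈ P m, d x = 0 → ∃ c : k, ∃ y ∈ P (m + 1), x = c • z + d y

lemma OneDim.neg {m : ℤ} {z : E} (h : OneDim d P m z) : OneDim (-d) P m z where
  mem := h.mem
  cyc := by simp [h.cyc]
  nb y hy e := h.nb (-y) (neg_mem hy) (by simpa using e)
  ex q hq x hx hd := by
    obtain ⟨y, hy, e⟩ := h.ex q hq x hx (by simpa using hd)
    exact ⟨-y, neg_mem hy, by simpa using e⟩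
  gen x hx hd := by
    obtain ⟨c, y, hy, e⟩ := h.gen x hx (by simpa using hd)
    exact ⟨c, -y, neg_mem hy, by simpa using e⟩

lemma OneDim.relEx {m : ℤ} {z : E} (h : OneDim d P m z) (q : ℤ) (hq : q ≠ m) :
    RelEx d P (fun _ => ⊥) q := by
  intro x hx hd
  obtain ⟨y, hy, e⟩ := h.ex q hq x hx (by simpa using hd)
  exact ⟨y, hy, by simp [e]⟩

lemma OneDim.bor_ex {m : ℤ} {z : E} (h : OneDim d P m z) (hd : Dat d r0 r1 P) {q : ℤ}
    (hq : q < m) (x : ℕ → E) (hx : x ∈ BP P q) (hx0 : BD d r0 r1 x = 0) :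
    ∃ y ∈ BP P (q + 1), x = BD d r0 r1 y := by
  have := relEx_bor hd hd.bot (q := q) (fun i hi => h.relEx i (by omega))
  rw [BP_bot] at this
  obtain ⟨y, hy, e⟩ := this x hx (by simp [hx0])
  exact ⟨y, hy, sub_eq_zero.1 (by simpa using e)⟩

lemma cs_zero_zero : cs (0 : E) 0 = 0 := by funext j; cases j <;> rfl

lemma lift_cycle (hd : Dat d r0 r1 P) {q : ℤ} {x w : ℕ → E} (hx : x ∈ BP P q)
    (hx0 : BD d r0 r1 x = 0) (hw : w ∈ BP P q)
    (e : (fun j => x (j + 1)) = BD (-d) r1 r0 w) :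
    ∃ c ∈ P q, d c = 0 ∧ x = BD d r0 r1 (cs 0 w) + cs c 0 := by
  refine ⟨x 0 - r0 (w 0), sub_mem (by simpa using hx 0)
    (hd.r0_mem _ _ (by simpa using hw 0)), ?_, ?_⟩
  · have h0 := congrFun hx0 0
    have h1 := congrFun e 0
    simp [BD_apply] at h0 h1
    rw [h1] at h0
    simp [hd.r01] at h0
    rw [map_sub, hd.c0, sub_eq_add_neg, h0]
  · conv_lhs => rw [← cs_eta x, e]
    rw [BD_cs, cs_add]
    simp

lemma OneDim.bor_top {m : ℤ} {z : E} (h : OneDim d P m z) (hd : Dat d r0 r1 P)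
    (x : ℕ → E) (hx : x ∈ BP P m) (hx0 : BD d r0 r1 x = 0) :
    ∃ c ∈ P m, d c = 0 ∧ ∃ y ∈ BP P (m + 1), x = BD d r0 r1 y + cs c 0 := by
  have hx' := hx
  have hx0' := hx0
  rw [← cs_eta x, BD_cs, ← cs_zero_zero] at hx0'
  rw [← cs_eta x] at hx'
  have h1 : BD (-d) r1 r0 (fun j => x (j + 1)) = 0 := by
    funext j; exact congrFun hx0' (j + 1)
  obtain ⟨w, hw, e⟩ := h.neg.bor_ex hd.shift (q := m - 1) (by omega) _ (cs_mem_BP.1 hx').2 h1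
  rw [sub_add_cancel] at hw
  obtain ⟨c, hc, hdc, he⟩ := lift_cycle hd hx hx0 hw e
  exact ⟨c, hc, hdc, cs 0 w, cs_mem_BP.2 ⟨zero_mem _, by rwa [add_sub_cancel_right]⟩, he⟩

/-- `r0` and `r1` send the generator to boundaries. -/
def RBd (d r0 r1 : End k E) (P : ℤ → Submodule k E) (m : ℤ) (z : E) : Prop :=
  (∃ y ∈ P (m + 1), d y = r0 z) ∧ ∃ y ∈ P (m + 1), d y = r1 z

lemma RBd.shift {m : ℤ} {z : E} (h : RBd d r0 r1 P m z) : RBd (-d) r1 r0 P m z := by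
  obtain ⟨⟨y, hy, e⟩, y', hy', e'⟩ := h
  exact ⟨⟨-y', neg_mem hy', by simpa using e'⟩, -y, neg_mem hy, by simpa using e⟩

lemma OneDim.inc_bd {m : ℤ} {z : E} (h : OneDim d P m z) (hd : Dat d r0 r1 P)
    (hr : RBd d r0 r1 P m z) {c : E} {w : ℕ → E} (hw : w ∈ BP P (m + 1))
    (e : BD d r0 r1 w = cs c 0) : ∃ y ∈ P (m + 1), d y = c := by
  rw [← cs_eta w, BD_cs] at e
  rw [← cs_eta w] at hw
  obtain ⟨hw0, hw'⟩ := cs_mem_BP.1 hw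
  rw [add_sub_cancel_right] at hw'
  have e0 : d (w 0) + r0 (w 1) = c := congrFun e 0
  have e1 : BD (-d) r1 r0 (fun j => w (j + 1)) = 0 := funext fun j => congrFun e (j + 1)
  obtain ⟨c', hc', hdc', u, hu, eu⟩ := h.neg.bor_top hd.shift _ hw' e1
  obtain ⟨l, y, hy, ey⟩ := h.gen c' hc' (by simpa using hdc')
  obtain ⟨⟨y', hy', ey'⟩, -⟩ := hr
  have e2 : w 1 = -d (u 0) + r1 (u 1) + c' := by
    have := congrFun eu 0
    simpa [BD_apply] using this
  refine ⟨w 0 - r0 (u 0) + l • y' + r0 y, ?_, ?_⟩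
  · exact add_mem (add_mem (sub_mem hw0 (hd.r0_mem _ _ (by simpa using hu 0)))
      (Submodule.smul_mem _ _ hy')) (hd.r0_mem _ _ hy)
  · rw [← e0, e2, ey]
    simp [hd.r01, hd.c0, ey']
    abel

lemma OneDim.tower {m : ℤ} (N : ℕ) : ∀ {d r0 r1 : End k E} {z : E} (_ : OneDim d P m z)
    (_ : Dat d r0 r1 P) (_ : RBd d r0 r1 P m z),
    ∃ x ∈ BP P (m + N), BD d r0 r1 x = 0 ∧ x N = z ∧ ∀ j > N, x j = 0 := by
  induction N with
  | zero =>
    intro d r0 r1 z h hd hr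
    refine ⟨cs z 0, cs_mem_BP.2 ⟨by simpa using h.mem, zero_mem _⟩, ?_, rfl, ?_⟩
    · rw [BD_cs]; simp [h.cyc, cs_zero_zero]
    · intro j hj; cases j with
      | zero => omega
      | succ j => rfl
  | succ N ih =>
    intro d r0 r1 z h hd hr
    obtain ⟨t, ht, ht0, htN, htj⟩ := ih h.neg hd.shift hr.shift
    have t0 : t 0 ∈ P (m + N) := by simpa using ht 0
    have : ∃ y ∈ P (m + N + 1), d y = r0 (t 0) := by
      cases N with
      | zero => rw [htN]; simpa using hr.1
      | succ N =>
        refine h.ex _ (by push_cast; omega) _ (hd.r0_mem _ _ t0) ?_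
        have h0 := congrFun ht0 0
        simp [BD_apply] at h0
        have : d (t 0) = r1 (t 1) := by
          have := neg_eq_iff_add_eq_zero.2 h0
          simpa using this
        rw [hd.c0, this, hd.r01]
    obtain ⟨y, hy, ey⟩ := this
    refine ⟨cs (-y) t, cs_mem_BP.2 ⟨neg_mem (by push_cast; rwa [← add_assoc]), ?_⟩, ?_, htN, ?_⟩
    · have : m + ((N + 1 : ℕ) : ℤ) - 1 = m + N := by push_cast; ring
      rwa [this]
    · rw [BD_cs, ht0]; simp [ey, cs_zero_zero]
    · intro j hj; cases j with
      | zero => omega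
      | succ j => exact htj j (by omega)

end Bor

end SmithFlag

namespace SmithFlag

open Module

section Rank

variable {k : Type} [Field k]

lemma rank_le_of_exact {A B C : Type} [AddCommGroup A] [Module k A] [AddCommGroup B] [Module k B]
    [AddCommGroup C] [Module k C] (i : A →ₗ[k] B) (v : B →ₗ[k] C) (SA : Submodule k A)
    (SB : Submodule k B) (SC : Submodule k C) (h1 : ∀ b ∈ SB, v b ∈ SC)
    (h2 : ∀ b ∈ SB, v b = 0 → ∃ a ∈ SA, i a = b) :
    Module.rank k SB ≤ Module.rank k SC + Module.rank k SA := by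
  set f : SB →ₗ[k] SC := v.restrict h1
  rw [← LinearMap.rank_range_add_rank_ker f]
  refine add_le_add (Submodule.rank_le _) ?_
  have h3 : (LinearMap.ker f).map SB.subtype ≤ SA.map i := by
    rintro _ ⟨b, hb, rfl⟩
    have : v b = 0 := congrArg Subtype.val (LinearMap.mem_ker.1 hb)
    obtain ⟨a, ha, e⟩ := h2 b b.2 this
    exact ⟨a, ha, e⟩
  calc Module.rank k (LinearMap.ker f)
      = Module.rank k ((LinearMap.ker f).map SB.subtype) :=
        (LinearEquiv.rank_eq (Submodule.equivMapOfInjective _ SB.injective_subtype _))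
    _ ≤ Module.rank k (SA.map i) := Submodule.rank_mono h3
    _ ≤ Module.rank k SA := rank_map_le _ _

variable {E : Type} [AddCommGroup E] [Module k E]

/-- Cycles of degree `q`. -/
def Cyc (d : End k E) (P : ℤ → Submodule k E) (q : ℤ) : Submodule k E := P q ⊓ LinearMap.ker d

/-- Boundaries of degree `q`. -/
def Bd (d : End k E) (P : ℤ → Submodule k E) (q : ℤ) : Submodule k E := (P (q + 1)).map d

/-- The rank of the homology in degree `q`. -/
noncomputable def hr (d : End k E) (P : ℤ → Submodule k E) (q : ℤ) : Cardinal :=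
  Module.rank k ((Cyc d P q).map (Bd d P q).mkQ)

variable {d r0 r1 : End k E} {P P' : ℤ → Submodule k E}

lemma Cyc_neg (q : ℤ) : Cyc (-d) P q = Cyc d P q := by
  ext x; simp [Cyc]

lemma Bd_neg (q : ℤ) : Bd (-d) P q = Bd d P q := by
  ext x
  constructor
  · rintro ⟨y, hy, rfl⟩; exact ⟨-y, neg_mem hy, by simp⟩
  · rintro ⟨y, hy, rfl⟩; exact ⟨-y, neg_mem hy, by simp⟩

lemma hr_neg (q : ℤ) : hr (-d) P q = hr d P q := by
  rw [hr, hr, Cyc_neg, Bd_neg]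

/-- The inclusion of the first summand. -/
def inc : E →ₗ[k] (ℕ → E) where
  toFun c := cs c 0
  map_add' _ _ := by rw [cs_add]; simp
  map_smul' _ _ := by funext j; cases j <;> simp

/-- The shift. -/
def sh : (ℕ → E) →ₗ[k] (ℕ → E) where
  toFun x j := x (j + 1)
  map_add' _ _ := rfl
  map_smul' _ _ := rfl

lemma BD_sh (x : ℕ → E) : sh (k := k) (BD d r0 r1 x) = BD (-d) r1 r0 (sh (k := k) x) := by
  conv_lhs => rw [← cs_eta x, BD_cs]
  rfl

lemma sh_mem {q : ℤ} {x : ℕ → E} (hx : x ∈ BP P q) : sh (k := k) x ∈ BP P (q - 1) := by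
  rw [← cs_eta x] at hx
  exact (cs_mem_BP.1 hx).2

lemma hr_bor_le (hd : Dat d r0 r1 P) (q : ℤ) :
    hr (BD d r0 r1) (BP P) q ≤ hr (BD (-d) r1 r0) (BP P) (q - 1) + hr d P q := by
  have hi : Bd d P q ≤ (Bd (BD d r0 r1) (BP P) q).comap inc := by
    rintro _ ⟨y, hy, rfl⟩
    refine ⟨cs y 0, cs_mem_BP.2 ⟨hy, zero_mem _⟩, ?_⟩
    rw [BD_cs]; simp [inc]
  have hv : Bd (BD d r0 r1) (BP P) q ≤ (Bd (BD (-d) r1 r0) (BP P) (q - 1)).comap sh := by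
    rintro _ ⟨y, hy, rfl⟩
    refine ⟨sh (k := k) y, ?_, (BD_sh y).symm⟩
    have := sh_mem hy
    rwa [show q + 1 - 1 = q - 1 + 1 by ring] at this
  refine rank_le_of_exact (Submodule.mapQ _ _ inc hi) (Submodule.mapQ _ _ sh hv) _ _ _ ?_ ?_
  · rintro _ ⟨x, ⟨hx, hx0⟩, rfl⟩
    refine ⟨sh (k := k) x, ⟨sh_mem hx, ?_⟩, rfl⟩
    change BD (-d) r1 r0 (sh (k := k) x) = 0
    rw [← BD_sh, LinearMap.mem_ker.1 hx0, map_zero]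
  · rintro _ ⟨x, ⟨hx, hx0⟩, rfl⟩ h
    rw [Submodule.mkQ_apply, Submodule.mapQ_apply, Submodule.Quotient.mk_eq_zero] at h
    obtain ⟨w, hw, e⟩ := h
    rw [sub_add_cancel] at hw
    obtain ⟨c, hc, hdc, ec⟩ := lift_cycle hd hx hx0 hw e.symm
    refine ⟨Submodule.Quotient.mk c, ⟨c, ⟨hc, hdc⟩, rfl⟩, ?_⟩
    rw [Submodule.mapQ_apply, Submodule.mkQ_apply, Submodule.Quotient.eq]
    refine ⟨-cs 0 w, neg_mem (cs_mem_BP.2 ⟨zero_mem _, by rwa [add_sub_cancel_right]⟩), ?_⟩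
    rw [map_neg, ec]
    simp [inc]

lemma hr_of_neg (h : ∀ q < 0, P q = ⊥) (q : ℤ) (hq : q < 0) : hr d P q = 0 := by
  rw [hr, Cyc, h q hq]
  simp

lemma hr_bor_sum (N : ℕ) : ∀ {d r0 r1 : End k E} (_ : Dat d r0 r1 P),
    hr (BD d r0 r1) (BP P) ((N : ℤ) - 1) ≤ ∑ i ∈ Finset.range N, hr d P i := by
  induction N with
  | zero => intro d r0 r1 hd; rw [hr_of_neg (BP_neg hd.neg) _ (by simp)]; exact zero_le
  | succ N ih =>
    intro d r0 r1 hd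
    rw [Finset.sum_range_succ]
    have := hr_bor_le hd N
    rw [show ((N + 1 : ℕ) : ℤ) - 1 = N by push_cast; ring]
    refine this.trans (add_le_add_left ?_ _)
    refine (ih hd.shift).trans ?_
    simp_rw [hr_neg]; exact le_rfl

lemma OneDim.hr_le {m : ℤ} {z : E} (h : OneDim d P m z) (q : ℤ) :
    hr d P q ≤ if q = m then 1 else 0 := by
  split_ifs with hq
  · subst hq
    refine (Submodule.rank_mono (t := Submodule.span k {(Bd d P q).mkQ z}) ?_).trans
      (rank_span_le _ |>.trans (by simp))
    rintro _ ⟨x, ⟨hx, hx0⟩, rfl⟩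
    obtain ⟨c, y, hy, e⟩ := h.gen x hx hx0
    refine Submodule.mem_span_singleton.2 ⟨c, ?_⟩
    rw [← map_smul, Submodule.mkQ_apply, Submodule.mkQ_apply, Submodule.Quotient.eq]
    exact ⟨-y, neg_mem hy, by rw [e]; simp⟩
  · refine le_of_eq ?_
    rw [hr, rank_eq_zero_iff]
    rintro ⟨_, x, ⟨hx, hx0⟩, rfl⟩
    refine ⟨1, one_ne_zero, ?_⟩
    obtain ⟨y, hy, e⟩ := h.ex q hq x hx hx0
    rw [one_smul]
    exact Subtype.ext ((Submodule.Quotient.mk_eq_zero _).2 ⟨y, hy, e⟩)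

lemma exists_relation {q : ℤ} {r : ℕ} (hr' : hr d P q ≤ r) {ι : Type} [Fintype ι]
    (hι : r < Fintype.card ι) (x : ι → E) (hx : ∀ i, x i ∈ P q) (hx0 : ∀ i, d (x i) = 0) :
    ∃ c : ι → k, c ≠ 0 ∧ ∃ y ∈ P (q + 1), d y = ∑ i, c i • x i := by
  set f : ι → (Cyc d P q).map (Bd d P q).mkQ := fun i => ⟨_, x i, ⟨hx i, hx0 i⟩, rfl⟩
  have : ¬ LinearIndependent k f := by
    intro hf
    have := hf.cardinal_le_rank.trans hr'
    rw [Cardinal.mk_fintype] at this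
    exact absurd (Nat.cast_le.1 this) (by omega)
  obtain ⟨c, hc, i, hi⟩ := Fintype.not_linearIndependent_iff.1 this
  refine ⟨c, fun h => hi (congrFun h i), ?_⟩
  have h2 := congrArg Subtype.val hc
  have h3 : (Bd d P q).mkQ (∑ i, c i • x i) = 0 := by
    simpa [f, Submodule.coe_sum] using h2
  exact (Submodule.Quotient.mk_eq_zero _).1 h3

lemma OneDim.hr_bor_le {m : ℤ} {z : E} (h : OneDim d P m z) (hd : Dat d r0 r1 P) (q : ℤ) :
    hr (BD d r0 r1) (BP P) q ≤ if m ≤ q then 1 else 0 := by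
  rcases lt_or_ge q 0 with hq | hq
  · rw [hr_of_neg (BP_neg hd.neg) _ hq]; exact zero_le
  obtain ⟨N, rfl⟩ := Int.eq_ofNat_of_zero_le hq
  have := hr_bor_sum (N + 1) hd
  rw [show ((N + 1 : ℕ) : ℤ) - 1 = N by push_cast; ring] at this
  refine this.trans ((Finset.sum_le_sum fun (i : ℕ) _ => h.hr_le (i : ℤ)).trans ?_)
  split_ifs with hm
  · rcases lt_or_ge m 0 with h0 | h0
    · rw [Finset.sum_eq_zero]
      · exact zero_le
      · intro i _; rw [if_neg (by omega)]
    · obtain ⟨m, rfl⟩ := Int.eq_ofNat_of_zero_le h0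
      simp only [Nat.cast_inj]
      rw [Finset.sum_ite_eq']
      split_ifs <;> simp
  · rw [Finset.sum_eq_zero]
    intro i hi
    rw [Finset.mem_range] at hi
    rw [if_neg (by omega)]

end Rank

end SmithFlag

namespace SmithFlag

open Module

section Nil

variable {k : Type} [Field k] {E : Type} [AddCommGroup E] [Module k E]
variable {d r0 r1 u K : End k E} {P P' P₁ P₂ : ℤ → Submodule k E}

/-- `u ^ N` kills the relative homology of `(P, P')`. -/
def Nil (d : End k E) (P P' : ℤ → Submodule k E) (u : End k E) (N : ℕ) : Prop :=
  ∀ q, ∀ x ∈ P q, d x ∈ P' (q - 1) →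
    ∃ y ∈ P (q + 1 - 2 * N), (u ^ N) x - d y ∈ P' (q - 2 * N)

/-- `u` is a chain map of degree `-2`. -/
structure Deg2 (d : End k E) (P : ℤ → Submodule k E) (u : End k E) : Prop where
  mem : ∀ q, ∀ x ∈ P q, u x ∈ P (q - 2)
  comm : ∀ x, u (d x) = d (u x)

lemma Deg2.pow_mem (h : Deg2 d P u) (N : ℕ) : ∀ q, ∀ x ∈ P q, (u ^ N) x ∈ P (q - 2 * N) := by
  induction N with
  | zero => intro q x hx; simpa using hx
  | succ N ih =>
    intro q x hx
    rw [pow_succ]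
    have := ih _ _ (h.mem q x hx)
    rw [show q - 2 * ((N + 1 : ℕ) : ℤ) = q - 2 - 2 * N by push_cast; ring]
    exact this

lemma Deg2.pow_comm (h : Deg2 d P u) (N : ℕ) (x : E) : (u ^ N) (d x) = d ((u ^ N) x) := by
  induction N generalizing x with
  | zero => rfl
  | succ N ih => rw [pow_succ]; simp [Module.End.mul_apply, h.comm, ih]

lemma nil_zero (h : ∀ q, RelEx d P P' q) : Nil d P P' u 0 := by
  intro q x hx hd
  obtain ⟨y, hy, e⟩ := h q x hx hd
  exact ⟨y, by simpa using hy, by simpa using e⟩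

lemma Nil.trans (hdd : ∀ x, d (d x) = 0) (hu : Deg2 d P u) (hu2 : Deg2 d P₂ u)
    (h1 : ∀ q, P₁ q ≤ P q) (h2 : ∀ q, P₂ q ≤ P₁ q) {M N : ℕ} (hM : Nil d P P₁ u M)
    (hN : Nil d P₁ P₂ u N) : Nil d P P₂ u (M + N) := by
  intro q x hx hd
  obtain ⟨y, hy, e⟩ := hM q x hx (h2 _ hd)
  have h3 : d ((u ^ M) x - d y) ∈ P₂ (q - 2 * M - 1) := by
    rw [map_sub, hdd, sub_zero, ← hu.pow_comm]
    have := hu2.pow_mem M _ _ hd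
    rwa [show q - 1 - 2 * (M : ℤ) = q - 2 * M - 1 by ring] at this
  obtain ⟨w, hw, e4⟩ := hN _ _ e h3
  refine ⟨(u ^ N) y + w, add_mem ?_ (h1 _ ?_), ?_⟩
  · have := hu.pow_mem N _ _ hy
    rwa [show q + 1 - 2 * (M : ℤ) - 2 * N = q + 1 - 2 * ((M + N : ℕ) : ℤ) by push_cast; ring]
      at this
  · rwa [show q - 2 * (M : ℤ) + 1 - 2 * N = q + 1 - 2 * ((M + N : ℕ) : ℤ) by push_cast; ring]
      at hw
  · rw [show q - 2 * ((M + N : ℕ) : ℤ) = q - 2 * M - 2 * N by push_cast; ring]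
    have e3 : (u ^ (M + N)) x - d ((u ^ N) y + w) = (u ^ N) ((u ^ M) x - d y) - d w := by
      rw [add_comm M N, pow_add, Module.End.mul_apply, map_add, map_sub, hu.pow_comm]
      abel
    rw [e3]
    exact e4

/-- `K` is a null-homotopy of `u` on `P` modulo `P'`. -/
structure Step (d : End k E) (P P' : ℤ → Submodule k E) (u K : End k E) : Prop where
  mem : ∀ q, ∀ x ∈ P q, K x ∈ P (q - 1)
  mem' : ∀ q, ∀ x ∈ P' q, K x ∈ P' (q - 1)
  htpy : ∀ q, ∀ x ∈ P q, d (K x) + K (d x) - u x ∈ P' (q - 2)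

lemma Step.nil (h : Step d P P' u K) : Nil d P P' u 1 := by
  intro q x hx hd
  refine ⟨K x, ?_, ?_⟩
  · have := h.mem q x hx
    rwa [show q + 1 - 2 * ((1 : ℕ) : ℤ) = q - 1 by push_cast; ring]
  · have h1 := h.mem' _ _ hd
    have h2 := h.htpy q x hx
    rw [show q - 1 - 1 = q - 2 by ring] at h1
    rw [show q - 2 * ((1 : ℕ) : ℤ) = q - 2 by push_cast; ring, pow_one]
    have e : u x - d (K x) = K (d x) - (d (K x) + K (d x) - u x) := by abel
    rw [e]
    exact sub_mem h1 h2

/-- The termwise alternating extension of a homotopy. -/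
def altMap (K : End k E) : End k (ℕ → E) :=
  LinearMap.pi fun j => ((-1 : k) ^ j) • K ∘ₗ LinearMap.proj j

lemma altMap_apply (K : End k E) (x : ℕ → E) (j : ℕ) : altMap K x j = ((-1 : k) ^ j) • K (x j) :=
  rfl

lemma neg_one_pow_sq (j : ℕ) (x : E) : ((-1 : k) ^ j) • ((-1 : k) ^ j) • x = x := by
  rw [smul_smul, ← pow_add, ← two_mul, pow_mul]; simp

lemma Step.bor (h : Step d P P' u K) (c0 : ∀ x, K (r0 x) = r0 (K x))
    (c1 : ∀ x, K (r1 x) = r1 (K x)) :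
    Step (BD d r0 r1) (BP P) (BP P') (u.compLeft ℕ) (altMap K) where
  mem q x hx j := by
    rw [altMap_apply, show q - 1 - (j : ℤ) = q - j - 1 by ring]
    exact Submodule.smul_mem _ _ (h.mem _ _ (hx j))
  mem' q x hx j := by
    rw [altMap_apply, show q - 1 - (j : ℤ) = q - j - 1 by ring]
    exact Submodule.smul_mem _ _ (h.mem' _ _ (hx j))
  htpy q x hx j := by
    have : (BD d r0 r1 (altMap K x) + altMap K (BD d r0 r1 x) - u.compLeft ℕ x) j =
        d (K (x j)) + K (d (x j)) - u (x j) := by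
      simp only [Pi.add_apply, Pi.sub_apply, BD_apply, altMap_apply, map_add, map_smul, smul_add,
        LinearMap.compLeft_apply, Function.comp, neg_one_pow_sq]
      have : ((-1 : k) ^ (j + 1)) = - (-1) ^ j := by ring
      rw [this]
      split_ifs
      · rw [c0]; simp; abel
      · rw [c1]; simp; abel
    rw [this, show q - 2 - (j : ℤ) = q - j - 2 by ring]
    exact h.htpy _ _ (hx j)

lemma Deg2.bor (h : Deg2 d P u) (c0 : ∀ x, u (r0 x) = r0 (u x))
    (c1 : ∀ x, u (r1 x) = r1 (u x)) : Deg2 (BD d r0 r1) (BP P) (u.compLeft ℕ) where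
  mem q x hx j := by
    rw [show q - 2 - (j : ℤ) = q - j - 2 by ring]
    exact h.mem _ _ (hx j)
  comm x := by
    funext j
    simp only [BD_apply, LinearMap.compLeft_apply, Function.comp, map_add, map_smul, h.comm]
    split_ifs
    · rw [c0]
    · rw [c1]

/-- The double shift. -/
def sh2 : End k (ℕ → E) := LinearMap.pi fun j => LinearMap.proj (j + 2)

lemma sh2_apply (x : ℕ → E) (j : ℕ) : sh2 (k := k) x j = x (j + 1 + 1) := rfl

lemma sh2_pow (N : ℕ) (x : ℕ → E) (j : ℕ) : ((sh2 (k := k)) ^ N) x j = x (j + 2 * N) := by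
  induction N generalizing x with
  | zero => rfl
  | succ N ih =>
    rw [pow_succ, Module.End.mul_apply, ih, sh2_apply]
    congr 1

lemma compLeft_pow (N : ℕ) (x : ℕ → E) (j : ℕ) : ((u.compLeft ℕ) ^ N) x j = (u ^ N) (x j) := by
  induction N generalizing x with
  | zero => rfl
  | succ N ih =>
    rw [pow_succ, Module.End.mul_apply, ih, pow_succ, Module.End.mul_apply]
    rfl

lemma deg2_sh2 : Deg2 (BD d r0 r1) (BP P) sh2 where
  mem q x hx j := by
    rw [sh2_apply, show q - 2 - (j : ℤ) = q - ((j + 1 + 1 : ℕ) : ℤ) by push_cast; ring]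
    exact hx _
  comm x := by
    funext j
    simp only [sh2_apply, BD_apply]
    simp [Nat.even_add_one, pow_add]

/-- The homotopy built from a splitting. -/
def splitK (s β : End k E) : End k (ℕ → E) :=
  LinearMap.pi fun j => (if Even j then s else β) ∘ₗ LinearMap.proj (j + 1)

lemma splitK_apply (s β : End k E) (x : ℕ → E) (j : ℕ) :
    splitK s β x j = (if Even j then s else β) (x (j + 1)) := rfl

/-- The identities making `splitK` a homotopy. -/
structure Split (d r0 r1 : End k E) (P P' : ℤ → Submodule k E) (s β : End k E) : Prop where
  s_mem : ∀ q, ∀ x ∈ P q, s x ∈ P q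
  s_mem' : ∀ q, ∀ x ∈ P' q, s x ∈ P' q
  b_mem : ∀ q, ∀ x ∈ P q, β x ∈ P q
  b_mem' : ∀ q, ∀ x ∈ P' q, β x ∈ P' q
  ds : ∀ q, ∀ x ∈ P q, d (s x) - s (d x) ∈ P' (q - 1)
  db : ∀ q, ∀ x ∈ P q, d (β x) - β (d x) ∈ P' (q - 1)
  e0 : ∀ q, ∀ x ∈ P q, r0 (β x) + s (r1 x) - x ∈ P' q
  e1 : ∀ q, ∀ x ∈ P q, r1 (s x) + β (r0 x) - x ∈ P' q

lemma Split.step {s β : End k E} (h : Split d r0 r1 P P' s β) :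
    Step (BD d r0 r1) (BP P) (BP P') sh2 (splitK s β) where
  mem q x hx j := by
    rw [splitK_apply, show q - 1 - (j : ℤ) = q - ((j + 1 : ℕ) : ℤ) by push_cast; ring]
    split_ifs
    · exact h.s_mem _ _ (hx _)
    · exact h.b_mem _ _ (hx _)
  mem' q x hx j := by
    rw [splitK_apply, show q - 1 - (j : ℤ) = q - ((j + 1 : ℕ) : ℤ) by push_cast; ring]
    split_ifs
    · exact h.s_mem' _ _ (hx _)
    · exact h.b_mem' _ _ (hx _)
  htpy q x hx j := by
    have e1 : q - ((j + 1 : ℕ) : ℤ) - 1 = q - 2 - j := by push_cast; ring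
    have e2 : q - ((j + 1 + 1 : ℕ) : ℤ) = q - 2 - j := by push_cast; ring
    have hp : ((-1 : k) ^ (j + 1)) = - (-1) ^ j := by ring
    simp only [Pi.add_apply, Pi.sub_apply, BD_apply, splitK_apply, sh2_apply, Nat.even_add_one]
    by_cases hj : Even j
    · have a1 := h.ds _ _ (hx (j + 1))
      have a2 := h.e0 _ _ (hx (j + 1 + 1))
      rw [e1] at a1
      rw [e2] at a2
      have := add_mem (Submodule.smul_mem _ ((-1 : k) ^ j) a1) a2
      convert this using 1
      simp only [hj, if_true, not_true, if_false, map_add, map_neg, map_smul, smul_sub, hp,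
        neg_smul]
      abel
    · have a1 := h.db _ _ (hx (j + 1))
      have a2 := h.e1 _ _ (hx (j + 1 + 1))
      rw [e1] at a1
      rw [e2] at a2
      have := add_mem (Submodule.smul_mem _ ((-1 : k) ^ j) a1) a2
      convert this using 1
      simp only [hj, if_true, not_false_iff, if_false, map_add, map_neg, map_smul, smul_sub, hp,
        neg_smul]
      abel

lemma Split.bor {a0 a1 s β : End k E} (h : Split d r0 r1 P P' s β)
    (sa0 : ∀ x, s (a0 x) = a0 (s x)) (sa1 : ∀ x, s (a1 x) = a1 (s x))
    (ba0 : ∀ x, β (a0 x) = a0 (β x)) (ba1 : ∀ x, β (a1 x) = a1 (β x)) :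
    Split (BD d a0 a1) (r0.compLeft ℕ) (r1.compLeft ℕ) (BP P) (BP P') (s.compLeft ℕ)
      (β.compLeft ℕ) where
  s_mem q x hx j := h.s_mem _ _ (hx j)
  s_mem' q x hx j := h.s_mem' _ _ (hx j)
  b_mem q x hx j := h.b_mem _ _ (hx j)
  b_mem' q x hx j := h.b_mem' _ _ (hx j)
  ds q x hx j := by
    have := Submodule.smul_mem _ ((-1 : k) ^ j) (h.ds _ _ (hx j))
    rw [show q - 1 - (j : ℤ) = q - j - 1 by ring]
    convert this using 1
    simp only [Pi.sub_apply, BD_apply, LinearMap.compLeft_apply, Function.comp, map_add, map_smul,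
      smul_sub]
    split_ifs
    · rw [sa0]; abel
    · rw [sa1]; abel
  db q x hx j := by
    have := Submodule.smul_mem _ ((-1 : k) ^ j) (h.db _ _ (hx j))
    rw [show q - 1 - (j : ℤ) = q - j - 1 by ring]
    convert this using 1
    simp only [Pi.sub_apply, BD_apply, LinearMap.compLeft_apply, Function.comp, map_add, map_smul,
      smul_sub]
    split_ifs
    · rw [ba0]; abel
    · rw [ba1]; abel
  e0 q x hx j := h.e0 _ _ (hx j)
  e1 q x hx j := h.e1 _ _ (hx j)

end Nil

section SplitRing

variable {R : Type} [Ring R]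

lemma split_identities {p : ℕ} {g h s : R} (hg : h * g = 1) (hh : g * h = 1) (hp : g ^ p = 1) :
    let σ := ∑ i ∈ Finset.range p, g ^ i
    let Q := ∑ i ∈ Finset.range p, g ^ i * s * h ^ i
    let β := ∑ i ∈ Finset.range p, g ^ i * s * h ^ i * ∑ j ∈ Finset.range i, g ^ j
    (1 - g) * β + s * σ = Q ∧ σ * s + β * (1 - g) = Q := by
  intro σ Q β
  have hc : ∀ i, h ^ i * g ^ i = 1 := fun i => by
    have : Commute h g := hg.trans hh.symm
    rw [← this.mul_pow, hg, one_pow]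
  have hhp : h ^ p = 1 := by have := hc p; rwa [hp, mul_one] at this
  set S : ℕ → R := fun i => ∑ j ∈ Finset.range i, g ^ j with hS
  constructor
  · set F : ℕ → R := fun i => g ^ i * s * h ^ i * S i with hF
    have h1 : ∀ i, g * F i = F (i + 1) - g ^ (i + 1) * s * h ^ (i + 1) := by
      intro i
      have : h * S (i + 1) = S i + h := by
        simp only [hS]
        rw [Finset.sum_range_succ', mul_add, Finset.mul_sum, pow_zero, mul_one]
        congr 1
        refine Finset.sum_congr rfl fun j _ => ?_
        rw [pow_succ', ← mul_assoc, hg, one_mul]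
      simp only [hF]
      rw [pow_succ' g i, pow_succ h i, mul_assoc _ (h ^ i * h), mul_assoc (h ^ i) h, this]
      noncomm_ring
    have h2 : g * β = β + (F p - F 0) - (Q + (g ^ p * s * h ^ p - g ^ 0 * s * h ^ 0)) := by
      rw [Finset.mul_sum]
      have h3 : ∑ i ∈ Finset.range p, F (i + 1) = β + (F p - F 0) := by
        have := Finset.sum_range_succ F p
        have h4 := Finset.sum_range_succ' F p
        rw [this] at h4
        change _ = (∑ i ∈ Finset.range p, F i) + _
        rw [← add_sub_assoc, h4, add_sub_cancel_right]
      have h3' : ∑ i ∈ Finset.range p, g ^ (i + 1) * s * h ^ (i + 1) =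
          Q + (g ^ p * s * h ^ p - g ^ 0 * s * h ^ 0) := by
        have := Finset.sum_range_succ (fun i => g ^ i * s * h ^ i) p
        have h4 := Finset.sum_range_succ' (fun i => g ^ i * s * h ^ i) p
        rw [this] at h4
        rw [← add_sub_assoc, h4, add_sub_cancel_right]
      rw [← h3, ← h3', ← Finset.sum_sub_distrib]
      exact Finset.sum_congr rfl fun i _ => h1 i
    have hF0 : F 0 = 0 := by simp [hF, hS]
    have hFp : F p = s * σ := by simp [hF, hp, hhp, hS, σ]
    rw [sub_mul, one_mul, h2, hF0, hFp, hp, hhp]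
    simp only [pow_zero, one_mul, mul_one]
    abel
  · have : β * (1 - g) = Q - σ * s := by
      rw [Finset.sum_mul, Finset.sum_mul, ← Finset.sum_sub_distrib]
      refine Finset.sum_congr rfl fun i _ => ?_
      rw [mul_assoc, geom_sum_mul_neg, mul_sub, mul_one, mul_assoc (g ^ i * s) (h ^ i), hc, mul_one]
    rw [this]; abel

end SplitRing
end SmithFlag

namespace SmithFlag

open Module

section Smith

variable {k : Type} [Field k] {E : Type} [AddCommGroup E] [Module k E]
variable {d r0 r1 u : End k E} {P P' : ℤ → Submodule k E}

lemma OneDim.of_relEx {m : ℤ} {z : E} (h : OneDim d P m z) (hle : ∀ q, P' q ≤ P q)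
    (hdd : ∀ x, d (d x) = 0) (hex : ∀ q, RelEx d P P' q) : ∃ z', OneDim d P' m z' := by
  obtain ⟨y, hy, e⟩ := hex m z h.mem (by rw [h.cyc]; exact zero_mem _)
  have push : ∀ q, ∀ x ∈ P' q, (∃ y ∈ P (q + 1), d y = x) → ∃ y ∈ P' (q + 1), d y = x := by
    rintro q x hx ⟨y, hy, rfl⟩
    obtain ⟨w, hw, e⟩ := hex (q + 1) y hy (by rwa [add_sub_cancel_right])
    exact ⟨_, e, by rw [map_sub, hdd, sub_zero]⟩
  refine ⟨z - d y, e, by rw [map_sub, h.cyc, hdd, sub_zero], ?_, ?_, ?_⟩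
  · intro w hw e
    exact h.nb (w + y) (add_mem (hle _ hw) hy) (by rw [map_add, e]; abel)
  · intro q hq x hx hx0
    exact push q x hx (h.ex q hq x (hle _ hx) hx0)
  · intro x hx hx0
    obtain ⟨c, w, hw, ew⟩ := h.gen x (hle _ hx) hx0
    obtain ⟨v, hv, ev⟩ := push m (x - c • (z - d y)) (sub_mem hx (Submodule.smul_mem _ _ e))
      ⟨w + c • y, add_mem hw (Submodule.smul_mem _ _ hy), by
        rw [ew, map_add, map_smul, smul_sub]; abel⟩
    exact ⟨c, v, hv, by rw [ev]; abel⟩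

lemma OneDim.to_relEx {m : ℤ} {z : E} (h : OneDim d P' m z) (hle : ∀ q, P' q ≤ P q)
    (hdd : ∀ x, d (d x) = 0) (hex : ∀ q, RelEx d P P' q) : OneDim d P m z where
  mem := hle _ h.mem
  cyc := h.cyc
  nb y hy e := by
    obtain ⟨w, hw, e'⟩ := hex (m + 1) y hy (by rw [add_sub_cancel_right, e]; exact h.mem)
    exact h.nb _ e' (by rw [map_sub, hdd, sub_zero, e])
  ex q hq x hx hx0 := by
    obtain ⟨w, hw, e⟩ := hex q x hx (by rw [hx0]; exact zero_mem _)
    obtain ⟨v, hv, e'⟩ := h.ex q hq _ e (by rw [map_sub, hx0, hdd, sub_zero])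
    exact ⟨v + w, add_mem (hle _ hv) hw, by rw [map_add, e']; abel⟩
  gen x hx hx0 := by
    obtain ⟨w, hw, e⟩ := hex m x hx (by rw [hx0]; exact zero_mem _)
    obtain ⟨c, v, hv, e'⟩ := h.gen _ e (by rw [map_sub, hx0, hdd, sub_zero])
    exact ⟨c, v + w, add_mem (hle _ hv) hw, by rw [map_add, ← add_assoc, ← e']; abel⟩

lemma Nil.kill (hdd : ∀ x, d (d x) = 0) (hu : Deg2 d P u) {N : ℕ} (hN : Nil d P P' u N) {q : ℤ}
    {y : E} (hy : y ∈ P (q + 1)) (hdy : d y ∈ P' q) :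
    ∃ v ∈ P' (q + 1 - 2 * N), d v = (u ^ N) (d y) := by
  obtain ⟨w, hw, e⟩ := hN (q + 1) y hy (by rwa [add_sub_cancel_right])
  exact ⟨_, e, by rw [map_sub, hdd, sub_zero, hu.pow_comm]⟩

lemma BD_fix (f0 : ∀ q, ∀ x ∈ P' q, r0 x = 0) (f1 : ∀ q, ∀ x ∈ P' q, r1 x = 0) {q : ℤ}
    {x : ℕ → E} (hx : x ∈ BP P' q) (j : ℕ) : BD d r0 r1 x j = ((-1 : k) ^ j) • d (x j) := by
  rw [BD_apply]
  split_ifs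
  · rw [f0 _ _ (hx _), add_zero]
  · rw [f1 _ _ (hx _), add_zero]

lemma single_mem_BP {q : ℤ} {a : ℕ} {z : E} (hz : z ∈ P (q - a)) :
    (Pi.single a z : ℕ → E) ∈ BP P q := by
  intro j
  by_cases h : j = a
  · subst h; simpa using hz
  · rw [Pi.single_eq_of_ne h]; exact zero_mem _

lemma BD_single (f0 : ∀ q, ∀ x ∈ P' q, r0 x = 0) (f1 : ∀ q, ∀ x ∈ P' q, r1 x = 0) {i : ℤ}
    {a : ℕ} {z : E} (hz : z ∈ P' i) (hz0 : d z = 0) :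
    BD d r0 r1 (Pi.single a z : ℕ → E) = 0 := by
  funext j
  rw [BD_fix f0 f1 (single_mem_BP (q := i + a) (by rwa [add_sub_cancel_right]))]
  by_cases h : j = a
  · subst h; simp [hz0]
  · simp [Pi.single_eq_of_ne h]

lemma smith_pair {m : ℤ} {z : E} (h : OneDim d P m z) (hd : Dat d r0 r1 P)
    (hle : ∀ q, P' q ≤ P q)
    (f0 : ∀ q, ∀ x ∈ P' q, r0 x = 0) (f1 : ∀ q, ∀ x ∈ P' q, r1 x = 0) {N : ℕ}
    (hN : Nil (BD d r0 r1) (BP P) (BP P') sh2 N) {q : ℤ} {a b : ℕ} {z1 z2 : E}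
    (h1 : z1 ∈ P' (q - a)) (h2 : z2 ∈ P' (q - b)) (h10 : d z1 = 0) (h20 : d z2 = 0) :
    ∃ c1 c2 : k, (c1 ≠ 0 ∨ c2 ≠ 0) ∧ ∀ t : ℕ, ∃ v ∈ P' (q + 1 - 2 * N - t),
      d v = c1 • (Pi.single a z1 : ℕ → E) (t + 2 * N) +
        c2 • (Pi.single b z2 : ℕ → E) (t + 2 * N) := by
  have m1 := single_mem_BP h1
  have m2 := single_mem_BP h2
  have hle' : ∀ x ∈ BP P' q, x ∈ BP P q := fun x hx j => hle _ (hx j)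
  have hr' : hr (BD d r0 r1) (BP P) q ≤ (1 : ℕ) := by
    refine (h.hr_bor_le hd q).trans ?_
    split_ifs <;> simp
  obtain ⟨c, hc, y, hy, e⟩ := exists_relation hr' (ι := Fin 2) (by simp)
    ![(Pi.single a z1 : ℕ → E), Pi.single b z2]
    (by
      intro i; fin_cases i
      · exact hle' _ m1
      · exact hle' _ m2)
    (by
      intro i; fin_cases i
      · exact BD_single f0 f1 h1 h10
      · exact BD_single f0 f1 h2 h20)
  simp only [Fin.sum_univ_two, Matrix.cons_val_zero, Matrix.cons_val_one] at e
  obtain ⟨v, hv, ev⟩ := hN.kill (BD_BD hd) deg2_sh2 hy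
    (by rw [e]; exact add_mem (Submodule.smul_mem _ _ m1) (Submodule.smul_mem _ _ m2))
  refine ⟨c 0, c 1, ?_, fun t => ?_⟩
  · by_contra hcon
    push Not at hcon
    apply hc
    funext i; fin_cases i
    · exact hcon.1
    · exact hcon.2
  · have := congrFun ev t
    rw [BD_fix f0 f1 hv, sh2_pow, e] at this
    refine ⟨((-1 : k) ^ t) • v t, Submodule.smul_mem _ _ (hv t), ?_⟩
    rw [map_smul, this]
    rfl

lemma smith {m : ℤ} {z : E} (h : OneDim d P m z) (hd : Dat d r0 r1 P) (hr : RBd d r0 r1 P m z)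
    (hle : ∀ q, P' q ≤ P q)
    (f0 : ∀ q, ∀ x ∈ P' q, r0 x = 0) (f1 : ∀ q, ∀ x ∈ P' q, r1 x = 0) {N : ℕ}
    (hN : Nil (BD d r0 r1) (BP P) (BP P') sh2 N) :
    ∃ (j : ℕ) (z' : E), OneDim d P' (m - j) z' ∧
      ∃ y ∈ BP P (m + 1), cs z 0 = BD d r0 r1 y + Pi.single j z' := by
  obtain ⟨x, hx, hx0, hxz, hxj⟩ := h.tower (2 * N) hd hr
  obtain ⟨y, hy, hx'⟩ := hN _ x hx (by rw [hx0]; exact zero_mem _)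
  have e1 : m + ((2 * N : ℕ) : ℤ) + 1 - 2 * N = m + 1 := by push_cast; ring
  have e2 : m + ((2 * N : ℕ) : ℤ) - 2 * N = m := by push_cast; ring
  rw [e1] at hy
  rw [e2] at hx'
  have ex : ((sh2 (k := k)) ^ N) x = cs z 0 := by
    funext j
    rw [sh2_pow]
    cases j with
    | zero => rw [zero_add, hxz]; rfl
    | succ j => exact hxj _ (by omega)
  rw [ex] at hx'
  set x' := cs z 0 - BD d r0 r1 y with hx'd
  have ez : cs z 0 = BD d r0 r1 y + x' := by rw [hx'd]; abel
  have hcyc : BD d r0 r1 x' = 0 := by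
    rw [hx'd, map_sub, BD_BD hd, BD_cs]
    simp [h.cyc, cs_zero_zero]
  have hj0 : ∀ j, d (x' j) = 0 := by
    intro j
    have := congrFun hcyc j
    rw [BD_fix f0 f1 hx'] at this
    have h2 := neg_one_pow_sq (k := k) j (d (x' j))
    rw [this] at h2
    simpa using h2.symm
  have absorb : ∀ w : ℕ → E, (∀ j : ℕ, w j ∈ P' (m - j + 1)) →
      ∃ W ∈ BP P (m + 1), BD d r0 r1 W = fun j => d (w j) := by
    intro w hw
    have hW : (fun j => ((-1 : k) ^ j) • w j) ∈ BP P' (m + 1) := by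
      intro j
      rw [show m + 1 - (j : ℤ) = m - j + 1 by ring]
      exact Submodule.smul_mem _ _ (hw j)
    refine ⟨_, fun j => hle _ (hW j), ?_⟩
    funext j
    rw [BD_fix f0 f1 hW, map_smul, neg_one_pow_sq]
  have hnb : ∃ j : ℕ, ¬ ∃ w ∈ P' (m - j + 1), d w = x' j := by
    by_contra hcon
    push Not at hcon
    choose w hw ew using hcon
    obtain ⟨W, hW, eW⟩ := absorb w hw
    obtain ⟨v, hv, ev⟩ := h.inc_bd hd hr (c := z) (add_mem hy hW) (by
      rw [map_add, eW, ez]; congr 1; funext j; exact ew j)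
    exact h.nb v hv ev
  obtain ⟨j, hj⟩ := hnb
  have hone : OneDim d P' (m - j) (x' j) := by
    refine ⟨hx' j, hj0 j, fun w hw e => hj ⟨w, hw, e⟩, ?_, ?_⟩
    · intro q hq w hw hw0
      obtain ⟨a, b, hab⟩ : ∃ a b : ℕ, m - j + (a + 2 * N : ℕ) = q + (b + 2 * N : ℕ) :=
        ⟨(q - (m - j)).toNat, (m - j - q).toNat, by push_cast; omega⟩
      obtain ⟨c1, c2, hc, hv⟩ := smith_pair h hd hle f0 f1 hN (q := m - j + (a + 2 * N : ℕ))
        (a := a + 2 * N) (b := b + 2 * N) (z1 := x' j) (z2 := w)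
        (by rw [add_sub_cancel_right]; exact hx' j)
        (by rw [hab, add_sub_cancel_right]; exact hw) (hj0 j) hw0
      have hne : a ≠ b := by rintro rfl; exact hq (by omega)
      obtain ⟨v1, hv1, e1⟩ := hv a
      obtain ⟨v2, hv2, e2⟩ := hv b
      rw [Pi.single_eq_same, Pi.single_eq_of_ne (by omega), smul_zero, add_zero] at e1
      rw [Pi.single_eq_same, Pi.single_eq_of_ne (by omega), smul_zero, zero_add] at e2
      have hc1 : c1 = 0 := by
        by_contra hc1
        refine hj ⟨c1⁻¹ • v1, Submodule.smul_mem _ _ ?_, by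
          rw [map_smul, e1, smul_smul, inv_mul_cancel₀ hc1, one_smul]⟩
        convert hv1 using 2
        push_cast; ring
      have hc2 : c2 ≠ 0 := by tauto
      refine ⟨c2⁻¹ • v2, Submodule.smul_mem _ _ ?_, by
          rw [map_smul, e2, smul_smul, inv_mul_cancel₀ hc2, one_smul]⟩
      convert hv2 using 2
      rw [hab]; push_cast; ring
    · intro w hw hw0
      obtain ⟨c1, c2, hc, hv⟩ := smith_pair h hd hle f0 f1 hN (q := m - j + (2 * N : ℕ))
        (a := 2 * N) (b := 2 * N) (z1 := x' j) (z2 := w)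
        (by rw [add_sub_cancel_right]; exact hx' j)
        (by rw [add_sub_cancel_right]; exact hw) (hj0 j) hw0
      obtain ⟨v, hv', e⟩ := hv 0
      rw [zero_add, Pi.single_eq_same, Pi.single_eq_same] at e
      have hvm : v ∈ P' (m - j + 1) := by
        convert hv' using 2
        push_cast; ring
      have hc2 : c2 ≠ 0 := by
        rintro rfl
        have hc1 : c1 ≠ 0 := by tauto
        refine hj ⟨c1⁻¹ • v, Submodule.smul_mem _ _ hvm, ?_⟩
        rw [map_smul, e, zero_smul, add_zero, smul_smul, inv_mul_cancel₀ hc1, one_smul]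
      refine ⟨-(c2⁻¹ * c1), c2⁻¹ • v, Submodule.smul_mem _ _ hvm, ?_⟩
      rw [map_smul, e, smul_add, smul_smul, smul_smul, inv_mul_cancel₀ hc2, one_smul, neg_smul]
      abel
  refine ⟨j, x' j, hone, ?_⟩
  have : ∀ i : ℕ, ∃ w ∈ P' (m - i + 1), d w = if i = j then 0 else x' i := by
    intro i
    split_ifs with hi
    · exact ⟨0, zero_mem _, map_zero _⟩
    · exact hone.ex _ (by omega) _ (hx' i) (hj0 i)
  choose w hw ew using this
  obtain ⟨W, hW, eW⟩ := absorb w hw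
  refine ⟨y + W, add_mem hy hW, ?_⟩
  rw [ez, map_add, add_assoc]
  congr 1
  rw [eW]
  funext i
  rw [Pi.add_apply, ew]
  by_cases hi : i = j
  · subst hi; simp
  · simp [hi]

lemma smith_nb {m : ℤ} {z z' : E} {j : ℕ} (h : OneDim d P m z) (hd : Dat d r0 r1 P)
    (hr : RBd d r0 r1 P m z)
    (hle : ∀ q, P' q ≤ P q)
    (f0 : ∀ q, ∀ x ∈ P' q, r0 x = 0) (f1 : ∀ q, ∀ x ∈ P' q, r1 x = 0)
    {y : ℕ → E} (hy : y ∈ BP P (m + 1)) (e : cs z 0 = BD d r0 r1 y + Pi.single j z')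
    {w : E} (hw : w ∈ P' (m - j + 1)) (ew : d w = z') : False := by
  have hW : (Pi.single j (((-1 : k) ^ j) • w) : ℕ → E) ∈ BP P' (m + 1) := by
    refine single_mem_BP ?_
    rw [show m + 1 - (j : ℤ) = m - j + 1 by ring]
    exact Submodule.smul_mem _ _ hw
  obtain ⟨v, hv, ev⟩ := h.inc_bd hd hr (c := z) (add_mem hy (fun i => hle _ (hW i))) (by
    rw [e, map_add]; congr 1
    funext i
    rw [BD_fix f0 f1 hW]
    by_cases hi : i = j
    · subst hi
      rw [Pi.single_eq_same, Pi.single_eq_same, map_smul, neg_one_pow_sq, ew]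
    · simp [Pi.single_eq_of_ne hi])
  exact h.nb v hv ev

lemma smith_zero {m : ℤ} {z z' : E} (h : OneDim d P m z) (hd : Dat d r0 r1 P)
    (hr : RBd d r0 r1 P m z)
    {y : ℕ → E} (hy : y ∈ BP P (m + 1)) (e : cs z 0 = BD d r0 r1 y + Pi.single 0 z') :
    ∃ v ∈ P (m + 1), d v = z - z' := by
  refine h.inc_bd hd hr hy ?_
  have : (Pi.single 0 z' : ℕ → E) = cs z' 0 := by
    funext i; cases i <;> simp
  rw [this] at e
  rw [eq_sub_iff_add_eq.2 e.symm, cs_sub, sub_zero]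

lemma corank_one {a0 a1 b0 b1 : End k E} {m m' : ℤ} {z z' : E} (h : OneDim d P m z)
    (h' : OneDim d P' m' z') (hm : m' < m) (hneg : ∀ q < 0, P' q = ⊥)
    (hda : Dat d a0 a1 P) (hdb : Dat (BD d a0 a1) (b0.compLeft ℕ) (b1.compLeft ℕ) (BP P))
    (hle : ∀ q, P' q ≤ P q)
    (fa0 : ∀ q, ∀ x ∈ P' q, a0 x = 0) (fa1 : ∀ q, ∀ x ∈ P' q, a1 x = 0)
    (fb0 : ∀ q, ∀ x ∈ P' q, b0 x = 0) (fb1 : ∀ q, ∀ x ∈ P' q, b1 x = 0) {N : ℕ}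
    (hNb : Nil (BD (BD d a0 a1) (b0.compLeft ℕ) (b1.compLeft ℕ)) (BP (BP P)) (BP (BP P')) sh2 N)
    (hNa : Nil (BD (BD d a0 a1) (b0.compLeft ℕ) (b1.compLeft ℕ)) (BP (BP P)) (BP (BP P'))
      ((sh2 (k := k)).compLeft ℕ) N)
    (hua : Deg2 (BD (BD d a0 a1) (b0.compLeft ℕ) (b1.compLeft ℕ)) (BP (BP P))
      ((sh2 (k := k)).compLeft ℕ)) : False := by
  set D := BD (BD d a0 a1) (b0.compLeft ℕ) (b1.compLeft ℕ) with hD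
  have hm0 : 0 ≤ m' := by
    by_contra hcon
    have h1 := h'.mem
    rw [hneg _ (by omega), Submodule.mem_bot] at h1
    exact h'.nb 0 (zero_mem _) (by rw [map_zero, h1])
  obtain ⟨m', rfl⟩ := Int.eq_ofNat_of_zero_le hm0
  set Q := 4 * N with hQ
  have gb0 : ∀ q, ∀ x ∈ BP P' q, b0.compLeft ℕ x = 0 :=
    fun q x hx => funext fun j => fb0 _ _ (hx j)
  have gb1 : ∀ q, ∀ x ∈ BP P' q, b1.compLeft ℕ x = 0 :=
    fun q x hx => funext fun j => fb1 _ _ (hx j)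
  set e : Fin (Q + 1) → ℕ → ℕ → E := fun t => Pi.single (t : ℕ) (Pi.single (Q - t) z') with he
  have hei : ∀ t : Fin (Q + 1), (Pi.single (Q - t) z' : ℕ → E) ∈
      BP P' ((m' + Q : ℕ) - (t : ℕ)) := by
    intro t
    refine single_mem_BP ?_
    convert h'.mem using 2
    have := t.2
    push_cast [show (t : ℕ) ≤ Q by omega]
    ring
  have heP : ∀ t, e t ∈ BP (BP P') ((m' + Q : ℕ) : ℤ) := fun t => single_mem_BP (hei t)
  have hle1 : ∀ q, BP P' q ≤ BP P q := fun q x hx j => hle _ (hx j)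
  have hle2 : ∀ q, BP (BP P') q ≤ BP (BP P) q := fun q x hx j => hle1 _ (hx j)
  have hr' : hr D (BP (BP P)) ((m' + Q : ℕ) : ℤ) ≤ (Q : ℕ) := by
    have := hr_bor_sum (m' + Q + 1) hdb
    rw [show ((m' + Q + 1 : ℕ) : ℤ) - 1 = (m' + Q : ℕ) by push_cast; ring] at this
    refine this.trans ((Finset.sum_le_sum fun (i : ℕ) _ => h.hr_bor_le hda (i : ℤ)).trans ?_)
    rw [← Finset.sum_filter, Finset.sum_const, nsmul_eq_mul, mul_one, Nat.cast_le]
    have : (Finset.range (m' + Q + 1)).filter (fun i : ℕ => m ≤ (i : ℤ)) ⊆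
        Finset.Ico (m' + 1) (m' + Q + 1) := by
      intro i hi
      simp only [Finset.mem_filter, Finset.mem_range, Finset.mem_Ico] at hi ⊢
      omega
    refine (Finset.card_le_card this).trans ?_
    simp
  obtain ⟨c, hc, y, hy, ey⟩ := exists_relation hr' (ι := Fin (Q + 1)) (by simp) e
    (fun t => hle2 _ (heP t)) (fun t => by
      refine BD_single gb0 gb1 (hei t) ?_
      exact BD_single fa0 fa1 h'.mem h'.cyc)
  have hdy : D y ∈ BP (BP P') ((m' + Q : ℕ) : ℤ) := by
    rw [ey]
    exact Submodule.sum_mem _ fun t _ => Submodule.smul_mem _ _ (heP t)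
  have hdd := BD_BD hdb
  have comp : ∀ t : Fin (Q + 1), (D y) t (Q - t) = c t • z' := by
    intro t
    rw [ey, Finset.sum_apply, Finset.sum_apply, Finset.sum_eq_single t]
    · simp [he]
    · intro s _ hs
      have : (t : ℕ) ≠ s := fun h => hs (Fin.ext h.symm)
      simp [he, Pi.single_eq_of_ne this]
    · simp
  obtain ⟨t, ht⟩ : ∃ t, c t ≠ 0 := by
    by_contra hcon
    push Not at hcon
    exact hc (funext hcon)
  have key : ∀ v : ℕ → ℕ → E, v ∈ BP (BP P') ((m' + Q : ℕ) + 1 - 2 * N) → ∀ i j : ℕ,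
      i + j + 2 * N = Q → D v i j = c t • z' → False := by
    intro v hv i j hij e1
    rw [hD, BD_fix gb0 gb1 hv, Pi.smul_apply, BD_fix fa0 fa1 (hv i)] at e1
    have hvm := hv i j
    rw [show (((m' + Q : ℕ) : ℤ) + 1 - 2 * N - i - j) = m' + 1 by push_cast; omega] at hvm
    refine h'.nb ((c t)⁻¹ • ((-1 : k) ^ i) • ((-1 : k) ^ j) • v i j)
      (Submodule.smul_mem _ _ (Submodule.smul_mem _ _ (Submodule.smul_mem _ _ hvm))) ?_
    rw [map_smul, map_smul, map_smul, e1, smul_smul, inv_mul_cancel₀ ht, one_smul]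
  have ht2 := t.2
  by_cases hcase : 2 * N ≤ (t : ℕ)
  · obtain ⟨v, hv, ev⟩ := hNb.kill hdd deg2_sh2 hy hdy
    refine key v hv (t - 2 * N) (Q - t) (by omega) ?_
    rw [ev, sh2_pow, Nat.sub_add_cancel hcase, comp]
  · obtain ⟨v, hv, ev⟩ := hNa.kill hdd hua hy hdy
    refine key v hv t (Q - t - 2 * N) (by omega) ?_
    rw [ev, compLeft_pow, sh2_pow, Nat.sub_add_cancel (by omega), comp]

end Smith
end SmithFlag

namespace SmithFlag

open Module

section Cochains

variable {k X : Type} [Field k]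

/-- Functions on finite sequences. -/
abbrev Fn (k X : Type) := List X → k

/-- Pull-back along a map of points. -/
def pb (φ : X → X) : End k (Fn k X) := LinearMap.funLeft k k (List.map φ)

lemma pb_apply (φ : X → X) (f : Fn k X) (l : List X) : pb φ f l = f (l.map φ) := rfl

/-- Insertion of a first vertex. -/
def insv (x : X) : End k (Fn k X) := LinearMap.funLeft k k (List.cons x)

lemma insv_apply (x : X) (f : Fn k X) (l : List X) : insv x f l = f (x :: l) := rfl

/-- Evaluation of the coboundary at a sequence. -/
def delAux : List X → Fn k X →ₗ[k] k
  | [] => 0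
  | x :: l => LinearMap.proj l - delAux l ∘ₗ insv x

/-- The alternating coboundary. -/
def del : End k (Fn k X) := LinearMap.pi delAux

@[simp] lemma del_nil (f : Fn k X) : del f [] = 0 := rfl

lemma del_cons (f : Fn k X) (x : X) (l : List X) : del f (x :: l) = f l - del (insv x f) l := rfl

/-- Evaluation of the prism operator. -/
def prismAux (r : X → X) : List X → Fn k X →ₗ[k] k
  | [] => 0
  | x :: l => LinearMap.proj (x :: r x :: l.map r) - prismAux r l ∘ₗ insv x

/-- The prism operator from the identity to a map. -/
def prism (r : X → X) : End k (Fn k X) := LinearMap.pi (prismAux r)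

@[simp] lemma prism_nil (r : X → X) (f : Fn k X) : prism r f [] = 0 := rfl

lemma prism_cons (r : X → X) (f : Fn k X) (x : X) (l : List X) :
    prism r f (x :: l) = f (x :: r x :: l.map r) - prism r (insv x f) l := rfl

lemma del_pb (φ : X → X) (f : Fn k X) : del (pb φ f) = pb φ (del f) := by
  funext l
  induction l generalizing f with
  | nil => rfl
  | cons x l ih =>
    rw [pb_apply, List.map_cons, del_cons, del_cons, ← pb_apply φ (del _), ← ih]
    rfl

lemma insv_del (x : X) (f : Fn k X) : insv x (del f) = f - del (insv x f) := rfl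

lemma insv_prism (r : X → X) (x : X) (f : Fn k X) :
    insv x (prism r f) = pb r (insv (r x) (insv x f)) - prism r (insv x f) := rfl

lemma del_del (f : Fn k X) : del (del f) = 0 := by
  funext l
  induction l generalizing f with
  | nil => rfl
  | cons x l ih =>
    rw [del_cons, insv_del, map_sub, Pi.sub_apply, ih]
    simp

lemma del_prism (r : X → X) (f : Fn k X) :
    del (prism r f) + prism r (del f) = pb r f - f := by
  funext l
  induction l generalizing f with
  | nil => simp [pb_apply]
  | cons x l ih =>
    have := ih (insv x f)
    rw [Pi.add_apply, Pi.sub_apply] at *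
    rw [del_cons, insv_prism, prism_cons, insv_del, del_cons, del_cons, map_sub, map_sub, del_pb,
      Pi.sub_apply, Pi.sub_apply, pb_apply, insv_apply, pb_apply, List.map_cons]
    rw [pb_apply, insv_apply, insv_apply] at this
    linear_combination this

/-- Restriction to sequences of length `q + 1`. -/
def tr (q : ℤ) : End k (Fn k X) where
  toFun f l := if (l.length : ℤ) = q + 1 then f l else 0
  map_add' f g := by funext l; simp only [Pi.add_apply]; split_ifs <;> simp
  map_smul' c f := by funext l; simp

lemma tr_apply (q : ℤ) (f : Fn k X) (l : List X) :
    tr q f l = if (l.length : ℤ) = q + 1 then f l else 0 := rfl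

lemma tr_tr (q : ℤ) (f : Fn k X) : tr q (tr q f) = tr q f := by
  funext l; simp only [tr_apply]; split_ifs <;> rfl

lemma tr_pb (q : ℤ) (φ : X → X) (f : Fn k X) : tr q (pb φ f) = pb φ (tr q f) := by
  funext l; simp [tr_apply, pb_apply]

lemma insv_tr (q : ℤ) (x : X) (f : Fn k X) : insv x (tr q f) = tr (q - 1) (insv x f) := by
  funext l
  simp only [tr_apply, insv_apply, List.length_cons]
  congr 1
  simp only [eq_iff_iff]; push_cast; constructor <;> intro h <;> omega

lemma del_tr (q : ℤ) (f : Fn k X) : del (tr (q - 1) f) = tr q (del f) := by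
  funext l
  induction l generalizing f q with
  | nil => simp [tr_apply]
  | cons x l ih =>
    rw [del_cons, insv_tr, ih, tr_apply, tr_apply, tr_apply, del_cons, List.length_cons]
    have : ((l.length : ℤ) = q - 1 + 1) ↔ (((l.length + 1 : ℕ) : ℤ) = q + 1) := by
      push_cast; constructor <;> intro h <;> omega
    simp only [this]
    split_ifs
    · rfl
    · simp

lemma prism_tr (q : ℤ) (r : X → X) (f : Fn k X) :
    prism r (tr (q + 1) f) = tr q (prism r f) := by
  funext l
  induction l generalizing f q with
  | nil => simp [tr_apply]
  | cons x l ih =>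
    have e : q + 1 - 1 = (q - 1) + 1 := by ring
    rw [prism_cons, insv_tr, e, ih, tr_apply, tr_apply, tr_apply, prism_cons]
    simp only [List.length_cons, List.length_map]
    have : ((l.length : ℤ) = q - 1 + 1) ↔ (((l.length + 1 : ℕ) : ℤ) = q + 1) := by
      push_cast; constructor <;> intro h <;> omega
    have h2 : (((l.length + 1 + 1 : ℕ) : ℤ) = q + 1 + 1) ↔ (((l.length + 1 : ℕ) : ℤ) = q + 1) := by
      push_cast; constructor <;> intro h <;> omega
    simp only [this, h2]
    split_ifs <;> simp

open Classical in
/-- Restriction to sequences whose first vertex lies in a set. -/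
noncomputable def hd (Y : Set X) : End k (Fn k X) where
  toFun f l := if ∃ x, l.head? = some x ∧ x ∈ Y then f l else 0
  map_add' f g := by funext l; simp only [Pi.add_apply]; split_ifs <;> simp
  map_smul' c f := by funext l; simp

@[simp] lemma hd_nil (Y : Set X) (f : Fn k X) : hd Y f [] = 0 := by simp [hd]

open Classical in
lemma hd_cons (Y : Set X) (f : Fn k X) (x : X) (l : List X) :
    hd Y f (x :: l) = if x ∈ Y then f (x :: l) else 0 := by simp [hd]

lemma tr_hd (q : ℤ) (Y : Set X) (f : Fn k X) : tr q (hd Y f) = hd Y (tr q f) := by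
  classical
  funext l
  cases l with
  | nil => simp [tr_apply]
  | cons x l => simp only [tr_apply, hd_cons]; split_ifs <;> rfl

lemma hd_pb (Y : Set X) (φ : X → X) (f : Fn k X) : hd (φ ⁻¹' Y) (pb φ f) = pb φ (hd Y f) := by
  classical
  funext l
  cases l with
  | nil => simp [pb_apply]
  | cons x l => simp [pb_apply, hd_cons]

/-- All vertices of the sequence lie in the set. -/
def In (l : List X) (U : Set X) : Prop := ∀ x ∈ l, x ∈ U

lemma In.mono {l : List X} {U U' : Set X} (h : In l U) (hU : U ⊆ U') : In l U' :=
  fun x hx => hU (h x hx)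

lemma in_cons {l : List X} {x : X} {U : Set X} : In (x :: l) U ↔ x ∈ U ∧ In l U := by
  simp [In]

lemma In.map {l : List X} {U U' : Set X} (h : In l U) {φ : X → X} (hφ : ∀ x ∈ U, φ x ∈ U') :
    In (l.map φ) U' := by
  intro x hx
  obtain ⟨y, hy, rfl⟩ := List.mem_map.1 hx
  exact hφ y (h y hy)

lemma del_local {U : Set X} {f g : Fn k X} (h : ∀ l, In l U → f l = g l) :
    ∀ l, In l U → del f l = del g l := by
  intro l
  induction l generalizing f g with
  | nil => intro _; rfl
  | cons x l ih =>
    intro hl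
    obtain ⟨hx, hl⟩ := in_cons.1 hl
    rw [del_cons, del_cons, h l hl, ih (f := insv x f) (g := insv x g) _ hl]
    intro l' hl'
    exact h _ (in_cons.2 ⟨hx, hl'⟩)

lemma del_zero_of {U : Set X} {f : Fn k X} (h : ∀ l, In l U → f l = 0) (l : List X)
    (hl : In l U) : del f l = 0 := by
  rw [del_local (g := 0) h l hl, map_zero]; rfl

lemma prism_zero_of {U U' : Set X} {r : X → X} (hr : ∀ x ∈ U', x ∈ U ∧ r x ∈ U) {f : Fn k X}
    (h : ∀ l, In l U → f l = 0) : ∀ l, In l U' → prism r f l = 0 := by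
  intro l
  induction l generalizing f with
  | nil => intro _; rfl
  | cons x l ih =>
    intro hl
    obtain ⟨hx, hl⟩ := in_cons.1 hl
    rw [prism_cons, h, ih (f := insv x f) _ hl, sub_zero]
    · intro l' hl'
      exact h _ (in_cons.2 ⟨(hr x hx).1, hl'⟩)
    · exact in_cons.2 ⟨(hr x hx).1, in_cons.2 ⟨(hr x hx).2, hl.map fun y hy => (hr y hy).2⟩⟩

end Cochains
end SmithFlag

namespace SmithFlag

open Module Topology Filter

section Germs

variable {k X : Type} [Field k] [MetricSpace X]

/-- Cochains vanishing on small sequences near each point of `F`. -/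
def Zt (F : Set X) : Submodule k (Fn k X) where
  carrier := {f | ∀ x ∈ F, ∃ U ∈ 𝓝 x, ∀ l, In l U → f l = 0}
  add_mem' := by
    intro f g hf hg x hx
    obtain ⟨U, hU, hU'⟩ := hf x hx
    obtain ⟨V, hV, hV'⟩ := hg x hx
    refine ⟨U ∩ V, inter_mem hU hV, fun l hl => ?_⟩
    rw [Pi.add_apply, hU' l (hl.mono Set.inter_subset_left),
      hV' l (hl.mono Set.inter_subset_right), add_zero]
  zero_mem' := fun x _ => ⟨Set.univ, univ_mem, fun _ _ => rfl⟩
  smul_mem' := by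
    intro c f hf x hx
    obtain ⟨U, hU, hU'⟩ := hf x hx
    exact ⟨U, hU, fun l hl => by rw [Pi.smul_apply, hU' l hl, smul_zero]⟩

/-- Cochains vanishing on small sequences in `F`. -/
def Zs (F : Set X) : Submodule k (Fn k X) where
  carrier := {f | ∀ x ∈ F, ∃ U ∈ 𝓝 x, ∀ l, In l (U ∩ F) → f l = 0}
  add_mem' := by
    intro f g hf hg x hx
    obtain ⟨U, hU, hU'⟩ := hf x hx
    obtain ⟨V, hV, hV'⟩ := hg x hx
    refine ⟨U ∩ V, inter_mem hU hV, fun l hl => ?_⟩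
    rw [Pi.add_apply, hU' l (hl.mono fun _ h => ⟨h.1.1, h.2⟩),
      hV' l (hl.mono fun _ h => ⟨h.1.2, h.2⟩), add_zero]
  zero_mem' := fun x _ => ⟨Set.univ, univ_mem, fun _ _ => rfl⟩
  smul_mem' := by
    intro c f hf x hx
    obtain ⟨U, hU, hU'⟩ := hf x hx
    exact ⟨U, hU, fun l hl => by rw [Pi.smul_apply, hU' l hl, smul_zero]⟩

lemma Zt_anti {F F' : Set X} (h : F' ⊆ F) : (Zt F : Submodule k (Fn k X)) ≤ Zt F' :=
  fun _ hf x hx => hf x (h hx)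

lemma Zt_le_Zs (F : Set X) : (Zt F : Submodule k (Fn k X)) ≤ Zs F := by
  intro f hf x hx
  obtain ⟨U, hU, h⟩ := hf x hx
  exact ⟨U, hU, fun l hl => h l (hl.mono Set.inter_subset_left)⟩

/-- Cochains with compact support in `W`. -/
def AA (Ω W : Set X) : Submodule k (Fn k X) where
  carrier := {f | f [] = 0 ∧ ∃ L, IsCompact L ∧ L ⊆ W ∧ L ⊆ Ω ∧ f ∈ (Zt (Ω \ L) : Submodule k _)}
  add_mem' := by
    rintro f g ⟨hf, L, h1, h2, h3, h4⟩ ⟨hg, L', h1', h2', h3', h4'⟩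
    refine ⟨by simp [hf, hg], L ∪ L', h1.union h1', Set.union_subset h2 h2',
      Set.union_subset h3 h3', add_mem (Zt_anti ?_ h4) (Zt_anti ?_ h4')⟩
    · exact fun x hx => ⟨hx.1, fun h => hx.2 (Or.inl h)⟩
    · exact fun x hx => ⟨hx.1, fun h => hx.2 (Or.inr h)⟩
  zero_mem' := ⟨rfl, ∅, isCompact_empty, Set.empty_subset _, Set.empty_subset _, zero_mem _⟩
  smul_mem' := by
    rintro c f ⟨hf, L, h1, h2, h3, h4⟩
    exact ⟨by simp [hf], L, h1, h2, h3, Submodule.smul_mem _ _ h4⟩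

lemma AA_mono {Ω W W' : Set X} (h : W ⊆ W') : (AA Ω W : Submodule k (Fn k X)) ≤ AA Ω W' := by
  rintro f ⟨h0, L, h1, h2, h3⟩
  exact ⟨h0, L, h1, h2.trans h, h3⟩

/-- Functionals killing the elements of `Y` with support near `x`. -/
def gAnn (Ω : Set X) (x : X) (Y : Submodule k (Fn k X)) : Submodule k (Dual k (Fn k X)) where
  carrier := {ℓ | ∃ W, IsOpen W ∧ x ∈ W ∧ ∀ f ∈ AA Ω W, f ∈ Y → ℓ f = 0}
  add_mem' := by
    rintro ℓ ℓ' ⟨W, h1, h2, h3⟩ ⟨W', h1', h2', h3'⟩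
    refine ⟨W ∩ W', h1.inter h1', ⟨h2, h2'⟩, fun f hf hY => ?_⟩
    rw [LinearMap.add_apply, h3 f (AA_mono Set.inter_subset_left hf) hY,
      h3' f (AA_mono Set.inter_subset_right hf) hY, add_zero]
  zero_mem' := ⟨Set.univ, isOpen_univ, trivial, fun _ _ _ => rfl⟩
  smul_mem' := by
    rintro c ℓ ⟨W, h1, h2, h3⟩
    exact ⟨W, h1, h2, fun f hf hY => by rw [LinearMap.smul_apply, h3 f hf hY, smul_zero]⟩

variable {Ω : Set X} {x : X} {Y Y' : Submodule k (Fn k X)}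

lemma gAnn_anti (h : Y' ≤ Y) : gAnn Ω x Y ≤ gAnn Ω x Y' := by
  rintro ℓ ⟨W, h1, h2, h3⟩
  exact ⟨W, h1, h2, fun f hf hY => h3 f hf (h hY)⟩

lemma gAnn_eventually {ℓ : Dual k (Fn k X)} (h : ℓ ∈ gAnn Ω x Y) :
    ∀ᶠ x' in 𝓝 x, ℓ ∈ gAnn Ω x' Y := by
  obtain ⟨W, h1, h2, h3⟩ := h
  filter_upwards [h1.mem_nhds h2] with x' hx'
  exact ⟨W, h1, hx', h3⟩

/-- The ambient space of germs of chains at `x`. -/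
abbrev EE (k : Type) [Field k] (Ω : Set X) (x : X) : Type :=
  Dual k (Fn k X) ⧸ (gAnn Ω x (⊤ : Submodule k (Fn k X)))

/-- The class of a functional. -/
abbrev cls (Ω : Set X) (x : X) : Dual k (Fn k X) →ₗ[k] EE k Ω x :=
  (gAnn Ω x (⊤ : Submodule k (Fn k X))).mkQ

lemma cls_eq {ℓ ℓ' : Dual k (Fn k X)} : cls Ω x ℓ = cls Ω x ℓ' ↔ ℓ - ℓ' ∈ gAnn Ω x ⊤ :=
  Submodule.Quotient.eq _

lemma cls_zero {ℓ : Dual k (Fn k X)} : cls Ω x ℓ = 0 ↔ ℓ ∈ gAnn Ω x ⊤ :=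
  Submodule.Quotient.mk_eq_zero _

/-- An operator which is local at `x`. -/
def Loc (Ω : Set X) (x : X) (T : End k (Fn k X)) : Prop :=
  ∀ W, IsOpen W → x ∈ W → ∃ W', IsOpen W' ∧ x ∈ W' ∧ ∀ f ∈ AA Ω W', T f ∈ AA Ω W

open Classical in
/-- The operator on germs of chains dual to an operator on cochains. -/
noncomputable def mop (Ω : Set X) (x : X) (T : End k (Fn k X)) : End k (EE k Ω x) :=
  if h : gAnn Ω x (⊤ : Submodule k (Fn k X)) ≤ (gAnn Ω x ⊤).comap (Dual.transpose T) then
    Submodule.mapQ _ _ (Dual.transpose T) h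
  else 0

lemma gAnn_comp {T : End k (Fn k X)} (hT : Loc Ω x T) (h : ∀ f, f [] = 0 → f ∈ Y' → T f ∈ Y)
    {ℓ : Dual k (Fn k X)} (hℓ : ℓ ∈ gAnn Ω x Y) : ℓ ∘ₗ T ∈ gAnn Ω x Y' := by
  obtain ⟨W, h1, h2, h3⟩ := hℓ
  obtain ⟨W', h1', h2', h3'⟩ := hT W h1 h2
  exact ⟨W', h1', h2', fun f hf hY => h3 _ (h3' f hf) (h f hf.1 hY)⟩

lemma mop_cls {T : End k (Fn k X)} (hT : Loc Ω x T) (ℓ : Dual k (Fn k X)) :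
    mop Ω x T (cls Ω x ℓ) = cls Ω x (ℓ ∘ₗ T) := by
  have h : gAnn Ω x (⊤ : Submodule k (Fn k X)) ≤ (gAnn Ω x ⊤).comap (Dual.transpose T) :=
    fun ℓ hℓ => gAnn_comp hT (fun f _ _ => Submodule.mem_top) hℓ
  rw [mop, dif_pos h]
  rfl

/-- The germs at `x` of chains of degree `q` killing `Y`. -/
def PP (Ω : Set X) (x : X) (Y : Submodule k (Fn k X)) (q : ℤ) : Submodule k (EE k Ω x) :=
  (gAnn Ω x Y ⊓ LinearMap.eqLocus (Dual.transpose (tr q)) LinearMap.id).map (cls Ω x)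

lemma mem_PP {q : ℤ} {e : EE k Ω x} :
    e ∈ PP Ω x Y q ↔ ∃ ℓ, ℓ ∈ gAnn Ω x Y ∧ ℓ ∘ₗ tr q = ℓ ∧ cls Ω x ℓ = e := by
  constructor
  · rintro ⟨ℓ, ⟨h1, h2⟩, rfl⟩
    exact ⟨ℓ, h1, h2, rfl⟩
  · rintro ⟨ℓ, h1, h2, rfl⟩
    exact ⟨ℓ, ⟨h1, h2⟩, rfl⟩

lemma cls_mem_PP {q : ℤ} {ℓ : Dual k (Fn k X)} (h : ℓ ∈ gAnn Ω x Y) (h' : ℓ ∘ₗ tr q = ℓ) :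
    cls Ω x ℓ ∈ PP Ω x Y q := mem_PP.2 ⟨ℓ, h, h', rfl⟩

lemma of_cls_mem_PP {q : ℤ} {ℓ : Dual k (Fn k X)} (h : cls Ω x ℓ ∈ PP Ω x Y q) :
    ℓ ∈ gAnn Ω x Y := by
  obtain ⟨ℓ', h1, h2, h3⟩ := mem_PP.1 h
  have := cls_eq.1 h3
  rw [← sub_sub_cancel ℓ' ℓ]
  exact sub_mem h1 (gAnn_anti le_top this)

lemma PP_mono (h : gAnn Ω x Y ≤ gAnn Ω x Y') (q : ℤ) : PP Ω x Y q ≤ PP Ω x Y' q := by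
  intro e he
  obtain ⟨ℓ, h1, h2, rfl⟩ := mem_PP.1 he
  exact cls_mem_PP (h h1) h2

lemma PP_neg (q : ℤ) (hq : q < 0) : PP Ω x Y q = ⊥ := by
  rw [eq_bot_iff]
  intro e he
  obtain ⟨ℓ, h1, h2, rfl⟩ := mem_PP.1 he
  rw [Submodule.mem_bot, cls_zero]
  refine ⟨Set.univ, isOpen_univ, trivial, fun f hf _ => ?_⟩
  rw [← h2, LinearMap.comp_apply]
  convert map_zero ℓ
  funext l
  rw [tr_apply]
  split_ifs with hl
  · have : l = [] := by
      rw [← List.length_eq_zero_iff]; omega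
    rw [this]; exact hf.1
  · rfl

lemma mop_mem {q q' : ℤ} {T : End k (Fn k X)} (hT : Loc Ω x T)
    (h : ∀ f, f [] = 0 → f ∈ Y' → T f ∈ Y)
    (ht : ∀ f, T (tr q' f) = tr q (T f)) {e : EE k Ω x} (he : e ∈ PP Ω x Y q) :
    mop Ω x T e ∈ PP Ω x Y' q' := by
  obtain ⟨ℓ, h1, h2, rfl⟩ := mem_PP.1 he
  rw [mop_cls hT]
  refine cls_mem_PP (gAnn_comp hT h h1) ?_
  ext1 f
  rw [LinearMap.comp_apply, LinearMap.comp_apply, ht, LinearMap.comp_apply]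
  exact LinearMap.congr_fun h2 (T f)

lemma cls_surj (e : EE k Ω x) : ∃ ℓ, cls Ω x ℓ = e := Submodule.mkQ_surjective _ e

lemma del_mem_Zt {F : Set X} {f : Fn k X} (h : f ∈ (Zt F : Submodule k _)) :
    del f ∈ (Zt F : Submodule k _) := by
  intro x hx
  obtain ⟨U, hU, h⟩ := h x hx
  exact ⟨U, hU, fun l hl => del_zero_of h l hl⟩

lemma del_mem_Zs {F : Set X} {f : Fn k X} (h : f ∈ (Zs F : Submodule k _)) :
    del f ∈ (Zs F : Submodule k _) := by
  intro x hx
  obtain ⟨U, hU, h⟩ := h x hx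
  exact ⟨U, hU, fun l hl => del_zero_of h l hl⟩

lemma del_mem_AA {W : Set X} {f : Fn k X} (h : f ∈ (AA Ω W : Submodule k _)) :
    del f ∈ (AA Ω W : Submodule k _) := by
  obtain ⟨h0, L, h1, h2, h3, h4⟩ := h
  exact ⟨rfl, L, h1, h2, h3, del_mem_Zt h4⟩

lemma tr_mem_Zt {F : Set X} {f : Fn k X} (q : ℤ) (h : f ∈ (Zt F : Submodule k _)) :
    tr q f ∈ (Zt F : Submodule k _) := by
  intro x hx
  obtain ⟨U, hU, h⟩ := h x hx
  refine ⟨U, hU, fun l hl => ?_⟩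
  rw [tr_apply, h l hl, ite_self]

lemma tr_mem_AA {W : Set X} {f : Fn k X} (q : ℤ) (h : f ∈ (AA Ω W : Submodule k _)) :
    tr q f ∈ (AA Ω W : Submodule k _) := by
  obtain ⟨h0, L, h1, h2, h3, h4⟩ := h
  exact ⟨by rw [tr_apply, h0, ite_self], L, h1, h2, h3, tr_mem_Zt q h4⟩

lemma hd_zero_of {U Y : Set X} {f : Fn k X} (h : ∀ l, In l U → f l = 0) :
    ∀ l, In l U → hd Y f l = 0 := by
  classical
  intro l hl
  cases l with
  | nil => exact hd_nil _ _
  | cons x l => rw [hd_cons, h _ hl, ite_self]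

lemma hd_mem_Zt {F Y : Set X} {f : Fn k X} (h : f ∈ (Zt F : Submodule k _)) :
    hd Y f ∈ (Zt F : Submodule k _) := by
  intro x hx
  obtain ⟨U, hU, h⟩ := h x hx
  exact ⟨U, hU, hd_zero_of h⟩

lemma hd_mem_Zs {F Y : Set X} {f : Fn k X} (h : f ∈ (Zs F : Submodule k _)) :
    hd Y f ∈ (Zs F : Submodule k _) := by
  intro x hx
  obtain ⟨U, hU, h⟩ := h x hx
  exact ⟨U, hU, hd_zero_of h⟩

lemma hd_mem_AA {W Y : Set X} {f : Fn k X} (h : f ∈ (AA Ω W : Submodule k _)) :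
    hd Y f ∈ (AA Ω W : Submodule k _) := by
  obtain ⟨h0, L, h1, h2, h3, h4⟩ := h
  exact ⟨hd_nil _ _, L, h1, h2, h3, hd_mem_Zt h4⟩

lemma loc_del : Loc Ω x (del : End k (Fn k X)) :=
  fun W h1 h2 => ⟨W, h1, h2, fun _ hf => del_mem_AA hf⟩

lemma loc_hd (Y : Set X) : Loc Ω x (hd Y : End k (Fn k X)) :=
  fun W h1 h2 => ⟨W, h1, h2, fun _ hf => hd_mem_AA hf⟩

lemma Loc.comp {S T : End k (Fn k X)} (hS : Loc Ω x S) (hT : Loc Ω x T) : Loc Ω x (S ∘ₗ T) := by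
  intro W h1 h2
  obtain ⟨W', h1', h2', h3'⟩ := hS W h1 h2
  obtain ⟨W'', h1'', h2'', h3''⟩ := hT W' h1' h2'
  exact ⟨W'', h1'', h2'', fun f hf => h3' _ (h3'' f hf)⟩

lemma Loc.sub {S T : End k (Fn k X)} (hS : Loc Ω x S) (hT : Loc Ω x T) : Loc Ω x (S - T) := by
  intro W h1 h2
  obtain ⟨W', h1', h2', h3'⟩ := hS W h1 h2
  obtain ⟨W'', h1'', h2'', h3''⟩ := hT W h1 h2
  exact ⟨W' ∩ W'', h1'.inter h1'', ⟨h2', h2''⟩, fun f hf =>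
    sub_mem (h3' _ (AA_mono Set.inter_subset_left hf)) (h3'' f (AA_mono Set.inter_subset_right hf))⟩

lemma loc_one : Loc Ω x (1 : End k (Fn k X)) := fun W h1 h2 => ⟨W, h1, h2, fun _ hf => hf⟩

lemma gAnn_local {F F1 : Set X} (hF : F ⊆ Ω) (h : ∀ᶠ x' in 𝓝 x, x' ∈ F → x' ∈ F1) :
    gAnn Ω x (Zt F : Submodule k (Fn k X)) ≤ gAnn Ω x (Zt F1) := by
  obtain ⟨U, hU, hUo, hxU⟩ := eventually_nhds_iff.1 h
  rintro ℓ ⟨W, h1, h2, h3⟩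
  refine ⟨W ∩ U, h1.inter hUo, ⟨h2, hxU⟩, fun f hf hY => ?_⟩
  refine h3 f (AA_mono Set.inter_subset_left hf) ?_
  obtain ⟨-, L, -, hL, -, hfL⟩ := hf
  intro z hz
  by_cases hzL : z ∈ L
  · exact hY z (hU z (hL hzL).2 hz)
  · exact hfL z ⟨hF hz, hzL⟩

lemma gAnn_off {F : Set X} (hF : F ⊆ Ω) (h : ∀ᶠ x' in 𝓝 x, x' ∉ F) :
    gAnn Ω x (Zt F : Submodule k (Fn k X)) ≤ gAnn Ω x ⊤ := by
  refine (gAnn_local (F1 := ∅) hF (h.mono fun x' hx' hx => absurd hx hx')).trans ?_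
  refine gAnn_anti fun f _ => ?_
  intro z hz; exact absurd hz (Set.notMem_empty z)

/-- The differential on germs of chains. -/
noncomputable abbrev dd (k : Type) [Field k] (Ω : Set X) (x : X) : End k (EE k Ω x) := mop Ω x del

lemma dd_dd (e : EE k Ω x) : dd k Ω x (dd k Ω x e) = 0 := by
  obtain ⟨ℓ, rfl⟩ := cls_surj e
  rw [mop_cls loc_del, mop_cls loc_del, ← map_zero (cls Ω x)]
  congr 1
  ext1 f
  simp [del_del]

lemma dd_mem {F : Set X} (q : ℤ) (e : EE k Ω x) (he : e ∈ PP Ω x (Zt F) q) :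
    dd k Ω x e ∈ PP Ω x (Zt F) (q - 1) :=
  mop_mem loc_del (fun _ _ h => del_mem_Zt h) (fun f => del_tr q f) he

lemma dd_mem' {F : Set X} (q : ℤ) (e : EE k Ω x) (he : e ∈ PP Ω x (Zs F) q) :
    dd k Ω x e ∈ PP Ω x (Zs F) (q - 1) :=
  mop_mem loc_del (fun _ _ h => del_mem_Zs h) (fun f => del_tr q f) he

end Germs
end SmithFlag

namespace SmithFlag

open Module Topology Filter

section Taut

variable {k X : Type} [Field k] [MetricSpace X]
variable {Ω : Set X} {x : X} {F : Set X}

lemma exists_retraction (hF : F ⊆ Ω) (hΩ : IsOpen Ω) (hcl : ∀ z ∈ Ω, z ∈ closure F → z ∈ F)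
    (hne : F.Nonempty) :
    ∃ r : X → X, (∀ z, r z ∈ F) ∧ (∀ z ∈ F, r z = z) ∧ ∀ z ∈ F, ContinuousAt r z := by
  have hex : ∀ z, ∃ w ∈ F, (z ∈ F → w = z) ∧ (z ∈ Ω → dist z w ≤ 2 * Metric.infDist z F) := by
    intro z
    by_cases hz : z ∈ F
    · exact ⟨z, hz, fun _ => rfl, fun _ => by
        rw [dist_self]; exact mul_nonneg zero_le_two Metric.infDist_nonneg⟩
    by_cases hzΩ : z ∈ Ω
    · have hpos : 0 < Metric.infDist z F := by
        refine lt_of_le_of_ne Metric.infDist_nonneg fun h => hz (hcl z hzΩ ?_)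
        exact (Metric.mem_closure_iff_infDist_zero hne).2 h.symm
      obtain ⟨w, hw, hd⟩ := (Metric.infDist_lt_iff hne).1
        (show Metric.infDist z F < 2 * Metric.infDist z F by linarith)
      exact ⟨w, hw, fun h => absurd h hz, fun _ => hd.le⟩
    · obtain ⟨w, hw⟩ := hne
      exact ⟨w, hw, fun h => absurd h hz, fun h => absurd h hzΩ⟩
  choose r hr1 hr2 hr3 using hex
  refine ⟨r, hr1, hr2, fun z hz => ?_⟩
  rw [Metric.continuousAt_iff']
  intro ε hε
  filter_upwards [hΩ.mem_nhds (hF hz), Metric.ball_mem_nhds z (show 0 < ε / 3 by linarith)]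
    with w hw hwz
  rw [hr2 z hz]
  have h1 := hr3 w hw
  have h2 : Metric.infDist w F ≤ dist w z := Metric.infDist_le_dist_of_mem hz
  have h3 : dist w z < ε / 3 := hwz
  have h4 := dist_triangle (r w) w z
  rw [dist_comm (r w) w] at h4
  linarith

lemma prism_mem_Zt_at {r : X → X} {z : X} (hrz : r z = z) (hc : ContinuousAt r z) {f : Fn k X}
    (h : ∃ U ∈ 𝓝 z, ∀ l, In l U → f l = 0) : ∃ U ∈ 𝓝 z, ∀ l, In l U → prism r f l = 0 := by
  obtain ⟨U, hU, h⟩ := h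
  have hV : r ⁻¹' U ∈ 𝓝 z := hc (by rwa [hrz])
  exact ⟨U ∩ r ⁻¹' U, inter_mem hU hV, prism_zero_of (fun w hw => hw) h⟩

lemma exists_rep {q : ℤ} {Y : Submodule k (Fn k X)} (hY : ∀ f ∈ Y, tr q f ∈ Y) {e : EE k Ω x}
    (he : e ∈ PP Ω x Y q) :
    ∃ ℓ : Dual k (Fn k X), (∀ f ∈ Y, ℓ f = 0) ∧ ℓ ∘ₗ tr q = ℓ ∧ cls Ω x ℓ = e := by
  obtain ⟨ℓ0, ⟨W, h1, h2, h3⟩, htr, rfl⟩ := mem_PP.1 he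
  have : ℓ0 ∈ (AA Ω W ⊓ Y).dualAnnihilator :=
    (Submodule.mem_dualAnnihilator _).2 fun f hf => h3 f hf.1 hf.2
  rw [Subspace.dualAnnihilator_inf_eq] at this
  obtain ⟨ν, hν, ℓ, hℓ, rfl⟩ := Submodule.mem_sup.1 this
  rw [Submodule.mem_dualAnnihilator] at hν hℓ
  refine ⟨ℓ ∘ₗ tr q, fun f hf => hℓ _ (hY f hf), ?_, ?_⟩
  · ext1 f; simp [tr_tr]
  · rw [← htr, cls_eq]
    refine ⟨W, h1, h2, fun f hf _ => ?_⟩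
    have := hν _ (tr_mem_AA q hf)
    simp [this]

lemma taut [LocallyCompactSpace X] (hF : F ⊆ Ω) (hΩ : IsOpen Ω)
    (hcl : ∀ z ∈ Ω, z ∈ closure F → z ∈ F) (hx : x ∈ F) (q : ℤ) :
    RelEx (dd k Ω x) (PP Ω x (Zt F)) (PP Ω x (Zs F)) q := by
  intro e he hde
  obtain ⟨r, hr1, hr2, hr3⟩ := exists_retraction hF hΩ hcl ⟨x, hx⟩
  obtain ⟨ℓ, hℓ, htr, rfl⟩ := exists_rep (fun f hf => tr_mem_Zt q hf) he
  rw [mop_cls loc_del] at hde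
  have hκ := of_cls_mem_PP hde
  have hprism : ∀ f ∈ (Zt F : Submodule k (Fn k X)), prism r f ∈ (Zt F : Submodule k (Fn k X)) :=
    fun f hf z hz => prism_mem_Zt_at (hr2 z hz) (hr3 z hz) (hf z hz)
  refine ⟨-cls Ω x (ℓ ∘ₗ prism r), neg_mem (cls_mem_PP ?_ ?_), ?_⟩
  · exact ⟨Set.univ, isOpen_univ, trivial, fun f _ hf => hℓ _ (hprism f hf)⟩
  · ext1 f
    simp only [LinearMap.comp_apply, prism_tr]
    exact LinearMap.congr_fun htr _
  have hrep : cls Ω x ℓ - dd k Ω x (-cls Ω x (ℓ ∘ₗ prism r)) =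
      cls Ω x (ℓ ∘ₗ pb r - (ℓ ∘ₗ del) ∘ₗ prism r) := by
    rw [map_neg, sub_neg_eq_add, mop_cls loc_del, ← map_add]
    congr 1
    ext1 f
    have := congrArg ℓ (del_prism r f)
    simp only [LinearMap.add_apply, LinearMap.sub_apply, LinearMap.comp_apply, map_add,
      map_sub] at this ⊢
    linear_combination this
  rw [hrep]
  refine cls_mem_PP (sub_mem ?_ ?_) ?_
  · refine ⟨Set.univ, isOpen_univ, trivial, fun f _ hf => hℓ _ ?_⟩
    intro z hz
    obtain ⟨U, hU, h⟩ := hf z hz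
    refine ⟨r ⁻¹' U, hr3 z hz (by rwa [hr2 z hz]), fun l hl => ?_⟩
    exact h _ (hl.map fun y hy => ⟨hy, hr1 y⟩)
  · obtain ⟨W, h1, h2, h3⟩ := hκ
    refine ⟨W, h1, h2, fun f hf hfY => ?_⟩
    obtain ⟨h0, L, hLc, hLW, hLΩ, hfL⟩ := hf
    obtain ⟨L', hL'c, hLL', hL'⟩ := exists_compact_between hLc (h1.inter hΩ)
      (Set.subset_inter hLW hLΩ)
    rw [LinearMap.comp_apply]
    have hZs : prism r f ∈ (Zs F : Submodule k (Fn k X)) := by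
      intro z hz
      obtain ⟨U, hU, h⟩ := hfY z hz
      exact ⟨U, hU, prism_zero_of (fun w hw => ⟨hw, by rwa [hr2 w hw.2]⟩) h⟩
    have hsplit : prism r f = hd L' (prism r f) + (prism r f - hd L' (prism r f)) := by abel
    rw [hsplit, map_add, h3, zero_add, LinearMap.comp_apply]
    · refine hℓ _ (del_mem_Zt fun z hz => ?_)
      by_cases hzL : z ∈ L
      · refine ⟨interior L', isOpen_interior.mem_nhds (hLL' hzL), fun l hl => ?_⟩
        cases l with
        | nil => simp
        | cons w l =>
          rw [Pi.sub_apply, hd_cons, if_pos (interior_subset (in_cons.1 hl).1), sub_self]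
      · obtain ⟨U, hU, h⟩ := prism_mem_Zt_at (hr2 z hz) (hr3 z hz) (hfL z ⟨hF hz, hzL⟩)
        exact ⟨U, hU, fun l hl => by
          rw [Pi.sub_apply, h l hl, hd_zero_of h l hl, sub_self]⟩
    · refine ⟨hd_nil _ _, L', hL'c, fun z hz => (hL' hz).1, fun z hz => (hL' hz).2, ?_⟩
      intro z hz
      refine ⟨L'ᶜ, hL'c.isClosed.isOpen_compl.mem_nhds hz.2, fun l hl => ?_⟩
      cases l with
      | nil => simp
      | cons w l => rw [hd_cons, if_neg (in_cons.1 hl).1]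
    · exact hd_mem_Zs hZs
  · ext1 f
    have h1 : prism r (tr q f) = tr (q - 1) (prism r f) := by
      have := prism_tr (q - 1) r f
      rwa [sub_add_cancel] at this
    simp only [LinearMap.sub_apply, LinearMap.comp_apply, h1, del_tr, ← tr_pb]
    rw [show ∀ g, ℓ (tr q g) = ℓ g from LinearMap.congr_fun htr,
      show ∀ g, ℓ (tr q g) = ℓ g from LinearMap.congr_fun htr]

end Taut
end SmithFlag

namespace SmithFlag

open Module Topology Filter

section Tame

variable {k : Type} [Field k] {E : Type} [AddCommGroup E] [Module k E]

/-- Operators preserving two complexes and commuting with the differential from the larger one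
modulo the smaller one. -/
def tame (d : End k E) (P P' : ℤ → Submodule k E) : Subsemiring (End k E) where
  carrier := {T | (∀ q, ∀ x ∈ P q, T x ∈ P q) ∧ (∀ q, ∀ x ∈ P' q, T x ∈ P' q) ∧
    ∀ q, ∀ x ∈ P q, d (T x) - T (d x) ∈ P' (q - 1)}
  mul_mem' := by
    rintro S T ⟨h1, h2, h3⟩ ⟨h1', h2', h3'⟩
    refine ⟨fun q x hx => h1 _ _ (h1' _ _ hx), fun q x hx => h2 _ _ (h2' _ _ hx),
      fun q x hx => ?_⟩
    have := add_mem (h3 _ _ (h1' _ _ hx)) (h2 _ _ (h3' _ _ hx))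
    convert this using 1
    simp only [End.mul_apply, map_sub]; abel
  one_mem' := ⟨fun _ _ h => h, fun _ _ h => h, fun q x _ => by simp⟩
  add_mem' := by
    rintro S T ⟨h1, h2, h3⟩ ⟨h1', h2', h3'⟩
    refine ⟨fun q x hx => add_mem (h1 _ _ hx) (h1' _ _ hx),
      fun q x hx => add_mem (h2 _ _ hx) (h2' _ _ hx), fun q x hx => ?_⟩
    have := add_mem (h3 _ _ hx) (h3' _ _ hx)
    convert this using 1
    simp only [LinearMap.add_apply, map_add]; abel
  zero_mem' := ⟨fun q x _ => zero_mem _, fun q x _ => zero_mem _, fun q x _ => by simp⟩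

end Tame

section Action

variable {k X K : Type} [Field k] [MetricSpace X] [Group K]

/-- An action on a set `X` which is continuous on the open set `Ω` and trivial elsewhere. -/
structure LAct (Ω : Set X) (φ : K →* Equiv.Perm X) : Prop where
  opn : IsOpen Ω
  cont : ∀ g, ContinuousOn (φ g) Ω
  off : ∀ g, ∀ x ∉ Ω, φ g x = x

variable {Ω : Set X} {φ : K →* Equiv.Perm X} {x : X}

lemma LAct.maps (h : LAct Ω φ) (g : K) {x : X} (hx : x ∈ Ω) : φ g x ∈ Ω := by
  by_contra hn
  have := h.off g⁻¹ _ hn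
  rw [← Equiv.Perm.mul_apply, ← map_mul, inv_mul_cancel, map_one, Equiv.Perm.one_apply] at this
  exact hn (this ▸ hx)

lemma LAct.contAt (h : LAct Ω φ) (g : K) {x : X} (hx : x ∈ Ω) : ContinuousAt (φ g) x :=
  (h.cont g).continuousAt (h.opn.mem_nhds hx)

lemma inv_fix {g : K} (hg : φ g x = x) : φ g⁻¹ x = x := by
  rw [map_inv, Equiv.Perm.inv_eq_iff_eq, hg]

lemma mul_fix {g h : K} (hg : φ g x = x) (hh : φ h x = x) : φ (g * h) x = x := by
  rw [map_mul, Equiv.Perm.mul_apply, hh, hg]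

lemma LAct.isOpen_pre (h : LAct Ω φ) (g : K) {W : Set X} (hW : IsOpen W) :
    IsOpen (Ω ∩ φ g ⁻¹' W) := (h.cont g).isOpen_inter_preimage h.opn hW

lemma pb_mem_Zt (h : LAct Ω φ) (g : K) {F F' : Set X} (hF : F ⊆ Ω) (hm : ∀ z ∈ F, φ g z ∈ F')
    {f : Fn k X} (hf : f ∈ (Zt F' : Submodule k _)) : pb (φ g) f ∈ (Zt F : Submodule k _) := by
  intro z hz
  obtain ⟨U, hU, h1⟩ := hf _ (hm z hz)
  exact ⟨φ g ⁻¹' U, h.contAt g (hF hz) hU, fun l hl => h1 _ (hl.map fun _ hy => hy)⟩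

lemma loc_pb (h : LAct Ω φ) {g : K} (hx : x ∈ Ω) (hg : φ g x = x) :
    Loc Ω x (pb (φ g) : End k (Fn k X)) := by
  intro W hW hxW
  refine ⟨Ω ∩ φ g⁻¹ ⁻¹' W, h.isOpen_pre _ hW, ⟨hx, by rw [Set.mem_preimage, inv_fix hg]; exact hxW⟩,
    ?_⟩
  rintro f ⟨h0, L, h1, h2, h3, h4⟩
  refine ⟨by simp [pb_apply, h0], φ g⁻¹ '' L, h1.image_of_continuousOn ((h.cont _).mono h3), ?_, ?_,
    ?_⟩
  · rintro _ ⟨z, hz, rfl⟩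
    exact (h2 hz).2
  · rintro _ ⟨z, hz, rfl⟩
    exact h.maps _ (h3 hz)
  · refine pb_mem_Zt h g (fun z hz => hz.1) ?_ h4
    rintro z ⟨hz, hzL⟩
    refine ⟨h.maps _ hz, fun hL => hzL ⟨_, hL, ?_⟩⟩
    rw [← Equiv.Perm.mul_apply, ← map_mul, inv_mul_cancel, map_one, Equiv.Perm.one_apply]

lemma mop_comp {S T : End k (Fn k X)} (hS : Loc Ω x S) (hT : Loc Ω x T) :
    mop Ω x (S ∘ₗ T) = mop Ω x T * mop Ω x S := by
  ext1
  ext1 ℓ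
  change mop Ω x (S ∘ₗ T) (cls Ω x ℓ) = mop Ω x T (mop Ω x S (cls Ω x ℓ))
  rw [mop_cls (hS.comp hT), mop_cls hS, mop_cls hT]
  rfl

lemma Loc.add {S T : End k (Fn k X)} (hS : Loc Ω x S) (hT : Loc Ω x T) : Loc Ω x (S + T) := by
  intro W h1 h2
  obtain ⟨W', h1', h2', h3'⟩ := hS W h1 h2
  obtain ⟨W'', h1'', h2'', h3''⟩ := hT W h1 h2
  exact ⟨W' ∩ W'', h1'.inter h1'', ⟨h2', h2''⟩, fun f hf =>
    add_mem (h3' _ (AA_mono Set.inter_subset_left hf)) (h3'' f (AA_mono Set.inter_subset_right hf))⟩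

lemma loc_zero : Loc Ω x (0 : End k (Fn k X)) := fun W h1 h2 => ⟨W, h1, h2, fun _ _ => zero_mem _⟩

lemma loc_sum {ι : Type} {T : ι → End k (Fn k X)} {s : Finset ι} (h : ∀ i ∈ s, Loc Ω x (T i)) :
    Loc Ω x (∑ i ∈ s, T i) := by
  classical
  induction s using Finset.induction_on with
  | empty => simpa using loc_zero
  | insert a s ha ih =>
    rw [Finset.sum_insert ha]
    exact (h a (Finset.mem_insert_self _ _)).add (ih fun i hi => h i (Finset.mem_insert_of_mem hi))

lemma mop_add {S T : End k (Fn k X)} (hS : Loc Ω x S) (hT : Loc Ω x T) :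
    mop Ω x (S + T) = mop Ω x S + mop Ω x T := by
  ext1; ext1 ℓ
  change mop Ω x (S + T) (cls Ω x ℓ) = mop Ω x S (cls Ω x ℓ) + mop Ω x T (cls Ω x ℓ)
  rw [mop_cls (hS.add hT), mop_cls hS, mop_cls hT, ← map_add, LinearMap.comp_add]

lemma mop_sub {S T : End k (Fn k X)} (hS : Loc Ω x S) (hT : Loc Ω x T) :
    mop Ω x (S - T) = mop Ω x S - mop Ω x T := by
  have := mop_add (hS.sub hT) hT
  rw [sub_add_cancel] at this
  rw [this, add_sub_cancel_right]

lemma mop_zero : mop Ω x (0 : End k (Fn k X)) = 0 := by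
  have := mop_add (loc_zero (k := k) (Ω := Ω) (x := x)) loc_zero
  rwa [add_zero, left_eq_add] at this

lemma mop_one : mop Ω x (1 : End k (Fn k X)) = 1 := by
  ext1; ext1 ℓ
  exact mop_cls loc_one ℓ

lemma mop_sum {ι : Type} {T : ι → End k (Fn k X)} {s : Finset ι} (h : ∀ i ∈ s, Loc Ω x (T i)) :
    mop Ω x (∑ i ∈ s, T i) = ∑ i ∈ s, mop Ω x (T i) := by
  classical
  induction s using Finset.induction_on with
  | empty => simp [mop_zero]
  | insert a s ha ih =>
    have hs := fun i hi => h i (Finset.mem_insert_of_mem hi)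
    rw [Finset.sum_insert ha, Finset.sum_insert ha, mop_add (h a (Finset.mem_insert_self _ _))
      (loc_sum hs), ih hs]

/-- The operator on germs of chains at a fixed point induced by a group element. -/
noncomputable abbrev gop (k : Type) [Field k] (Ω : Set X) (φ : K →* Equiv.Perm X) (x : X) (g : K) :
    End k (EE k Ω x) := mop Ω x (pb (φ g))

lemma pb_mul (g h : K) : (pb (φ (g * h)) : End k (Fn k X)) = pb (φ h) ∘ₗ pb (φ g) := by
  ext1 f
  funext l
  simp [pb_apply, List.map_map, Function.comp_def]

lemma pb_one : (pb (φ 1) : End k (Fn k X)) = 1 := by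
  ext1 f
  funext l
  simp [pb_apply]

lemma gop_mul (h : LAct Ω φ) (hx : x ∈ Ω) {a b : K} (ha : φ a x = x) (hb : φ b x = x) :
    gop k Ω φ x (a * b) = gop k Ω φ x a * gop k Ω φ x b := by
  rw [gop, pb_mul, mop_comp (loc_pb h hx hb) (loc_pb h hx ha)]

lemma gop_one : gop k Ω φ x 1 = 1 := by rw [gop, pb_one, mop_one]

lemma pow_fix {g : K} (hg : φ g x = x) (i : ℕ) : φ (g ^ i) x = x := by
  induction i with
  | zero => simp
  | succ i ih => rw [pow_succ]; exact mul_fix ih hg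

lemma gop_pow (h : LAct Ω φ) (hx : x ∈ Ω) {a : K} (ha : φ a x = x) (i : ℕ) :
    gop k Ω φ x (a ^ i) = gop k Ω φ x a ^ i := by
  induction i with
  | zero => rw [pow_zero, pow_zero, gop_one]
  | succ i ih => rw [pow_succ, pow_succ, gop_mul h hx (pow_fix ha i) ha, ih]

lemma gop_mem (h : LAct Ω φ) (hx : x ∈ Ω) {a : K} (ha : φ a x = x) {F : Set X} (hF : F ⊆ Ω)
    (hm : ∀ z ∈ F, φ a z ∈ F) (q : ℤ) (e : EE k Ω x) (he : e ∈ PP Ω x (Zt F) q) :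
    gop k Ω φ x a e ∈ PP Ω x (Zt F) q :=
  mop_mem (loc_pb h hx ha) (fun _ _ hf => pb_mem_Zt h a hF hm hf)
    (fun f => (tr_pb q (φ a) f).symm) he

lemma dd_gop (h : LAct Ω φ) (hx : x ∈ Ω) {a : K} (ha : φ a x = x) :
    dd k Ω x * gop k Ω φ x a = gop k Ω φ x a * dd k Ω x := by
  rw [← mop_comp (loc_pb h hx ha) loc_del, ← mop_comp loc_del (loc_pb h hx ha)]
  congr 1
  ext1 f
  exact (del_pb _ _).symm

lemma gop_fix (h : LAct Ω φ) (hx : x ∈ Ω) {a : K} (ha : φ a x = x) {F : Set X}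
    (hm : ∀ z ∈ F, φ a z = z) (q : ℤ) (e : EE k Ω x) (he : e ∈ PP Ω x (Zs F) q) :
    gop k Ω φ x a e = e := by
  obtain ⟨ℓ, h1, h2, rfl⟩ := mem_PP.1 he
  rw [mop_cls (loc_pb h hx ha), cls_eq]
  have := gAnn_comp (Y' := (⊤ : Submodule k (Fn k X))) ((loc_pb (k := k) h hx ha).sub loc_one)
    (fun f _ _ => ?_) h1
  · convert this using 1
    rw [LinearMap.comp_sub]; rfl
  · intro z hz
    refine ⟨Set.univ, univ_mem, fun l hl => ?_⟩
    have : l.map (φ a) = l := by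
      conv_rhs => rw [← List.map_id l]
      exact List.map_congr_left fun y hy => hm y (hl y hy).2
    rw [LinearMap.sub_apply, Pi.sub_apply, pb_apply, this, Module.End.one_apply, sub_self]

/-- The element `1 - g`. -/
noncomputable abbrev tau (k : Type) [Field k] (Ω : Set X) (φ : K →* Equiv.Perm X) (x : X) (g : K) :
    End k (EE k Ω x) := 1 - gop k Ω φ x g

/-- The norm element. -/
noncomputable abbrev sig (k : Type) [Field k] (Ω : Set X) (φ : K →* Equiv.Perm X) (x : X) (p : ℕ)
    (g : K) : End k (EE k Ω x) := ∑ i ∈ Finset.range p, gop k Ω φ x g ^ i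

section Ops
variable {p : ℕ} {a b : K} {F : Set X}

lemma tau_mem (h : LAct Ω φ) (hx : x ∈ Ω) (ha : φ a x = x) (hF : F ⊆ Ω)
    (hm : ∀ z ∈ F, φ a z ∈ F) (q : ℤ) (e : EE k Ω x) (he : e ∈ PP Ω x (Zt F) q) :
    tau k Ω φ x a e ∈ PP Ω x (Zt F) q := sub_mem he (gop_mem h hx ha hF hm q e he)

lemma gop_pow_mem (h : LAct Ω φ) (hx : x ∈ Ω) (ha : φ a x = x) (hF : F ⊆ Ω)
    (hm : ∀ z ∈ F, φ a z ∈ F) (q : ℤ) (i : ℕ) (e : EE k Ω x) (he : e ∈ PP Ω x (Zt F) q) :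
    (gop k Ω φ x a ^ i) e ∈ PP Ω x (Zt F) q := by
  induction i generalizing e with
  | zero => exact he
  | succ i ih => exact ih _ (gop_mem h hx ha hF hm q e he)

lemma sig_mem (h : LAct Ω φ) (hx : x ∈ Ω) (ha : φ a x = x) (hF : F ⊆ Ω)
    (hm : ∀ z ∈ F, φ a z ∈ F) (q : ℤ) (e : EE k Ω x) (he : e ∈ PP Ω x (Zt F) q) :
    sig k Ω φ x p a e ∈ PP Ω x (Zt F) q := by
  rw [LinearMap.sum_apply]
  exact Submodule.sum_mem _ fun i _ => gop_pow_mem h hx ha hF hm q i e he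

lemma tau_sig (h : LAct Ω φ) (hx : x ∈ Ω) (ha : φ a x = x) (hap : a ^ p = 1) :
    tau k Ω φ x a * sig k Ω φ x p a = 0 := by
  rw [mul_neg_geom_sum, ← gop_pow h hx ha, hap, gop_one, sub_self]

lemma sig_tau (h : LAct Ω φ) (hx : x ∈ Ω) (ha : φ a x = x) (hap : a ^ p = 1) :
    sig k Ω φ x p a * tau k Ω φ x a = 0 := by
  rw [geom_sum_mul_neg, ← gop_pow h hx ha, hap, gop_one, sub_self]

lemma comm_tau {T : End k (EE k Ω x)} (hT : Commute T (gop k Ω φ x a)) :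
    Commute T (tau k Ω φ x a) := (Commute.one_right _).sub_right hT

lemma comm_sig {T : End k (EE k Ω x)} (hT : Commute T (gop k Ω φ x a)) :
    Commute T (sig k Ω φ x p a) := Commute.sum_right _ _ _ fun i _ => hT.pow_right i

lemma dat_act (h : LAct Ω φ) (hx : x ∈ Ω) (ha : φ a x = x) (hap : a ^ p = 1) (hF : F ⊆ Ω)
    (hm : ∀ z ∈ F, φ a z ∈ F) :
    Dat (dd k Ω x) (tau k Ω φ x a) (sig k Ω φ x p a) (PP Ω x (Zt F)) where
  neg := PP_neg
  d_mem := dd_mem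
  r0_mem := tau_mem h hx ha hF hm
  r1_mem := sig_mem h hx ha hF hm
  dd := dd_dd
  r01 e := LinearMap.congr_fun (tau_sig h hx ha hap) e
  r10 e := LinearMap.congr_fun (sig_tau h hx ha hap) e
  c0 e := LinearMap.congr_fun (comm_tau (dd_gop h hx ha)).eq e
  c1 e := LinearMap.congr_fun (comm_sig (dd_gop h hx ha)).eq e

lemma tau_fix (h : LAct Ω φ) (hx : x ∈ Ω) (ha : φ a x = x)
    (hm : ∀ z ∈ F, φ a z = z) (q : ℤ) (e : EE k Ω x) (he : e ∈ PP Ω x (Zs F) q) :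
    tau k Ω φ x a e = 0 := by
  rw [LinearMap.sub_apply, gop_fix h hx ha hm q e he, End.one_apply, sub_self]

lemma gop_pow_fix (h : LAct Ω φ) (hx : x ∈ Ω) (ha : φ a x = x)
    (hm : ∀ z ∈ F, φ a z = z) (q : ℤ) (e : EE k Ω x) (he : e ∈ PP Ω x (Zs F) q) (i : ℕ) :
    (gop k Ω φ x a ^ i) e = e := by
  induction i with
  | zero => rfl
  | succ i ih => rw [pow_succ, End.mul_apply, gop_fix h hx ha hm q e he, ih]

lemma sig_fix [CharP k p] (h : LAct Ω φ) (hx : x ∈ Ω) (ha : φ a x = x)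
    (hm : ∀ z ∈ F, φ a z = z) (q : ℤ) (e : EE k Ω x) (he : e ∈ PP Ω x (Zs F) q) :
    sig k Ω φ x p a e = 0 := by
  rw [LinearMap.sum_apply, Finset.sum_congr rfl fun i _ => gop_pow_fix h hx ha hm q e he i,
    Finset.sum_const, Finset.card_range, ← Nat.cast_smul_eq_nsmul k, CharP.cast_eq_zero, zero_smul]

lemma rbd_act [Fact p.Prime] [CharP k p] (h : LAct Ω φ) (hx : x ∈ Ω) (ha : φ a x = x)
    (hap : a ^ p = 1) (hF : F ⊆ Ω)
    (hm : ∀ z ∈ F, φ a z ∈ F) {m : ℤ} {z : EE k Ω x} (hz : OneDim (dd k Ω x) (PP Ω x (Zt F)) m z) :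
    RBd (dd k Ω x) (tau k Ω φ x a) (sig k Ω φ x p a) (PP Ω x (Zt F)) m z := by
  set g := gop k Ω φ x a with hg
  have hdg : ∀ e, dd k Ω x (g e) = g (dd k Ω x e) := fun e =>
    LinearMap.congr_fun (dd_gop h hx ha) e
  obtain ⟨c, y, hy, e⟩ := hz.gen (g z) (gop_mem h hx ha hF hm m z hz.mem)
    (by rw [hdg, hz.cyc, map_zero])
  have hpow : ∀ i : ℕ, ∃ y ∈ PP Ω x (Zt F) (m + 1), (g ^ i) z = c ^ i • z + dd k Ω x y := by
    intro i
    induction i with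
    | zero => exact ⟨0, zero_mem _, by simp⟩
    | succ i ih =>
      obtain ⟨w, hw, e'⟩ := ih
      refine ⟨c ^ i • y + g w, add_mem (Submodule.smul_mem _ _ hy)
        (gop_mem h hx ha hF hm _ _ hw), ?_⟩
      rw [pow_succ', End.mul_apply, e', map_add, map_smul, e, map_add, map_smul, hdg, smul_add,
        smul_smul, pow_succ, add_assoc]
  have hc : c = 1 := by
    obtain ⟨w, hw, e'⟩ := hpow p
    rw [hg, ← gop_pow h hx ha, hap, gop_one, End.one_apply] at e'
    have h1 : c ^ p = 1 := by
      by_contra hne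
      have h2 : 1 - c ^ p ≠ 0 := sub_ne_zero.2 (Ne.symm hne)
      refine hz.nb ((1 - c ^ p)⁻¹ • w) (Submodule.smul_mem _ _ hw) ?_
      have h3 : dd k Ω x w = (1 - c ^ p) • z := by
        rw [sub_smul, one_smul, eq_sub_iff_add_eq, add_comm]; exact e'.symm
      rw [map_smul, h3, smul_smul, inv_mul_cancel₀ h2, one_smul]
    have h2 : (c - 1) ^ p = 0 := by rw [sub_pow_char, h1, one_pow, sub_self]
    exact sub_eq_zero.1 (pow_eq_zero_iff (Fact.out : p.Prime).ne_zero |>.1 h2)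
  subst hc
  constructor
  · refine ⟨-y, neg_mem hy, ?_⟩
    rw [LinearMap.sub_apply, End.one_apply, ← hg, e]; simp
  · choose w hw ew using hpow
    refine ⟨∑ i ∈ Finset.range p, w i, Submodule.sum_mem _ fun i _ => hw i, ?_⟩
    rw [LinearMap.sum_apply, Finset.sum_congr rfl fun i _ => ew i, Finset.sum_add_distrib, map_sum]
    simp only [one_pow, one_smul, Finset.sum_const, Finset.card_range]
    rw [← Nat.cast_smul_eq_nsmul k, CharP.cast_eq_zero, zero_smul, zero_add]

end Ops

end Action
end SmithFlag

namespace SmithFlag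

open Module Topology Filter

section Splitting

variable {k X K : Type} [Field k] [MetricSpace X] [Group K]
variable {Ω : Set X} {φ : K →* Equiv.Perm X} {x : X} {p : ℕ} {a : K} {F V Y : Set X}

lemma inv_app (g : K) (x : X) : φ g⁻¹ (φ g x) = x := by
  rw [← Equiv.Perm.mul_apply, ← map_mul, inv_mul_cancel, map_one, Equiv.Perm.one_apply]

lemma app_inv (g : K) (x : X) : φ g (φ g⁻¹ x) = x := by
  rw [← Equiv.Perm.mul_apply, ← map_mul, mul_inv_cancel, map_one, Equiv.Perm.one_apply]

lemma conj_hd (h : LAct Ω φ) (hx : x ∈ Ω) (ha : φ a x = x) (i : ℕ) :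
    gop k Ω φ x a ^ i * mop Ω x (hd Y) * gop k Ω φ x a⁻¹ ^ i =
      mop Ω x (hd (φ (a⁻¹ ^ i) ⁻¹' Y)) := by
  classical
  have hi := inv_fix ha
  rw [← gop_pow h hx ha, ← gop_pow h hx hi, gop, gop, ← mop_comp (loc_hd _) (loc_pb h hx
    (pow_fix ha i)), ← mop_comp (loc_pb h hx (pow_fix hi i))
    ((loc_hd _).comp (loc_pb h hx (pow_fix ha i)))]
  congr 1
  ext1 f
  rw [LinearMap.comp_apply, LinearMap.comp_apply, ← hd_pb]
  congr 1
  funext l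
  rw [pb_apply, pb_apply, List.map_map]
  convert rfl
  rw [inv_pow]
  exact (((List.map_congr_left (g := id) fun z _ => app_inv (φ := φ) (a ^ i) z).trans
    (List.map_id l)).symm :)

lemma hd_tame (hV : ∀ z ∈ V, z ∈ F → ∃ U ∈ 𝓝 z, U ⊆ Y ∨ U ⊆ Yᶜ) :
    mop Ω x (hd Y) ∈ tame (dd k Ω x) (PP Ω x (Zt F)) (PP Ω x (Zt (F \ V))) := by
  classical
  refine ⟨fun q e he => mop_mem (loc_hd Y) (fun f _ hf => hd_mem_Zt hf)
    (fun f => (tr_hd q Y f).symm) he, fun q e he => mop_mem (loc_hd Y)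
    (fun f _ hf => hd_mem_Zt hf) (fun f => (tr_hd q Y f).symm) he, fun q e he => ?_⟩
  rw [← End.mul_apply, ← End.mul_apply, ← LinearMap.sub_apply, ← mop_comp (loc_hd Y) loc_del,
    ← mop_comp loc_del (loc_hd Y), ← mop_sub ((loc_hd Y).comp loc_del) (loc_del.comp (loc_hd Y))]
  refine mop_mem (((loc_hd Y).comp loc_del).sub (loc_del.comp (loc_hd Y))) ?_ ?_ he
  · intro f h0 hf z hz
    by_cases hzV : z ∈ V
    · obtain ⟨U, hU, hUY⟩ := hV z hzV hz
      refine ⟨U, hU, fun l hl => ?_⟩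
      rw [LinearMap.sub_apply, Pi.sub_apply, LinearMap.comp_apply, LinearMap.comp_apply,
        sub_eq_zero]
      rcases hUY with hUY | hUY
      · have key : ∀ f' : Fn k X, f' [] = 0 → ∀ l, In l U → hd Y f' l = f' l := by
          intro f' h' l hl
          cases l with
          | nil => rw [hd_nil, h']
          | cons y l => rw [hd_cons, if_pos (hUY (hl y (by simp)))]
        rw [key _ (del_nil f) l hl]
        exact del_local (fun l hl => (key f h0 l hl).symm) l hl
      · have key : ∀ f' : Fn k X, ∀ l, In l U → hd Y f' l = 0 := by
          intro f' l hl
          cases l with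
          | nil => rw [hd_nil]
          | cons y l => rw [hd_cons, if_neg (hUY (hl y (by simp)))]
        rw [key _ l hl, del_zero_of (key f) l hl]
    · have hz' : z ∈ F \ V := ⟨hz, hzV⟩
      exact sub_mem (hd_mem_Zt (del_mem_Zt hf)) (del_mem_Zt (hd_mem_Zt hf)) z hz'
  · intro f
    rw [LinearMap.sub_apply, LinearMap.sub_apply, map_sub, LinearMap.comp_apply,
      LinearMap.comp_apply, LinearMap.comp_apply, LinearMap.comp_apply, tr_hd, ← del_tr, ← del_tr,
      tr_hd]

lemma gop_tame (h : LAct Ω φ) (hx : x ∈ Ω) (ha : φ a x = x) (hF : F ⊆ Ω)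
    (hm : ∀ z ∈ F, φ a z ∈ F) (hVm : ∀ z, φ a z ∈ V → z ∈ V) :
    gop k Ω φ x a ∈ tame (dd k Ω x) (PP Ω x (Zt F)) (PP Ω x (Zt (F \ V))) := by
  refine ⟨gop_mem h hx ha hF hm, gop_mem h hx ha (Set.sdiff_subset.trans hF)
    fun z hz => ⟨hm z hz.1, fun h' => hz.2 (hVm z h')⟩, fun q e _ => ?_⟩
  have := LinearMap.congr_fun (dd_gop (k := k) h hx ha) e
  simp only [End.mul_apply] at this
  rw [this, sub_self]
  exact zero_mem _

open Classical in
lemma sum_hd (f : Fn k X) (h0 : f [] = 0) (l : List X) {s : Finset ℕ} {Z : ℕ → Set X}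
    (hZ : ∀ z ∈ l, ∃! i, i ∈ s ∧ z ∈ Z i) : (∑ i ∈ s, hd (Z i)) f l = f l := by
  rw [LinearMap.sum_apply, Finset.sum_apply]
  cases l with
  | nil => simp [h0]
  | cons z l =>
    obtain ⟨i, ⟨hi, hzi⟩, hu⟩ := hZ z (by simp)
    rw [Finset.sum_eq_single_of_mem i hi]
    · rw [hd_cons, if_pos hzi]
    · intro j hj hji
      rw [hd_cons, if_neg fun hzj => hji (hu j ⟨hj, hzj⟩)]

lemma split_act (h : LAct Ω φ) (hx : x ∈ Ω) (ha : φ a x = x) (hap : a ^ p = 1) (hF : F ⊆ Ω)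
    (hm : ∀ z ∈ F, φ a z ∈ F) (hm' : ∀ z ∈ F, φ a⁻¹ z ∈ F)
    (hVm : ∀ z, φ a z ∈ V → z ∈ V) (hVm' : ∀ z, φ a⁻¹ z ∈ V → z ∈ V)
    (hY : IsOpen Y) (hYV : Y ⊆ V)
    (hun : ∀ z ∈ V, z ∈ Ω → ∃! i, i ∈ Finset.range p ∧ φ (a⁻¹ ^ i) z ∈ Y) :
    ∃ s β, Split (dd k Ω x) (tau k Ω φ x a) (sig k Ω φ x p a) (PP Ω x (Zt F))
      (PP Ω x (Zt (F \ V))) s β ∧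
      ∀ b, φ b x = x → a * b = b * a → φ b ⁻¹' Y = Y →
        Commute s (gop k Ω φ x b) ∧ Commute β (gop k Ω φ x b) := by
  classical
  have hi := inv_fix ha
  set g := gop k Ω φ x a with hg
  set g' := gop k Ω φ x a⁻¹ with hg'
  set s : End k (EE k Ω x) := mop Ω x (hd Y) with hs
  have h1 : g' * g = 1 := by rw [hg, hg', ← gop_mul h hx hi ha, inv_mul_cancel, gop_one]
  have h2 : g * g' = 1 := by rw [hg, hg', ← gop_mul h hx ha hi, mul_inv_cancel, gop_one]
  have hp : g ^ p = 1 := by rw [hg, ← gop_pow h hx ha, hap, gop_one]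
  have hsplit := split_identities (s := s) h1 h2 hp
  set β : End k (EE k Ω x) :=
    ∑ i ∈ Finset.range p, g ^ i * s * g' ^ i * ∑ j ∈ Finset.range i, g ^ j with hβ
  have ho : ∀ i, IsOpen (Ω ∩ φ (a⁻¹ ^ i) ⁻¹' Y) := fun i => h.isOpen_pre _ hY
  have tg : g ∈ tame (dd k Ω x) (PP Ω x (Zt F)) (PP Ω x (Zt (F \ V))) :=
    gop_tame h hx ha hF hm hVm
  have tg' : g' ∈ tame (dd k Ω x) (PP Ω x (Zt F)) (PP Ω x (Zt (F \ V))) :=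
    gop_tame h hx hi hF hm' hVm'
  have hp0 : ∀ z ∈ V, z ∈ Ω → 0 < p := by
    intro z hz hzΩ
    obtain ⟨i, ⟨hi, -⟩, -⟩ := hun z hz hzΩ
    exact (Nat.zero_le _).trans_lt (Finset.mem_range.1 hi)
  have hVj : ∀ i z, φ (a⁻¹ ^ i) z ∈ V → z ∈ V := by
    intro i
    induction i with
    | zero => simp
    | succ i ih =>
      intro z hz
      rw [pow_succ', map_mul, Equiv.Perm.mul_apply] at hz
      exact ih z (hVm' _ hz)
  have ts : s ∈ tame (dd k Ω x) (PP Ω x (Zt F)) (PP Ω x (Zt (F \ V))) := by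
    refine hd_tame fun z hzV hzF => ?_
    obtain ⟨i, ⟨hip, hiY⟩, hu⟩ := hun z hzV (hF hzF)
    refine ⟨Ω ∩ φ (a⁻¹ ^ i) ⁻¹' Y, (ho i).mem_nhds ⟨hF hzF, hiY⟩, ?_⟩
    by_cases hi0 : i = 0
    · subst hi0
      left
      rintro w ⟨-, hw⟩
      simpa using hw
    · right
      rintro w ⟨hwΩ, hw⟩ hwY
      obtain ⟨i', -, hu'⟩ := hun w (hYV hwY) hwΩ
      have e1 := hu' i ⟨hip, hw⟩
      have e2 := hu' 0 ⟨Finset.mem_range.2 (hp0 z hzV (hF hzF)), by simpa using hwY⟩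
      exact hi0 (e1.trans e2.symm)
  have tb : β ∈ tame (dd k Ω x) (PP Ω x (Zt F)) (PP Ω x (Zt (F \ V))) :=
    sum_mem fun i _ => mul_mem (mul_mem (mul_mem (pow_mem tg _) ts) (pow_mem tg' _))
      (sum_mem fun j _ => pow_mem tg _)
  have hQ : ∀ q, ∀ e ∈ PP Ω x (Zt F) q,
      (∑ i ∈ Finset.range p, g ^ i * s * g' ^ i) e - e ∈ PP Ω x (Zt (F \ V)) q := by
    intro q e he
    rw [Finset.sum_congr rfl fun i _ => conj_hd h hx ha i, ← mop_sum fun i _ => loc_hd _]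
    have hl : Loc Ω x (∑ i ∈ Finset.range p, hd (φ (a⁻¹ ^ i) ⁻¹' Y) - 1 : End k (Fn k X)) :=
      (loc_sum fun i _ => loc_hd _).sub loc_one
    have e1 : mop Ω x (∑ i ∈ Finset.range p, hd (φ (a⁻¹ ^ i) ⁻¹' Y)) e - e =
        mop Ω x (∑ i ∈ Finset.range p, hd (φ (a⁻¹ ^ i) ⁻¹' Y) - 1) e := by
      rw [mop_sub (loc_sum fun i _ => loc_hd _) loc_one, mop_one]; rfl
    rw [e1]
    refine mop_mem hl ?_ ?_ he
    · intro f h0 hf z hz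
      by_cases hzV : z ∈ V
      · obtain ⟨i, ⟨hip, hiY⟩, hu⟩ := hun z hzV (hF hz)
        refine ⟨Ω ∩ φ (a⁻¹ ^ i) ⁻¹' Y, (ho i).mem_nhds ⟨hF hz, hiY⟩, fun l hl => ?_⟩
        rw [LinearMap.sub_apply, Pi.sub_apply, End.one_apply, sum_hd f h0, sub_self]
        intro w hw
        exact hun w (hVj i w (hYV (hl w hw).2)) (hl w hw).1
      · have hz' : z ∈ F \ V := ⟨hz, hzV⟩
        refine sub_mem ?_ hf z hz'
        rw [LinearMap.sum_apply]
        exact Submodule.sum_mem _ fun i _ => hd_mem_Zt hf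
    · intro f
      rw [LinearMap.sub_apply, LinearMap.sub_apply, map_sub, LinearMap.sum_apply,
        LinearMap.sum_apply, map_sum]
      simp only [tr_hd, End.one_apply]
  refine ⟨s, β, ⟨ts.1, ts.2.1, tb.1, tb.2.1, ts.2.2, tb.2.2, ?_, ?_⟩, ?_⟩
  · intro q e he
    have := hQ q e he
    rw [← hsplit.1] at this
    exact this
  · intro q e he
    have := hQ q e he
    rw [← hsplit.2] at this
    exact this
  · intro b hb hab hYb
    have cg : Commute g (gop k Ω φ x b) := by
      rw [Commute, SemiconjBy, hg, ← gop_mul h hx ha hb, hab, gop_mul h hx hb ha]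
    have cg' : Commute g' (gop k Ω φ x b) := by
      have : a⁻¹ * b = b * a⁻¹ := ((show Commute a b from hab).inv_left).eq
      rw [Commute, SemiconjBy, hg', ← gop_mul h hx hi hb, this, gop_mul h hx hb hi]
    have cs' : Commute s (gop k Ω φ x b) := by
      rw [Commute, SemiconjBy, hs, gop, ← mop_comp (loc_pb h hx hb) (loc_hd _),
        ← mop_comp (loc_hd _) (loc_pb h hx hb)]
      congr 1
      ext1 f
      rw [LinearMap.comp_apply, LinearMap.comp_apply, ← hd_pb, hYb]
    exact ⟨cs', Commute.sum_left _ _ _ fun i _ => (((cg.pow_left i).mul_left cs').mul_left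
      (cg'.pow_left i)).mul_left (Commute.sum_left _ _ _ fun j _ => cg.pow_left j)⟩

end Splitting
end SmithFlag

namespace SmithFlag

open Module Topology Filter

section Colors

variable {X K J : Type} [MetricSpace X] [CommGroup K] [Finite K] [Finite J]
variable {Ω : Set X} {φ : K →* Equiv.Perm X} {A B : Subgroup K} {c : J → X → ℝ}

/-- The points at which every set of group elements in the family `C` is a strict upper set for
the corresponding coordinate. -/
def topSet (Ω : Set X) (φ : K →* Equiv.Perm X) (A : Subgroup K) (c : J → X → ℝ)
    (C : Set (J × Set K)) : Set X :=
  {x | x ∈ Ω ∧ ∀ σ : J × Set K, ∀ g h : K, σ ∈ C → g ∈ σ.2 → h ∈ A → h ∉ σ.2 →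
    c σ.1 (φ h x) < c σ.1 (φ g x)}

/-- A family of subsets of `A` separating all translations. -/
def Sep (A : Subgroup K) (C : Set (J × Set K)) : Prop :=
  (∀ σ ∈ C, σ.2 ⊆ A) ∧ ∀ a ∈ A, a ≠ 1 → ∃ σ ∈ C, ∃ g ∈ A, ¬ (g * a ∈ σ.2 ↔ g ∈ σ.2)

lemma isOpen_topSet (h : LAct Ω φ) (hc : ∀ j, Continuous (c j)) (C : Set (J × Set K)) :
    IsOpen (topSet Ω φ A c C) := by
  rw [isOpen_iff_mem_nhds]
  rintro x ⟨hx, h1⟩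
  refine inter_mem (h.opn.mem_nhds hx) ?_
  change ∀ᶠ y in 𝓝 x, ∀ σ : J × Set K, ∀ g h : K, σ ∈ C → g ∈ σ.2 → h ∈ A → h ∉ σ.2 →
    c σ.1 (φ h y) < c σ.1 (φ g y)
  refine eventually_all.2 fun σ => eventually_all.2 fun g => eventually_all.2 fun g' => ?_
  by_cases hh : σ ∈ C ∧ g ∈ σ.2 ∧ g' ∈ A ∧ g' ∉ σ.2
  · have := ((hc σ.1).continuousAt.comp (h.contAt g' hx)).eventually_lt
      ((hc σ.1).continuousAt.comp (h.contAt g hx)) (h1 σ g g' hh.1 hh.2.1 hh.2.2.1 hh.2.2.2)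
    exact this.mono fun y hy _ _ _ _ => hy
  · exact Eventually.of_forall fun y h1 h2 h3 h4 => absurd ⟨h1, h2, h3, h4⟩ hh

lemma topSet_free {C : Set (J × Set K)} (hC : Sep A C) {x : X} (hx : x ∈ topSet Ω φ A c C) {a : K}
    (ha : a ∈ A) (hax : φ a x ∈ topSet Ω φ A c C) : a = 1 := by
  by_contra hne
  obtain ⟨σ, hσ, g, hg, hgn⟩ := hC.2 a ha hne
  have hS := hC.1 σ hσ
  have h1 := fun u v => hx.2 σ u v hσ
  have h2 := fun u v => hax.2 σ u v hσ
  set S := σ.2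
  set S' := (fun u => u * a) '' S with hS'
  have hcard : S'.ncard = S.ncard := Set.ncard_image_of_injective _ (mul_left_injective a)
  have hsub : S ⊆ S' ∨ S' ⊆ S := by
    by_contra hn
    rw [not_or, Set.not_subset, Set.not_subset] at hn
    obtain ⟨⟨u, hu, hu'⟩, _, ⟨v, hv, rfl⟩, hv'⟩ := hn
    have e1 := h1 u (v * a) hu (A.mul_mem (hS hv) ha) hv'
    have e2 := h2 v (u * a⁻¹) hv (A.mul_mem (hS hu) (A.inv_mem ha)) fun hm =>
      hu' ⟨_, hm, by simp⟩
    rw [← Equiv.Perm.mul_apply, ← Equiv.Perm.mul_apply, ← map_mul, ← map_mul,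
      inv_mul_cancel_right] at e2
    exact lt_asymm e1 e2
  have heq : S = S' := by
    rcases hsub with h | h
    · exact Set.eq_of_subset_of_ncard_le h hcard.le (Set.toFinite _)
    · exact (Set.eq_of_subset_of_ncard_le h hcard.ge (Set.toFinite _)).symm
  apply hgn
  constructor
  · intro h
    rw [heq] at h
    obtain ⟨u, hu, e⟩ := h
    rwa [← mul_right_cancel e]
  · intro h
    rw [heq]
    exact ⟨g, h, rfl⟩

lemma exists_topSet (hsep : ∀ x y, (∀ j, c j x = c j y) → x = y) {x : X} (hx : x ∈ Ω)
    (hfree : ∀ a ∈ A, φ a x = x → a = 1) : ∃ C, Sep A C ∧ x ∈ topSet Ω φ A c C := by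
  refine ⟨{σ | ∃ t : ℝ, σ.2 = {g | g ∈ A ∧ t ≤ c σ.1 (φ g x)}}, ⟨?_, ?_⟩, hx, ?_⟩
  · rintro σ ⟨t, e⟩
    rw [e]
    exact fun g hg => hg.1
  · intro a ha hne
    have : ∃ j, c j (φ a x) ≠ c j x := by
      by_contra hn
      push Not at hn
      exact hne (hfree a ha (hsep _ _ hn))
    obtain ⟨j, hj⟩ := this
    refine ⟨(j, {g | g ∈ A ∧ max (c j (φ a x)) (c j x) ≤ c j (φ g x)}), ⟨_, rfl⟩, 1, A.one_mem, ?_⟩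
    simp only [Set.mem_ofPred_eq, one_mul, ha, A.one_mem, true_and, map_one, Equiv.Perm.one_apply,
      max_le_iff, le_refl, and_true]
    intro h
    rcases lt_or_gt_of_ne hj with h' | h'
    · exact absurd (h.2 h'.le) (not_le.2 h')
    · exact absurd (h.1 h'.le) (not_le.2 h')
  · rintro σ g g' ⟨t, e⟩ hg hg' hn
    rw [e] at hg hn
    by_contra hlt
    exact hn ⟨hg', hg.2.trans (not_lt.1 hlt)⟩

/-- The union of the translates of a set by a subgroup. -/
def sat (φ : K →* Equiv.Perm X) (B : Subgroup K) (Y : Set X) : Set X := {z | ∃ b ∈ B, φ b z ∈ Y}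

lemma subset_sat (Y : Set X) : Y ⊆ sat φ B Y := fun z hz => ⟨1, B.one_mem, by simpa using hz⟩

lemma sat_mono (hBA : B ≤ A) (Y : Set X) : sat φ B Y ⊆ sat φ A Y :=
  fun _ ⟨b, hb, h⟩ => ⟨b, hBA hb, h⟩

lemma sat_inv {b : K} (hb : b ∈ B) {Y : Set X} {z : X} : φ b z ∈ sat φ B Y ↔ z ∈ sat φ B Y := by
  constructor
  · rintro ⟨b', hb', h⟩
    exact ⟨b' * b, B.mul_mem hb' hb, by rwa [map_mul]⟩
  · rintro ⟨b', hb', h⟩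
    refine ⟨b' * b⁻¹, B.mul_mem hb' (B.inv_mem hb), ?_⟩
    rwa [← Equiv.Perm.mul_apply, ← map_mul, inv_mul_cancel_right]

lemma isOpen_sat (h : LAct Ω φ) {Y : Set X} (hY : IsOpen Y) (hYΩ : Y ⊆ Ω) :
    IsOpen (sat φ B Y) := by
  have : sat φ B Y = ⋃ b ∈ B, Ω ∩ φ b ⁻¹' Y := by
    ext z
    simp only [sat, Set.mem_ofPred_eq, Set.mem_iUnion, exists_prop, Set.mem_inter_iff,
      Set.mem_preimage]
    constructor
    · rintro ⟨b, hb, hz⟩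
      refine ⟨b, hb, ?_, hz⟩
      have := h.maps b⁻¹ (hYΩ hz)
      rwa [inv_app] at this
    · rintro ⟨b, hb, -, hz⟩
      exact ⟨b, hb, hz⟩
  rw [this]
  exact isOpen_biUnion fun b _ => h.isOpen_pre b hY

/-- Every element of `A` is uniquely the product of an element of `B` and a power of `a⁻¹`. -/
structure Dec (p : ℕ) (a : K) (B A : Subgroup K) : Prop where
  mem : a ∈ A
  le : B ≤ A
  ex : ∀ c ∈ A, ∃ i ∈ Finset.range p, ∃ b ∈ B, c = b * a⁻¹ ^ i
  uniq : ∀ i ∈ Finset.range p, ∀ i' ∈ Finset.range p, ∀ b ∈ B, ∀ b' ∈ B,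
    b * a⁻¹ ^ i = b' * a⁻¹ ^ i' → i = i'

lemma dec_sup {p : ℕ} (hp : p.Prime) {a : K} (hap : a ^ p = 1) (ha : a ∉ B) :
    Dec p a B (B ⊔ Subgroup.zpowers a) where
  mem := Subgroup.mem_sup_right (Subgroup.mem_zpowers a)
  le := le_sup_left
  ex c hc := by
    obtain ⟨b, hb, _, ⟨n, rfl⟩, rfl⟩ := Subgroup.mem_sup.1 hc
    have hp0 : (0 : ℤ) < p := by exact_mod_cast hp.pos
    refine ⟨((-n) % p).toNat, ?_, b, hb, ?_⟩
    · rw [Finset.mem_range]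
      have := Int.emod_lt_of_pos (-n) hp0
      omega
    · have h1 := Int.emod_nonneg (-n) hp0.ne'
      have h2 : a⁻¹ ^ ((-n) % p).toNat = a⁻¹ ^ (-n) := by
        rw [← zpow_natCast, Int.toNat_of_nonneg h1]
        conv_rhs => rw [← Int.emod_add_mul_ediv (-n) p, zpow_add, zpow_mul, zpow_natCast, inv_pow,
          hap, inv_one, one_zpow, mul_one]
      rw [h2, inv_zpow, zpow_neg, inv_inv]
  uniq i hi i' hi' b hb b' hb' e := by
    have key : ∀ i i', i < i' → i' < p → ∀ b ∈ B, ∀ b' ∈ B, b * a⁻¹ ^ i ≠ b' * a⁻¹ ^ i' := by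
      intro i i' hlt hi' b hb b' hb' e
      obtain ⟨m, rfl⟩ := Nat.exists_eq_add_of_lt hlt
      have h1 : a ^ (m + 1) ∈ B := by
        have : a ^ (m + 1) = b⁻¹ * b' := by
          rw [show i + m + 1 = (m + 1) + i by ring, pow_add, ← mul_assoc] at e
          have e' := mul_right_cancel e
          rw [e']
          simp [mul_comm]
        rw [this]
        exact B.mul_mem (B.inv_mem hb) hb'
      have hco : Nat.Coprime (m + 1) p :=
        (Nat.coprime_of_lt_prime (Nat.succ_ne_zero m) (by omega) hp).symm
      apply ha
      have h2 : (a ^ (m + 1)) ^ (Nat.gcdA (m + 1) p) ∈ B := B.zpow_mem h1 _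
      have h3 : (a ^ (m + 1)) ^ (Nat.gcdA (m + 1) p) = a := by
        have h4 := Nat.gcd_eq_gcd_ab (m + 1) p
        rw [hco.gcd_eq_one] at h4
        have h5 : ((m + 1 : ℕ) : ℤ) * Nat.gcdA (m + 1) p = 1 - p * Nat.gcdB (m + 1) p := by
          rw [Nat.cast_one] at h4; linarith
        rw [← zpow_natCast, ← zpow_mul, h5, zpow_sub, zpow_mul, zpow_natCast, hap]
        simp
      rwa [h3] at h2
    rw [Finset.mem_range] at hi hi'
    rcases lt_trichotomy i i' with h | h | h
    · exact absurd e (key _ _ h hi' b hb b' hb')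
    · exact h
    · exact absurd e.symm (key _ _ h hi b' hb' b hb)

variable {k : Type} [Field k] {x : X} {p : ℕ} {a : K} {F : Set X}

lemma split_topSet (h : LAct Ω φ) (hc : ∀ j, Continuous (c j)) (hx : x ∈ Ω)
    (hap : a ^ p = 1) (hd : Dec p a B A) (hA : ∀ g ∈ A, φ g x = x)
    (hF : F ⊆ Ω) (hm : ∀ g ∈ A, ∀ z ∈ F, φ g z ∈ F) {C : Set (J × Set K)} (hC : Sep A C) :
    ∃ s β, Split (dd k Ω x) (tau k Ω φ x a) (sig k Ω φ x p a) (PP Ω x (Zt F))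
      (PP Ω x (Zt (F \ sat φ A (topSet Ω φ A c C)))) s β ∧
      ∀ b ∈ B, Commute s (gop k Ω φ x b) ∧ Commute β (gop k Ω φ x b) := by
  have hYo := isOpen_topSet (A := A) h hc C
  have hYΩ : topSet Ω φ A c C ⊆ Ω := fun z hz => hz.1
  have hun : ∀ z ∈ sat φ A (topSet Ω φ A c C), z ∈ Ω → ∃! i, i ∈ Finset.range p ∧
      φ (a⁻¹ ^ i) z ∈ sat φ B (topSet Ω φ A c C) := by
    rintro z ⟨g, hg, hz⟩ -
    obtain ⟨i, hi, b, hb, rfl⟩ := hd.ex g hg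
    refine ⟨i, ⟨hi, b, hb, by rwa [map_mul] at hz⟩, ?_⟩
    rintro i' ⟨hi', b', hb', hz'⟩
    rw [← Equiv.Perm.mul_apply, ← map_mul] at hz'
    refine hd.uniq _ hi' _ hi _ hb' _ hb ?_
    have hA' : ∀ i, ∀ b ∈ B, b * a⁻¹ ^ i ∈ A := fun i b hb =>
      A.mul_mem (hd.le hb) (A.pow_mem (A.inv_mem hd.mem) _)
    have := topSet_free hC hz (A.mul_mem (hA' i' b' hb') (A.inv_mem (hA' i b hb)))
      (by rw [← Equiv.Perm.mul_apply, ← map_mul, inv_mul_cancel_right]; exact hz')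
    exact mul_inv_eq_one.1 this
  obtain ⟨s, β, hs, hb⟩ := split_act (k := k) (F := F) (V := sat φ A (topSet Ω φ A c C))
    (Y := sat φ B (topSet Ω φ A c C)) h hx (hA a hd.mem) hap hF (hm a hd.mem)
    (hm _ (A.inv_mem hd.mem)) (fun z => (sat_inv hd.mem).1)
    (fun z => (sat_inv (A.inv_mem hd.mem)).1)
    (isOpen_sat h hYo hYΩ) (sat_mono hd.le _) hun
  refine ⟨s, β, hs, fun b hbB => hb b (hA b (hd.le hbB)) (mul_comm _ _) ?_⟩
  ext z
  exact sat_inv hbB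

end Colors

section Chain

variable {k : Type} [Field k] {E : Type} [AddCommGroup E] [Module k E] {X ι : Type}

lemma nil_family {D u : End k E} {C : Set X → ℤ → Submodule k E} (hdd : ∀ x, D (D x) = 0)
    (good : Set X → Prop) (V : ι → Set X) (s : Finset ι)
    (hgood : ∀ F, good F → ∀ i ∈ s, good (F \ V i))
    (hmono : ∀ F F', F' ⊆ F → ∀ q, C F' q ≤ C F q)
    (hdeg : ∀ F, good F → Deg2 D (C F) u)
    (hstep : ∀ F, good F → ∀ i ∈ s, Nil D (C F) (C (F \ V i)) u 1) (F : Set X) (hF : good F) :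
    good (F \ ⋃ i ∈ s, V i) ∧ ∃ N, Nil D (C F) (C (F \ ⋃ i ∈ s, V i)) u N := by
  classical
  induction s using Finset.induction_on with
  | empty =>
    simp only [Finset.notMem_empty, Set.iUnion_of_empty, Set.iUnion_empty, Set.sdiff_empty]
    exact ⟨hF, 0, fun q x hx _ => ⟨0, zero_mem _, by simpa using hx⟩⟩
  | insert i s hi ih =>
    obtain ⟨h1, N, hN⟩ := ih (fun F hF i hi => hgood F hF i (Finset.mem_insert_of_mem hi))
      fun F hF i hi => hstep F hF i (Finset.mem_insert_of_mem hi)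
    have e : F \ ⋃ j ∈ insert i s, V j = (F \ ⋃ j ∈ s, V j) \ V i := by
      rw [Finset.set_biUnion_insert, Set.union_comm, Set.sdiff_sdiff]
    rw [e]
    refine ⟨hgood _ h1 i (Finset.mem_insert_self _ _), N + 1, ?_⟩
    exact Nil.trans hdd (hdeg _ hF) (hdeg _ (hgood _ h1 i (Finset.mem_insert_self _ _)))
      (hmono _ _ Set.sdiff_subset) (hmono _ _ Set.sdiff_subset) hN
      (hstep _ h1 i (Finset.mem_insert_self _ _))

end Chain
end SmithFlag

namespace SmithFlag

open Module Topology Filter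

section Nilpotence

variable {X K J : Type} [MetricSpace X] [CommGroup K] [Finite K] [Finite J]
variable {Ω : Set X} {φ : K →* Equiv.Perm X} {A B : Subgroup K} {c : J → X → ℝ}
variable {F F' : Set X} {k : Type} [Field k] {x : X} {p : ℕ} {a b : K}

/-- Invariant subsets of `Ω`. -/
def Inv (Ω : Set X) (φ : K →* Equiv.Perm X) (A : Subgroup K) (F : Set X) : Prop :=
  F ⊆ Ω ∧ ∀ g ∈ A, ∀ z ∈ F, φ g z ∈ F

lemma Inv.sdiff_sat (h : Inv Ω φ A F) (Y : Set X) : Inv Ω φ A (F \ sat φ A Y) :=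
  ⟨Set.sdiff_subset.trans h.1, fun g hg z hz => ⟨h.2 g hg z hz.1, fun h' => hz.2
    ((sat_inv hg).1 h')⟩⟩

lemma BP_mono {E : Type} [AddCommGroup E] [Module k E] {P P' : ℤ → Submodule k E}
    (h : ∀ q, P' q ≤ P q) (q : ℤ) : BP P' q ≤ BP P q := fun _ hx j => h _ (hx j)

lemma dat_fix [CharP k p] (h : LAct Ω φ) (hx : x ∈ Ω) (ha : φ a x = x) (hap : a ^ p = 1)
    (hm : ∀ z ∈ F, φ a z = z) :
    Dat (dd k Ω x) (tau k Ω φ x a) (sig k Ω φ x p a) (PP Ω x (Zs F)) where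
  neg := PP_neg
  d_mem := dd_mem'
  r0_mem q e he := by rw [tau_fix h hx ha hm q e he]; exact zero_mem _
  r1_mem q e he := by rw [sig_fix h hx ha hm q e he]; exact zero_mem _
  dd := dd_dd
  r01 e := LinearMap.congr_fun (tau_sig h hx ha hap) e
  r10 e := LinearMap.congr_fun (sig_tau h hx ha hap) e
  c0 e := LinearMap.congr_fun (comm_tau (dd_gop h hx ha)).eq e
  c1 e := LinearMap.congr_fun (comm_sig (dd_gop h hx ha)).eq e

lemma nil_colors
    (hsep : ∀ x y, (∀ j, c j x = c j y) → x = y) (hF : Inv Ω φ A F) (hA1 : ∃ g ∈ A, g ≠ 1)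
    (hF'F : F' ⊆ F) (hF' : ∀ g ∈ A, ∀ z ∈ F', φ g z = z)
    (hnear : ∀ᶠ z in 𝓝 x, z ∈ F → (∃ g ∈ A, g ≠ 1 ∧ φ g z = z) → z ∈ F')
    {E : Type} [AddCommGroup E] [Module k E] {D u : End k E}
    (T : (ℤ → Submodule k (EE k Ω x)) → ℤ → Submodule k E) (hdd : ∀ x, D (D x) = 0)
    (hT : ∀ P P', (∀ q, P' q ≤ P q) → ∀ q, T P' q ≤ T P q)
    (hdeg : ∀ F, Inv Ω φ A F → Deg2 D (T (PP Ω x (Zt F))) u)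
    (hstep : ∀ F, Inv Ω φ A F → ∀ C, Sep A C → Nil D (T (PP Ω x (Zt F)))
      (T (PP Ω x (Zt (F \ sat φ A (topSet Ω φ A c C))))) u 1) :
    ∃ N, Nil D (T (PP Ω x (Zt F))) (T (PP Ω x (Zt F'))) u N := by
  classical
  have := Fintype.ofFinite (Set (J × Set K))
  obtain ⟨h1, N, hN⟩ := nil_family (C := fun F => T (PP Ω x (Zt F))) hdd (Inv Ω φ A)
    (fun C => sat φ A (topSet Ω φ A c C)) (Finset.univ.filter (Sep A))
    (fun F hF C _ => hF.sdiff_sat _) (fun F F' hFF' => hT _ _ fun q => PP_mono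
      (gAnn_anti (Zt_anti hFF')) q) hdeg
    (fun F hF C hC => hstep F hF C (Finset.mem_filter.1 hC).2) F hF
  refine ⟨N, ?_⟩
  set F1 := F \ ⋃ C ∈ Finset.univ.filter (Sep A), sat φ A (topSet Ω φ A c C) with hF1
  have e : (PP Ω x (Zt F1) : ℤ → Submodule k (EE k Ω x)) = PP Ω x (Zt F') := by
    funext q
    apply le_antisymm
    · refine PP_mono (gAnn_local h1.1 ?_) q
      refine hnear.mono fun z hz hzF1 => hz hzF1.1 ?_
      by_contra hn
      push Not at hn
      obtain ⟨C, hC, hzC⟩ := exists_topSet (A := A) hsep (hF.1 hzF1.1) fun g hg hgz => by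
        by_contra hne
        exact hn g hg hne hgz
      exact hzF1.2 (Set.mem_biUnion (by simpa using hC) (subset_sat _ hzC))
    · have hsub : F' ⊆ F1 := by
        intro z hz
        refine ⟨hF'F hz, fun hn => ?_⟩
        obtain ⟨C, hC, g, hg, hz'⟩ := Set.mem_iUnion₂.1 hn
        obtain ⟨g', hg', hne⟩ := hA1
        rw [hF' g hg z hz] at hz'
        exact hne (topSet_free (Finset.mem_filter.1 hC).2 hz' hg' (by rwa [hF' g' hg' z hz]))
      exact PP_mono (gAnn_anti (Zt_anti hsub)) q
  rw [← e]
  exact hN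

lemma smith_nil [CharP k p] [LocallyCompactSpace X] (h : LAct Ω φ) (hc : ∀ j, Continuous (c j))
    (hsep : ∀ x y, (∀ j, c j x = c j y) → x = y) (hap : a ^ p = 1) (hd : Dec p a ⊥ A)
    (ha1 : a ≠ 1) (hA : ∀ g ∈ A, φ g x = x) (hF : Inv Ω φ A F)
    (hF'F : F' ⊆ F) (hF' : ∀ g ∈ A, ∀ z ∈ F', φ g z = z)
    (hcl : ∀ z ∈ Ω, z ∈ closure F' → z ∈ F') (hx : x ∈ F')
    (hnear : ∀ᶠ z in 𝓝 x, z ∈ F → (∃ g ∈ A, g ≠ 1 ∧ φ g z = z) → z ∈ F') :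
    ∃ N, Nil (BD (dd k Ω x) (tau k Ω φ x a) (sig k Ω φ x p a)) (BP (PP Ω x (Zt F)))
      (BP (PP Ω x (Zs F'))) sh2 N := by
  have hxΩ := hF.1 (hF'F hx)
  have hax := hA a hd.mem
  have hdat := fun F (hF : Inv Ω φ A F) =>
    dat_act (k := k) h hxΩ hax hap hF.1 (hF.2 a hd.mem)
  have hFI : Inv Ω φ A F' := ⟨hF'F.trans hF.1, fun g hg z hz => by rwa [hF' g hg z hz]⟩
  have hdd := BD_BD (hdat F hF)
  obtain ⟨N, hN⟩ := nil_colors (k := k) (u := sh2) hsep hF ⟨a, hd.mem, ha1⟩ hF'F hF' hnear BP hdd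
    (fun P P' hPP => BP_mono hPP) (fun F _ => deg2_sh2) fun F hF C hC => by
      obtain ⟨s, β, hs, -⟩ := split_topSet (k := k) h hc hxΩ hap hd hA hF.1 hF.2 hC
      exact hs.step.nil
  refine ⟨N + 0, Nil.trans hdd deg2_sh2 deg2_sh2
    (BP_mono fun q => PP_mono (gAnn_anti (Zt_anti hF'F)) q)
    (BP_mono fun q => PP_mono (gAnn_anti (Zt_le_Zs _)) q) hN (nil_zero fun q => ?_)⟩
  exact relEx_bor (hdat F' hFI) (dat_fix h hxΩ hax hap (hF' a hd.mem)) fun i _ =>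
    taut hFI.1 h.opn hcl hx i

lemma Nil.mono {E : Type} [AddCommGroup E] [Module k E] {d u : End k E}
    {P P' : ℤ → Submodule k E} {N : ℕ} (h : Nil d P P' u N) (hu : Deg2 d P u)
    (hu' : ∀ q, ∀ x ∈ P' q, u x ∈ P' (q - 2)) : Nil d P P' u (N + 1) := by
  intro q x hx hd
  obtain ⟨y, hy, e⟩ := h q x hx hd
  refine ⟨u y, ?_, ?_⟩
  · have := hu.mem _ _ hy
    rwa [show q + 1 - 2 * (N : ℤ) - 2 = q + 1 - 2 * ((N + 1 : ℕ) : ℤ) by push_cast; ring] at this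
  · have := hu' _ _ e
    rwa [show q - 2 * (N : ℤ) - 2 = q - 2 * ((N + 1 : ℕ) : ℤ) by push_cast; ring, map_sub,
      hu.comm, ← Module.End.mul_apply, ← pow_succ'] at this

lemma Nil.mono_le {E : Type} [AddCommGroup E] [Module k E] {d u : End k E}
    {P P' : ℤ → Submodule k E} {N N' : ℕ} (h : Nil d P P' u N) (hu : Deg2 d P u)
    (hu' : ∀ q, ∀ x ∈ P' q, u x ∈ P' (q - 2)) (hN : N ≤ N') : Nil d P P' u N' :=
  Nat.le_induction h (fun _ _ h => h.mono hu hu') N' hN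

lemma dat_two (h : LAct Ω φ) (hx : x ∈ Ω) (ha : φ a x = x) (hb : φ b x = x)
    {P : ℤ → Submodule k (EE k Ω x)}
    (hPa : Dat (dd k Ω x) (tau k Ω φ x a) (sig k Ω φ x p a) P)
    (hPb : Dat (dd k Ω x) (tau k Ω φ x b) (sig k Ω φ x p b) P) :
    Dat (BD (dd k Ω x) (tau k Ω φ x a) (sig k Ω φ x p a)) ((tau k Ω φ x b).compLeft ℕ)
      ((sig k Ω φ x p b).compLeft ℕ) (BP P) := by
  have hab : Commute (gop k Ω φ x a) (gop k Ω φ x b) := by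
    rw [commute_iff_eq, ← gop_mul h hx ha hb, ← gop_mul h hx hb ha, mul_comm]
  have h1 : Commute (tau k Ω φ x b) (tau k Ω φ x a) := comm_tau (comm_tau hab).symm
  have h2 : Commute (tau k Ω φ x b) (sig k Ω φ x p a) := comm_sig (comm_tau hab).symm
  have h3 : Commute (sig k Ω φ x p b) (tau k Ω φ x a) := comm_tau (comm_sig hab).symm
  have h4 : Commute (sig k Ω φ x p b) (sig k Ω φ x p a) := comm_sig (comm_sig hab).symm
  exact hPa.bor hPb.r0_mem hPb.r1_mem hPb.r01 hPb.r10 hPb.c0 hPb.c1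
    (fun e => LinearMap.congr_fun h1.eq.symm e) (fun e => LinearMap.congr_fun h2.eq.symm e)
    (fun e => LinearMap.congr_fun h3.eq.symm e) (fun e => LinearMap.congr_fun h4.eq.symm e)

lemma splitK_comm {E : Type} [AddCommGroup E] [Module k E] {s β r : End k E}
    (hs : Commute s r) (hβ : Commute β r) (y : ℕ → E) :
    splitK s β (r.compLeft ℕ y) = r.compLeft ℕ (splitK s β y) := by
  funext j
  have e1 := LinearMap.congr_fun hs.eq (y (j + 1))
  have e2 := LinearMap.congr_fun hβ.eq (y (j + 1))
  simp only [Module.End.mul_apply] at e1 e2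
  simp only [splitK_apply, LinearMap.compLeft_apply, Function.comp]
  split_ifs
  · exact e1
  · exact e2

lemma two_nil [CharP k p] [LocallyCompactSpace X] (h : LAct Ω φ) (hc : ∀ j, Continuous (c j))
    (hsep : ∀ x y, (∀ j, c j x = c j y) → x = y) (hap : a ^ p = 1) (hbp : b ^ p = 1)
    {A₁ A₂ : Subgroup K} (hda : Dec p a A₂ A) (hdb : Dec p b A₁ A) (ha' : a ∈ A₁) (hb' : b ∈ A₂)
    (ha1 : a ≠ 1) (hA : ∀ g ∈ A, φ g x = x) (hF : Inv Ω φ A F)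
    (hF'F : F' ⊆ F) (hF' : ∀ g ∈ A, ∀ z ∈ F', φ g z = z)
    (hcl : ∀ z ∈ Ω, z ∈ closure F' → z ∈ F') (hx : x ∈ F')
    (hnear : ∀ᶠ z in 𝓝 x, z ∈ F → (∃ g ∈ A, g ≠ 1 ∧ φ g z = z) → z ∈ F') :
    ∃ N, Nil (BD (BD (dd k Ω x) (tau k Ω φ x a) (sig k Ω φ x p a)) ((tau k Ω φ x b).compLeft ℕ)
        ((sig k Ω φ x p b).compLeft ℕ)) (BP (BP (PP Ω x (Zt F)))) (BP (BP (PP Ω x (Zs F')))) sh2 N ∧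
      Nil (BD (BD (dd k Ω x) (tau k Ω φ x a) (sig k Ω φ x p a)) ((tau k Ω φ x b).compLeft ℕ)
        ((sig k Ω φ x p b).compLeft ℕ)) (BP (BP (PP Ω x (Zt F)))) (BP (BP (PP Ω x (Zs F'))))
        ((sh2 (k := k)).compLeft ℕ) N := by
  have hxΩ := hF.1 (hF'F hx)
  have hax := hA a hda.mem
  have hbx := hA b hdb.mem
  have hdata := fun F (hF : Inv Ω φ A F) =>
    dat_act (k := k) h hxΩ hax hap hF.1 (hF.2 a hda.mem)
  have hdatb := fun F (hF : Inv Ω φ A F) =>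
    dat_act (k := k) h hxΩ hbx hbp hF.1 (hF.2 b hdb.mem)
  have hdat := fun F (hF : Inv Ω φ A F) =>
    dat_two h hxΩ hax hbx (hdata F hF) (hdatb F hF)
  have hfa := dat_fix (k := k) h hxΩ hax hap (hF' a hda.mem)
  have hfb := dat_fix (k := k) h hxΩ hbx hbp (hF' b hdb.mem)
  have hf := dat_two h hxΩ hax hbx hfa hfb
  have hFI : Inv Ω φ A F' := ⟨hF'F.trans hF.1, fun g hg z hz => by rwa [hF' g hg z hz]⟩
  have hdd := BD_BD (hdat F hF)
  have hT : ∀ P P' : ℤ → Submodule k (EE k Ω x), (∀ q, P' q ≤ P q) →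
      ∀ q, BP (BP P') q ≤ BP (BP P) q := fun P P' hPP => BP_mono (BP_mono hPP)
  have hsc : ∀ r : End k (EE k Ω x), ∀ y : ℕ → EE k Ω x,
      sh2 (k := k) (r.compLeft ℕ y) = r.compLeft ℕ (sh2 (k := k) y) := fun r y => rfl
  have hdega : ∀ P, Deg2 (BD (BD (dd k Ω x) (tau k Ω φ x a) (sig k Ω φ x p a))
      ((tau k Ω φ x b).compLeft ℕ) ((sig k Ω φ x p b).compLeft ℕ)) (BP (BP P))
      ((sh2 (k := k)).compLeft ℕ) := fun P => deg2_sh2.bor (hsc _) (hsc _)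
  have htaut : ∀ q, RelEx (BD (BD (dd k Ω x) (tau k Ω φ x a) (sig k Ω φ x p a))
      ((tau k Ω φ x b).compLeft ℕ) ((sig k Ω φ x p b).compLeft ℕ)) (BP (BP (PP Ω x (Zt F'))))
      (BP (BP (PP Ω x (Zs F')))) q := fun q =>
    relEx_bor (hdat F' hFI) hf fun i _ => relEx_bor (hdata F' hFI) hfa fun i _ =>
      taut hFI.1 h.opn hcl hx i
  obtain ⟨N₁, hN₁⟩ := nil_colors (k := k) (u := sh2) hsep hF ⟨a, hda.mem, ha1⟩ hF'F hF' hnear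
    (fun P => BP (BP P)) hdd hT (fun F _ => deg2_sh2) fun F hF C hC => by
      obtain ⟨s, β, hs, hcomm⟩ := split_topSet (k := k) h hc hxΩ hbp hdb hA hF.1 hF.2 hC
      obtain ⟨cs, cβ⟩ := hcomm a ha'
      exact (hs.bor (fun e => LinearMap.congr_fun (comm_tau cs).eq e)
        (fun e => LinearMap.congr_fun (comm_sig cs).eq e)
        (fun e => LinearMap.congr_fun (comm_tau cβ).eq e)
        (fun e => LinearMap.congr_fun (comm_sig cβ).eq e)).step.nil
  obtain ⟨N₂, hN₂⟩ := nil_colors (k := k) (u := (sh2 (k := k)).compLeft ℕ) hsep hF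
    ⟨a, hda.mem, ha1⟩ hF'F hF' hnear
    (fun P => BP (BP P)) hdd hT (fun F _ => hdega _) fun F hF C hC => by
      obtain ⟨s, β, hs, hcomm⟩ := split_topSet (k := k) h hc hxΩ hap hda hA hF.1 hF.2 hC
      obtain ⟨cs, cβ⟩ := hcomm b hb'
      exact (hs.step.bor (splitK_comm (comm_tau cs) (comm_tau cβ))
        (splitK_comm (comm_sig cs) (comm_sig cβ))).nil
  have hle1 := hT _ _ fun q => PP_mono (k := k) (x := x) (Ω := Ω) (gAnn_anti (Zt_anti hF'F)) q
  have hle2 := hT _ _ fun q => PP_mono (k := k) (x := x) (Ω := Ω) (gAnn_anti (Zt_le_Zs F')) q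
  refine ⟨max N₁ N₂, Nil.mono_le (Nil.trans hdd deg2_sh2 deg2_sh2 hle1 hle2 hN₁
      (nil_zero htaut)) deg2_sh2 (fun q y hy => ?_) (le_max_left _ _),
    Nil.mono_le (Nil.trans hdd (hdega _) (hdega _) hle1 hle2 hN₂ (nil_zero htaut)) (hdega _)
      (fun q y hy => (hdega _).mem q y hy) (le_max_right _ _)⟩
  exact (deg2_sh2 (d := BD (dd k Ω x) (tau k Ω φ x a) (sig k Ω φ x p a))
    (r0 := (tau k Ω φ x b).compLeft ℕ) (r1 := (sig k Ω φ x p b).compLeft ℕ)).mem q y hy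

end Nilpotence
end SmithFlag

namespace SmithFlag

open Module Topology Filter

lemma OneDim.change {k E : Type} [Field k] [AddCommGroup E] [Module k E] {d : End k E}
    {P : ℤ → Submodule k E} {m m' : ℤ} {z z' : E} (h : OneDim d P m z) (hz' : z' ∈ P m')
    (hd : d z' = 0) (hnb : ∀ y ∈ P (m' + 1), d y ≠ z') : m' = m ∧ OneDim d P m z' := by
  have hm : m' = m := by
    by_contra hne
    obtain ⟨y, hy, e⟩ := h.ex m' hne z' hz' hd
    exact hnb y hy e
  subst hm
  refine ⟨rfl, hz', hd, hnb, h.ex, fun x hx hdx => ?_⟩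
  obtain ⟨c, y, hy, e⟩ := h.gen z' hz' hd
  have hc : c ≠ 0 := by
    rintro rfl
    exact hnb y hy (by rw [e, zero_smul, zero_add])
  obtain ⟨c', y', hy', e'⟩ := h.gen x hx hdx
  refine ⟨c' * c⁻¹, y' - (c' * c⁻¹) • y, sub_mem hy' (Submodule.smul_mem _ _ hy), ?_⟩
  rw [e, e', map_sub, map_smul, smul_add, smul_smul, inv_mul_cancel_right₀ hc]
  abel

section Spread

variable {X K J : Type} [MetricSpace X] [CommGroup K] [Finite K] [Finite J]
variable {Ω : Set X} {φ : K →* Equiv.Perm X} {A B S : Subgroup K} {c : J → X → ℝ}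
variable {F F' : Set X} {k : Type} [Field k] {x y : X} {p : ℕ} {a b : K}

/-- The points of `Ω` fixed by `S`. -/
def Fx (Ω : Set X) (φ : K →* Equiv.Perm X) (S : Subgroup K) : Set X :=
  {x | x ∈ Ω ∧ ∀ g ∈ S, φ g x = x}

lemma inv_Fx (h : LAct Ω φ) (A S : Subgroup K) : Inv Ω φ A (Fx Ω φ S) := by
  refine ⟨fun z hz => hz.1, fun g _ z hz => ⟨h.maps g hz.1, fun s hs => ?_⟩⟩
  rw [← Equiv.Perm.mul_apply, ← map_mul, mul_comm, map_mul, Equiv.Perm.mul_apply, hz.2 s hs]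

lemma closed_Fx (h : LAct Ω φ) (S : Subgroup K) :
    ∀ z ∈ Ω, z ∈ closure (Fx Ω φ S) → z ∈ Fx Ω φ S := by
  refine fun z hz hcl => ⟨hz, fun g hg => ?_⟩
  have h1 : (𝓝[Fx Ω φ S] z).NeBot := mem_closure_iff_nhdsWithin_neBot.1 hcl
  have h2 : Tendsto (φ g) (𝓝[Fx Ω φ S] z) (𝓝 (φ g z)) :=
    (h.contAt g hz).tendsto.mono_left nhdsWithin_le_nhds
  have h3 : Tendsto (φ g) (𝓝[Fx Ω φ S] z) (𝓝 z) := by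
    refine Tendsto.congr' ?_ (tendsto_id.mono_left nhdsWithin_le_nhds)
    filter_upwards [self_mem_nhdsWithin] with w hw
    exact (hw.2 g hg).symm
  exact tendsto_nhds_unique h2 h3

lemma Fx_anti (h : S ≤ A) : Fx Ω φ A ⊆ Fx Ω φ S := fun _ hz => ⟨hz.1, fun g hg => hz.2 g (h hg)⟩

lemma fix_zpowers (ha : φ a x = x) : ∀ g ∈ Subgroup.zpowers a, φ g x = x := by
  rintro _ ⟨n, rfl⟩
  obtain ⟨i, rfl | rfl⟩ := n.eq_nat_or_neg
  · change φ (a ^ (i : ℤ)) x = x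
    rw [zpow_natCast]
    exact pow_fix ha i
  · change φ (a ^ (-(i : ℤ))) x = x
    rw [zpow_neg, zpow_natCast]
    exact inv_fix (pow_fix ha i)

lemma mem_Fx_sup : x ∈ Fx Ω φ (S ⊔ Subgroup.zpowers a) ↔ x ∈ Fx Ω φ S ∧ φ a x = x := by
  constructor
  · exact fun h => ⟨Fx_anti le_sup_left h, h.2 a (Subgroup.mem_sup_right
      (Subgroup.mem_zpowers a))⟩
  · rintro ⟨h, ha⟩
    refine ⟨h.1, fun g hg => ?_⟩
    obtain ⟨s, hs, b, hb, rfl⟩ := Subgroup.mem_sup.1 hg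
    exact mul_fix (h.2 s hs) (fix_zpowers ha b hb)

/-- The germs of the chains carried by `F` have one-dimensional homology, with a common generator,
near `y`. -/
def SOD (k : Type) [Field k] (Ω F : Set X) (m : ℤ) (y : X) : Prop :=
  ∃ ℓ : Dual k (Fn k X), ∀ᶠ x in 𝓝 y, x ∈ F →
    OneDim (dd k Ω x) (PP Ω x (Zt F)) m (cls Ω x ℓ)

lemma cls_BD {T0 T1 : End k (Fn k X)} (h0 : Loc Ω x T0) (h1 : Loc Ω x T1)
    (L : ℕ → Dual k (Fn k X)) :
    BD (dd k Ω x) (mop Ω x T0) (mop Ω x T1) (fun i => cls Ω x (L i)) = fun i =>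
      cls Ω x (BD (Dual.transpose del) (Dual.transpose T0) (Dual.transpose T1) L i) := by
  funext i
  rw [BD_apply, BD_apply, map_add, map_smul, mop_cls loc_del]
  split_ifs
  · rw [mop_cls h0]; rfl
  · rw [mop_cls h1]; rfl

lemma loc_tau (h : LAct Ω φ) (hx : x ∈ Ω) (ha : φ a x = x) :
    Loc Ω x (1 - pb (φ a) : End k (Fn k X)) := loc_one.sub (loc_pb h hx ha)

lemma tau_eq (h : LAct Ω φ) (hx : x ∈ Ω) (ha : φ a x = x) :
    tau k Ω φ x a = mop Ω x (1 - pb (φ a)) := by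
  rw [mop_sub loc_one (loc_pb h hx ha), mop_one]

lemma loc_sig (h : LAct Ω φ) (hx : x ∈ Ω) (ha : φ a x = x) :
    Loc Ω x (∑ i ∈ Finset.range p, pb (φ (a ^ i)) : End k (Fn k X)) :=
  loc_sum fun i _ => loc_pb h hx (pow_fix ha i)

lemma sig_eq (h : LAct Ω φ) (hx : x ∈ Ω) (ha : φ a x = x) :
    sig k Ω φ x p a = mop Ω x (∑ i ∈ Finset.range p, pb (φ (a ^ i))) := by
  rw [mop_sum fun i _ => loc_pb h hx (pow_fix ha i)]
  exact Finset.sum_congr rfl fun i _ => (gop_pow h hx ha i).symm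

lemma exists_gen [hp : Fact p.Prime] (hap : a ^ p = 1) {g : K} (hg : g ∈ Subgroup.zpowers a)
    (hg1 : g ≠ 1) : a ∈ Subgroup.zpowers g := by
  have ha1 : a ≠ 1 := by
    rintro rfl
    simp at hg
    exact hg1 hg
  have ho : orderOf a = p := orderOf_eq_prime hap ha1
  have hgp : g ^ p = 1 := by
    obtain ⟨n, rfl⟩ := hg
    rw [← zpow_natCast, ← zpow_mul, mul_comm, zpow_mul, zpow_natCast, hap, one_zpow]
  have hog : orderOf g = p := orderOf_eq_prime hgp hg1
  have hle : Subgroup.zpowers g ≤ Subgroup.zpowers a := Subgroup.zpowers_le.2 hg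
  have : Subgroup.zpowers g = Subgroup.zpowers a :=
    Subgroup.eq_of_le_of_card_ge hle (by rw [Nat.card_zpowers, Nat.card_zpowers, ho, hog])
  rw [this]
  exact Subgroup.mem_zpowers a

lemma cls_bot_of_eq {Y : Submodule k (Fn k X)} {q : ℤ} {e : EE k Ω x} (hY : e ∈ PP Ω x Y q) :
    ∃ ℓ : Dual k (Fn k X), ℓ ∈ gAnn Ω x Y ∧ ℓ ∘ₗ tr q = ℓ ∧ cls Ω x ℓ = e ∧ (q < 0 → ℓ = 0) := by
  by_cases hq : q < 0
  · rw [PP_neg q hq, Submodule.mem_bot] at hY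
    exact ⟨0, zero_mem _, rfl, by rw [hY, map_zero], fun _ => rfl⟩
  · obtain ⟨ℓ, h1, h2, h3⟩ := mem_PP.1 hY
    exact ⟨ℓ, h1, h2, h3, fun h => absurd h hq⟩

/-- The local form of Smith's theorem. -/
lemma spread [hp : Fact p.Prime] [CharP k p] [LocallyCompactSpace X] (h : LAct Ω φ)
    (hc : ∀ j, Continuous (c j)) (hsep : ∀ x y, (∀ j, c j x = c j y) → x = y)
    (hap : a ^ p = 1) {m : ℤ} (hy : y ∈ Fx Ω φ (S ⊔ Subgroup.zpowers a))
    (hF : SOD k Ω (Fx Ω φ S) m y) :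
    ∃ m' ≤ m, SOD k Ω (Fx Ω φ (S ⊔ Subgroup.zpowers a)) m' y ∧
      (m' = m → ∀ᶠ x in 𝓝 y, x ∈ Fx Ω φ S → x ∈ Fx Ω φ (S ⊔ Subgroup.zpowers a)) := by
  by_cases ha1 : a = 1
  · subst ha1
    rw [Subgroup.zpowers_one_eq_bot, sup_bot_eq] at *
    exact ⟨m, le_rfl, hF, fun _ => Eventually.of_forall fun _ => id⟩
  set F := Fx Ω φ S with hFdef
  set F' := Fx Ω φ (S ⊔ Subgroup.zpowers a) with hF'def
  obtain ⟨ℓ, hℓ⟩ := hF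
  have hF'F : F' ⊆ F := Fx_anti le_sup_left
  have hFa : ∀ z ∈ F', φ a z = z := fun z hz => (mem_Fx_sup.1 hz).2
  have hFI : Inv Ω φ (⊥ ⊔ Subgroup.zpowers a) F := inv_Fx h _ _
  have hFm : ∀ z ∈ F, φ a z ∈ F := fun z hz =>
    hFI.2 a (Subgroup.mem_sup_right (Subgroup.mem_zpowers a)) z hz
  have hdec : Dec p a ⊥ (⊥ ⊔ Subgroup.zpowers a) := dec_sup hp.out hap (by simpa using ha1)
  have hAfix : ∀ g ∈ (⊥ ⊔ Subgroup.zpowers a : Subgroup K), ∀ z ∈ F', φ g z = z :=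
    fun g hg z hz => fix_zpowers (hFa z hz) g (by simpa using hg)
  have hnear : ∀ z ∈ F, (∃ g ∈ (⊥ ⊔ Subgroup.zpowers a : Subgroup K), g ≠ 1 ∧ φ g z = z) →
      z ∈ F' := by
    rintro z hz ⟨g, hg, hg1, hgz⟩
    exact mem_Fx_sup.2 ⟨hz, fix_zpowers hgz a (exists_gen hap (by simpa using hg) hg1)⟩
  have hcl := closed_Fx h (S ⊔ Subgroup.zpowers a)
  have hle : ∀ x q, (PP Ω x (Zs F') q : Submodule k (EE k Ω x)) ≤ PP Ω x (Zt F) q := fun x q =>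
    (PP_mono (gAnn_anti (Zt_le_Zs F')) q).trans (PP_mono (gAnn_anti (Zt_anti hF'F)) q)
  have hdat : ∀ x ∈ F', Dat (dd k Ω x) (tau k Ω φ x a) (sig k Ω φ x p a) (PP Ω x (Zt F)) :=
    fun x hx => dat_act h hx.1 (hFa x hx) hap hFI.1 hFm
  have hnil := fun x (hx : x ∈ F') => smith_nil (k := k) h hc hsep hap hdec ha1
    (fun g hg => hAfix g hg x hx) hFI hF'F hAfix hcl hx (Eventually.of_forall hnear)
  have f0 := fun x (hx : x ∈ F') => tau_fix (k := k) h hx.1 (hFa x hx) hFa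
  have f1 := fun x (hx : x ∈ F') => sig_fix (k := k) (p := p) h hx.1 (hFa x hx) hFa
  have hrb := fun x (hx : x ∈ F') (ho : OneDim (dd k Ω x) (PP Ω x (Zt F)) m (cls Ω x ℓ)) =>
    rbd_act h hx.1 (hFa x hx) hap hFI.1 hFm ho
  have hy0 := hℓ.self_of_nhds (hF'F hy)
  obtain ⟨N, hN⟩ := hnil y hy
  obtain ⟨j, z', ho', Y, hY, hE⟩ := smith hy0 (hdat y hy) (hrb y hy hy0) (hle y) (f0 y hy)
    (f1 y hy) hN
  obtain ⟨ℓ', hℓ'1, hℓ'2, rfl⟩ := mem_PP.1 ho'.mem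
  choose L hL1 hL2 hL3 hL4 using fun i => cls_bot_of_eq (hY i)
  set E : ℕ → Dual k (Fn k X) := fun i => cs ℓ 0 i - BD (Dual.transpose del)
    (Dual.transpose (1 - pb (φ a))) (Dual.transpose (∑ i ∈ Finset.range p, pb (φ (a ^ i)))) L i -
    (Pi.single j ℓ' : ℕ → _) i with hEdef
  have hEx : ∀ x ∈ F', (∀ i, E i ∈ gAnn Ω x ⊤) ↔ cs (cls Ω x ℓ) 0 =
      BD (dd k Ω x) (tau k Ω φ x a) (sig k Ω φ x p a) (fun i => cls Ω x (L i)) +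
        Pi.single j (cls Ω x ℓ') := by
    intro x hx
    rw [tau_eq h hx.1 (hFa x hx), sig_eq h hx.1 (hFa x hx),
      cls_BD (loc_tau h hx.1 (hFa x hx)) (loc_sig h hx.1 (hFa x hx)), funext_iff]
    refine forall_congr' fun i => ?_
    rw [← cls_zero, hEdef]
    simp only [map_sub, Pi.add_apply]
    rw [sub_sub, sub_eq_zero]
    have e1 : cls Ω x (cs ℓ 0 i) = (cs (cls Ω x ℓ) 0 : ℕ → EE k Ω x) i := by
      cases i <;> simp
    have e2 : cls Ω x ((Pi.single j ℓ' : ℕ → _) i) =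
        (Pi.single j (cls Ω x ℓ') : ℕ → EE k Ω x) i := by
      by_cases hij : i = j
      · subst hij; simp
      · simp [hij]
    rw [e1, e2]
  have hEy : ∀ i, E i ∈ gAnn Ω y ⊤ := (hEx y hy).2 (by simpa only [hL3] using hE)
  obtain ⟨N0, hN0⟩ : ∃ N0 : ℕ, m + 1 < N0 ∧ j < N0 ∧ 0 < N0 :=
    ⟨(m + 1).toNat + j + 1, by omega, by omega, by omega⟩
  have hE0 : ∀ i, N0 ≤ i → E i = 0 := by
    intro i hi
    have e1 : L i = 0 := hL4 i (by omega)
    have e2 : L (i + 1) = 0 := hL4 (i + 1) (by push_cast; omega)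
    have e3 : (cs ℓ 0 : ℕ → Dual k (Fn k X)) i = 0 := by
      cases i with
      | zero => omega
      | succ i => simp
    have e4 : (Pi.single j ℓ' : ℕ → Dual k (Fn k X)) i = 0 := by
      rw [Pi.single_apply, if_neg (by omega)]
    simp only [hEdef, BD_apply, e1, e2, e3, e4, map_zero, smul_zero, add_zero, sub_zero]
  have hEev : ∀ᶠ x in 𝓝 y, ∀ i, E i ∈ gAnn Ω x ⊤ := by
    have : ∀ᶠ x in 𝓝 y, ∀ i ∈ Finset.range N0, E i ∈ gAnn Ω x ⊤ :=
      (Finset.eventually_all _).2 fun i _ => gAnn_eventually (hEy i)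
    filter_upwards [this] with x hx i
    by_cases hi : i < N0
    · exact hx i (Finset.mem_range.2 hi)
    · rw [hE0 i (by omega)]; exact zero_mem _
  have hLev : ∀ᶠ x in 𝓝 y, ∀ i, L i ∈ gAnn Ω x (Zt F) := by
    have : ∀ᶠ x in 𝓝 y, ∀ i ∈ Finset.range N0, L i ∈ gAnn Ω x (Zt F) :=
      (Finset.eventually_all _).2 fun i _ => gAnn_eventually (hL1 i)
    filter_upwards [this] with x hx i
    by_cases hi : i < N0
    · exact hx i (Finset.mem_range.2 hi)
    · rw [hL4 i (by omega)]; exact zero_mem _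
  have hcycev : ∀ᶠ x in 𝓝 y, ℓ' ∘ₗ del ∈ gAnn Ω x ⊤ := by
    refine gAnn_eventually (cls_zero.1 ?_)
    rw [← mop_cls loc_del, ho'.cyc]
  refine ⟨m - j, by omega, ⟨ℓ', ?_⟩, fun hmj => ?_⟩
  · filter_upwards [hℓ, hEev, hLev, hcycev, gAnn_eventually hℓ'1] with x hox hEx' hLx hcx hℓ'x hx
    have ho := hox (hF'F hx)
    have hEE := (hEx x hx).1 hEx'
    have hYx : (fun i => cls Ω x (L i)) ∈ BP (PP Ω x (Zt F)) (m + 1) := fun i =>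
      cls_mem_PP (hLx i) (hL2 i)
    obtain ⟨N, hN⟩ := hnil x hx
    obtain ⟨j', z1, ho1, -⟩ := smith ho (hdat x hx) (hrb x hx ho) (hle x) (f0 x hx) (f1 x hx) hN
    obtain ⟨hm', hO⟩ := ho1.change (cls_mem_PP hℓ'x hℓ'2)
      (by rw [mop_cls loc_del]; exact cls_zero.2 hcx)
      (fun w hw ew => smith_nb ho (hdat x hx) (hrb x hx ho) (hle x) (f0 x hx) (f1 x hx) hYx hEE
        hw ew)
    rw [hm']
    exact hO.to_relEx (PP_mono (gAnn_anti (Zt_le_Zs F'))) dd_dd fun q =>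
      taut (fun z hz => hz.1) h.opn hcl hx q
  · have hj : j = 0 := by omega
    subst hj
    obtain ⟨v, hv, ev⟩ := smith_zero hy0 (hdat y hy) (hrb y hy hy0) hY hE
    obtain ⟨V, hV1, hV2, rfl⟩ := mem_PP.1 hv
    rw [mop_cls loc_del, ← map_sub, cls_eq] at ev
    have hΩ : ∀ᶠ x in 𝓝 y, x ∈ Ω := h.opn.mem_nhds hy.1
    filter_upwards [hℓ, gAnn_eventually ev, gAnn_eventually hV1, gAnn_eventually hℓ'1, hΩ]
      with x hox hex hVx hℓ'x hxΩ hxF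
    by_contra hn
    have hz : cls Ω x ℓ' = 0 := by
      refine cls_zero.2 (gAnn_off (F := F') (fun z hz => hz.1) ?_
        (gAnn_anti (Zt_le_Zs F') hℓ'x))
      have : x ∉ closure F' := fun hc => hn (hcl x hxΩ hc)
      filter_upwards [isClosed_closure.isOpen_compl.mem_nhds this] with w hw hw'
      exact hw (subset_closure hw')
    refine (hox hxF).nb (cls Ω x V) (cls_mem_PP hVx hV2) ?_
    rw [mop_cls loc_del]
    rw [← cls_eq, map_sub, hz, sub_zero] at hex
    exact hex

end Spread
end SmithFlag

namespace SmithFlag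

open Module Topology Filter

section Local

variable {X K J : Type} [MetricSpace X] [LocallyCompactSpace X] [CommGroup K] [Finite K] [Finite J]
variable {Ω : Set X} {φ : K →* Equiv.Perm X} {A B S T : Subgroup K} {c : J → X → ℝ}
variable {k : Type} [Field k] {x y : X} {p : ℕ} {a b : K} {F F' : Set X}

lemma SOD.congr {m : ℤ} (h : SOD k Ω F m y) (hF : F ⊆ Ω) (hF' : F' ⊆ Ω)
    (he : ∀ᶠ x in 𝓝 y, x ∈ F ↔ x ∈ F') : SOD k Ω F' m y := by
  obtain ⟨ℓ, hℓ⟩ := h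
  refine ⟨ℓ, ?_⟩
  filter_upwards [hℓ, he.eventually_nhds, he] with x hx hex hex' hxF'
  have : (PP Ω x (Zt F) : ℤ → Submodule k (EE k Ω x)) = PP Ω x (Zt F') := funext fun q =>
    le_antisymm (PP_mono (gAnn_local hF (hex.mono fun z hz => hz.1)) q)
      (PP_mono (gAnn_local hF' (hex.mono fun z hz => hz.2)) q)
  rw [← this]
  exact hx (hex'.2 hxF')

lemma SOD.unique {m m' : ℤ} (h : SOD k Ω F m y) (h' : SOD k Ω F m' y) (hy : y ∈ F) : m = m' := by
  obtain ⟨ℓ, hℓ⟩ := h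
  obtain ⟨ℓ', hℓ'⟩ := h'
  have h1 := hℓ.self_of_nhds hy
  exact ((hℓ'.self_of_nhds hy).change h1.mem h1.cyc h1.nb).1

lemma SOD.nonneg {m : ℤ} (h : SOD k Ω F m y) (hy : y ∈ F) : 0 ≤ m := by
  obtain ⟨ℓ, hℓ⟩ := h
  have h1 := hℓ.self_of_nhds hy
  by_contra hm
  have h2 := h1.mem
  rw [PP_neg m (by omega), Submodule.mem_bot] at h2
  exact h1.nb 0 (zero_mem _) (by rw [map_zero, h2])

lemma SOD.eventually {m : ℤ} (h : SOD k Ω F m y) : ∀ᶠ x in 𝓝 y, SOD k Ω F m x := by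
  obtain ⟨ℓ, hℓ⟩ := h
  exact hℓ.eventually_nhds.mono fun x hx => ⟨ℓ, hx⟩

lemma spread_le [hp : Fact p.Prime] [CharP k p] (h : LAct Ω φ)
    (hc : ∀ j, Continuous (c j)) (hsep : ∀ x y, (∀ j, c j x = c j y) → x = y)
    (hap : ∀ a : K, a ^ p = 1) (hST : S ≤ T) {m : ℤ} (hy : y ∈ Fx Ω φ T)
    (hF : SOD k Ω (Fx Ω φ S) m y) :
    ∃ m' ≤ m, SOD k Ω (Fx Ω φ T) m' y ∧
      (m' = m → ∀ᶠ x in 𝓝 y, x ∈ Fx Ω φ S → x ∈ Fx Ω φ T) := by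
  induction S using WellFoundedGT.induction generalizing m with
  | ind S ih =>
    rcases hST.eq_or_lt with rfl | hlt
    · exact ⟨m, le_rfl, hF, fun _ => Eventually.of_forall fun _ => id⟩
    · obtain ⟨a, haT, haS⟩ := SetLike.exists_of_lt hlt
      have hle : S ⊔ Subgroup.zpowers a ≤ T := sup_le hST (Subgroup.zpowers_le.2 haT)
      have hgt : S < S ⊔ Subgroup.zpowers a := lt_of_le_of_ne le_sup_left fun he =>
        haS (he ▸ Subgroup.mem_sup_right (Subgroup.mem_zpowers a))
      obtain ⟨m1, hm1, hs1, he1⟩ := spread h hc hsep (hap a) (Fx_anti hle hy) hF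
      obtain ⟨m2, hm2, hs2, he2⟩ := ih _ hgt hle hs1
      refine ⟨m2, hm2.trans hm1, hs2, fun hm => ?_⟩
      filter_upwards [he1 (by omega), he2 (by omega)] with x h1 h2 hx
      exact h2 (h1 hx)

lemma corank [hp : Fact p.Prime] [CharP k p] (h : LAct Ω φ)
    (hc : ∀ j, Continuous (c j)) (hsep : ∀ x y, (∀ j, c j x = c j y) → x = y)
    (hap : ∀ a : K, a ^ p = 1) (hST : S ≤ T) {m m' : ℤ} (hy : y ∈ Fx Ω φ T)
    (hS : SOD k Ω (Fx Ω φ S) m y) (hT : SOD k Ω (Fx Ω φ T) m' y) (hm : m' < m)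
    (hmax : ∀ S', S < S' → S' ≤ T → ∀ᶠ x in 𝓝 y, x ∈ Fx Ω φ S' → x ∈ Fx Ω φ T)
    (haT : a ∈ T) (haS : a ∉ S) : T = S ⊔ Subgroup.zpowers a := by
  refine le_antisymm (fun b hbT => ?_) (sup_le hST (Subgroup.zpowers_le.2 haT))
  by_contra hbS
  have ha1 : a ≠ 1 := fun e => haS (e ▸ S.one_mem)
  have hba : b ∉ Subgroup.zpowers a := fun hb => hbS (Subgroup.mem_sup_right hb)
  have hb1 : b ≠ 1 := fun e => hba (e ▸ Subgroup.one_mem _)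
  have hab : a ∉ Subgroup.zpowers b := fun ha => hba (exists_gen (hap b) ha ha1)
  have hda : Dec p a (Subgroup.zpowers b) (Subgroup.zpowers a ⊔ Subgroup.zpowers b) := by
    rw [sup_comm]; exact dec_sup hp.out (hap a) hab
  have hdb : Dec p b (Subgroup.zpowers a) (Subgroup.zpowers a ⊔ Subgroup.zpowers b) :=
    dec_sup hp.out (hap b) hba
  have hAT : Subgroup.zpowers a ⊔ Subgroup.zpowers b ≤ T :=
    sup_le (Subgroup.zpowers_le.2 haT) (Subgroup.zpowers_le.2 hbT)
  have hAS : ∀ g ∈ Subgroup.zpowers a ⊔ Subgroup.zpowers b, g ≠ 1 → g ∉ S := by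
    intro g hg hg1 hgS
    obtain ⟨u, hu, v, hv, rfl⟩ := Subgroup.mem_sup.1 hg
    by_cases hv1 : v = 1
    · rw [hv1, mul_one] at hgS hg1
      exact haS (Subgroup.zpowers_le.2 hgS (exists_gen (hap a) hu hg1))
    · have hvm : v ∈ S ⊔ Subgroup.zpowers a := by
        have := Subgroup.mul_mem_sup hgS (Subgroup.inv_mem _ hu)
        rwa [mul_comm u v, mul_inv_cancel_right] at this
      exact hbS (Subgroup.zpowers_le.2 hvm (exists_gen (hap b) hv hv1))
  have hnear : ∀ᶠ z in 𝓝 y, z ∈ Fx Ω φ S →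
      (∃ g ∈ Subgroup.zpowers a ⊔ Subgroup.zpowers b, g ≠ 1 ∧ φ g z = z) → z ∈ Fx Ω φ T := by
    have : ∀ᶠ z in 𝓝 y, ∀ g ∈ Subgroup.zpowers a ⊔ Subgroup.zpowers b, g ≠ 1 →
        z ∈ Fx Ω φ (S ⊔ Subgroup.zpowers g) → z ∈ Fx Ω φ T := by
      refine eventually_all.2 fun g => ?_
      by_cases hg : g ∈ Subgroup.zpowers a ⊔ Subgroup.zpowers b ∧ g ≠ 1
      · refine (hmax (S ⊔ Subgroup.zpowers g) (lt_of_le_of_ne le_sup_left fun he =>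
          hAS g hg.1 hg.2 (he ▸ Subgroup.mem_sup_right (Subgroup.mem_zpowers g)))
          (sup_le hST (Subgroup.zpowers_le.2 (hAT hg.1)))).mono fun z hz _ _ => hz
      · exact Eventually.of_forall fun z h1 h2 => absurd ⟨h1, h2⟩ hg
    filter_upwards [this] with z hz hzS ⟨g, hg, hg1, hgz⟩
    exact hz g hg hg1 (mem_Fx_sup.2 ⟨hzS, hgz⟩)
  have hTfix : ∀ g ∈ Subgroup.zpowers a ⊔ Subgroup.zpowers b, ∀ z ∈ Fx Ω φ T, φ g z = z :=
    fun g hg z hz => hz.2 g (hAT hg)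
  have hcl := closed_Fx h T
  have haf : ∀ z ∈ Fx Ω φ T, φ a z = z := fun z hz => hz.2 a haT
  have hbf : ∀ z ∈ Fx Ω φ T, φ b z = z := fun z hz => hz.2 b hbT
  obtain ⟨N, hNb, hNa⟩ := two_nil (k := k) h hc hsep (hap a) (hap b) hda hdb
    (Subgroup.mem_zpowers a) (Subgroup.mem_zpowers b) ha1 (fun g hg => hTfix g hg y hy)
    (inv_Fx h _ S) (Fx_anti hST) hTfix hcl hy hnear
  obtain ⟨ℓ, hℓ⟩ := hS
  obtain ⟨ℓ', hℓ'⟩ := hT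
  obtain ⟨z', hz'⟩ := (hℓ'.self_of_nhds hy).of_relEx (PP_mono (gAnn_anti (Zt_le_Zs _))) dd_dd
    fun q => taut (fun z hz => hz.1) h.opn hcl hy q
  have hdata := dat_act (k := k) h hy.1 (haf y hy) (hap a) (F := Fx Ω φ S) (fun z hz => hz.1)
    fun z hz => (inv_Fx h ⊤ S).2 a trivial z hz
  have hdatb := dat_act (k := k) h hy.1 (hbf y hy) (hap b) (F := Fx Ω φ S) (fun z hz => hz.1)
    fun z hz => (inv_Fx h ⊤ S).2 b trivial z hz
  exact corank_one (hℓ.self_of_nhds (Fx_anti hST hy)) hz' hm PP_neg hdata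
    (dat_two h hy.1 (haf y hy) (hbf y hy) hdata hdatb)
    (fun q => (PP_mono (gAnn_anti (Zt_le_Zs _)) q).trans
      (PP_mono (gAnn_anti (Zt_anti (Fx_anti hST))) q))
    (tau_fix h hy.1 (haf y hy) haf) (sig_fix h hy.1 (haf y hy) haf)
    (tau_fix h hy.1 (hbf y hy) hbf) (sig_fix h hy.1 (hbf y hy) hbf) hNb hNa
    (deg2_sh2.bor (fun _ => rfl) (fun _ => rfl))

lemma card_sup (hp : p.Prime) (hap : a ^ p = 1) (ha : a ∉ S) :
    Nat.card (S ⊔ Subgroup.zpowers a : Subgroup K) = p * Nat.card S := by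
  have ha1 : a ≠ 1 := fun e => ha (e ▸ S.one_mem)
  have : Fact p.Prime := ⟨hp⟩
  have hdis : Disjoint S (Subgroup.zpowers a) := by
    rw [Subgroup.disjoint_def]
    intro g hg hga
    by_contra hg1
    exact ha (Subgroup.zpowers_le.2 hg (exists_gen hap hga hg1))
  have h2 : Nat.card (S ⊔ Subgroup.zpowers a : Subgroup K) =
      Nat.card S * Nat.card (Subgroup.zpowers a) := by
    have e : Function.Bijective (fun u : S × Subgroup.zpowers a =>
        (⟨u.1 * u.2, Subgroup.mul_mem_sup u.1.2 u.2.2⟩ :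
          (S ⊔ Subgroup.zpowers a : Subgroup K))) := by
      constructor
      · intro u v huv
        exact Subgroup.mul_injective_of_disjoint hdis (Subtype.ext_iff.1 huv)
      · rintro ⟨g, hg⟩
        obtain ⟨u, hu, v, hv, rfl⟩ := Subgroup.mem_sup.1 hg
        exact ⟨(⟨u, hu⟩, ⟨v, hv⟩), rfl⟩
    rw [← Nat.card_congr (Equiv.ofBijective _ e), Nat.card_prod]
  rw [h2, Nat.card_zpowers, orderOf_eq_prime hap ha1, mul_comm]

lemma Fx_bot : Fx Ω φ ⊥ = Ω := by
  ext z
  refine ⟨fun h => h.1, fun h => ⟨h, fun g hg => ?_⟩⟩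
  rw [Subgroup.mem_bot.1 hg, map_one, Equiv.Perm.one_apply]

lemma local_closed [hp : Fact p.Prime] [CharP k p] (h : LAct Ω φ)
    (hc : ∀ j, Continuous (c j)) (hsep : ∀ x y, (∀ j, c j x = c j y) → x = y)
    (hap : a ^ p = 1) {n : ℤ} (hy : y ∈ Ω) (ha : φ a y = y)
    (hn : SOD k Ω Ω n y) (hfr : ∃ᶠ x in 𝓝 y, ∀ᶠ z in 𝓝 x, φ a z = z) :
    ∀ᶠ z in 𝓝 y, φ a z = z := by
  have hΩ : ∀ᶠ x in 𝓝 y, x ∈ Ω := h.opn.mem_nhds hy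
  obtain ⟨m', -, hs, he⟩ := spread h hc hsep (S := ⊥) hap
    (mem_Fx_sup.2 ⟨by rwa [Fx_bot], ha⟩) (by rwa [Fx_bot])
  rw [Fx_bot] at he
  obtain ⟨x, hx, hxn, hxs, hxΩ⟩ :=
    (hfr.and_eventually (hn.eventually.and (hs.eventually.and hΩ))).exists
  have hxn' : SOD k Ω (Fx Ω φ (⊥ ⊔ Subgroup.zpowers a)) n x := by
    refine hxn.congr subset_rfl (fun z hz => hz.1) ?_
    filter_upwards [hx, h.opn.mem_nhds hxΩ] with z hz hzΩ
    refine ⟨fun hz' => mem_Fx_sup.2 ⟨by rwa [Fx_bot], hz⟩, fun hz' => hz'.1⟩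
  have hm := hxs.unique hxn' (mem_Fx_sup.2 ⟨by rwa [Fx_bot], hx.self_of_nhds⟩)
  filter_upwards [he hm, hΩ] with z hz hzΩ
  exact (mem_Fx_sup.1 (hz hzΩ)).2

lemma local_drop [hp : Fact p.Prime] [CharP k p] (h : LAct Ω φ)
    (hc : ∀ j, Continuous (c j)) (hsep : ∀ x y, (∀ j, c j x = c j y) → x = y)
    (hap : ∀ a : K, a ^ p = 1) {n : ℤ} (hy : y ∈ Fx Ω φ T) (hn : SOD k Ω Ω n y)
    (heff : ∀ g : K, (∀ᶠ z in 𝓝 y, φ g z = z) → g = 1) {m' : ℤ}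
    (hT : SOD k Ω (Fx Ω φ T) m' y) (hT1 : T ≠ ⊥) :
    ∃ S < T, ∃ m > m', SOD k Ω (Fx Ω φ S) m y ∧ Nat.card T = p * Nat.card S ∧
      ∃ᶠ x in 𝓝 y, x ∈ Ω ∧ ∀ g ∈ T, φ g x = x ↔ g ∈ S := by
  have hΩ : ∀ᶠ x in 𝓝 y, x ∈ Ω := h.opn.mem_nhds hy.1
  set good : Set (Subgroup K) := {S | S ≤ T ∧ ¬ ∀ᶠ x in 𝓝 y, x ∈ Fx Ω φ S → x ∈ Fx Ω φ T}
    with hgood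
  have hbot : ⊥ ∈ good := by
    refine ⟨bot_le, fun hev => hT1 ?_⟩
    rw [eq_bot_iff]
    intro g hg
    refine Subgroup.mem_bot.2 (heff g ?_)
    filter_upwards [hev, hΩ] with z hz hzΩ
    exact (hz (by rwa [Fx_bot])).2 g hg
  obtain ⟨S, ⟨hST, hSne⟩, hmax⟩ := (Set.toFinite good).exists_maximal ⟨⊥, hbot⟩
  have hmax' : ∀ S', S < S' → S' ≤ T → ∀ᶠ x in 𝓝 y, x ∈ Fx Ω φ S' → x ∈ Fx Ω φ T := by
    intro S' hlt hle
    by_contra hcon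
    exact absurd (hmax ⟨hle, hcon⟩ hlt.le) (not_le_of_gt hlt)
  have hlt : S < T := lt_of_le_of_ne hST fun he => hSne (by
    rw [he]; exact Eventually.of_forall fun _ => id)
  obtain ⟨m, -, hs, -⟩ := spread_le h hc hsep hap (S := ⊥) bot_le (Fx_anti hST hy)
    (by rwa [Fx_bot])
  obtain ⟨m1, hm1, hs1, he1⟩ := spread_le h hc hsep hap hST hy hs
  have hm' := hs1.unique hT hy
  have hmm : m' < m := lt_of_le_of_ne (hm' ▸ hm1) fun he => hSne (he1 (by omega))
  obtain ⟨a, haT, haS⟩ := SetLike.exists_of_lt hlt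
  have hTe := corank h hc hsep hap hST hy hs hT hmm hmax' haT haS
  refine ⟨S, hlt, m, hmm, hs, by rw [hTe]; exact card_sup hp.out (hap a) haS, ?_⟩
  have hev : ∀ᶠ x in 𝓝 y, ∀ g ∈ T, g ∉ S → x ∈ Fx Ω φ (S ⊔ Subgroup.zpowers g) →
      x ∈ Fx Ω φ T := by
    refine eventually_all.2 fun g => ?_
    by_cases hg : g ∈ T ∧ g ∉ S
    · exact (hmax' (S ⊔ Subgroup.zpowers g) (lt_of_le_of_ne le_sup_left fun he =>
        hg.2 (he ▸ Subgroup.mem_sup_right (Subgroup.mem_zpowers g)))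
        (sup_le hST (Subgroup.zpowers_le.2 hg.1))).mono fun z hz _ _ => hz
    · exact Eventually.of_forall fun z h1 h2 => absurd ⟨h1, h2⟩ hg
  refine ((not_eventually.1 hSne).and_eventually hev).mono fun x hx => ?_
  obtain ⟨hx1, hx2⟩ := hx
  push Not at hx1
  refine ⟨hx1.1.1, fun g hg => ⟨fun hgx => ?_, fun hgS => hx1.1.2 g hgS⟩⟩
  by_contra hgS
  exact hx1.2 (hx2 g hg hgS (mem_Fx_sup.2 ⟨hx1.1, hgx⟩))

lemma local_card [hp : Fact p.Prime] [CharP k p] (h : LAct Ω φ)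
    (hc : ∀ j, Continuous (c j)) (hsep : ∀ x y, (∀ j, c j x = c j y) → x = y)
    (hap : ∀ a : K, a ^ p = 1) {n : ℕ} (hn : SOD k Ω Ω n y)
    (heff : ∀ g : K, (∀ᶠ z in 𝓝 y, φ g z = z) → g = 1) (hy : y ∈ Fx Ω φ T) {m : ℕ}
    (hT : SOD k Ω (Fx Ω φ T) m y) : Nat.card T * p ^ m ≤ p ^ n := by
  induction T using WellFoundedLT.induction generalizing m with
  | ind T ih =>
    by_cases hT1 : T = ⊥
    · subst hT1
      rw [Fx_bot] at hT hy
      have := hT.unique hn hy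
      have : m = n := by omega
      subst this
      simp
    · obtain ⟨S, hlt, m1, hm1, hs, hcard, -⟩ := local_drop h hc hsep hap hy hn heff hT hT1
      lift m1 to ℕ using by omega
      have h1 := ih S hlt (Fx_anti hlt.le hy) hs
      rw [hcard]
      calc p * Nat.card S * p ^ m = Nat.card S * p ^ (m + 1) := by ring
        _ ≤ Nat.card S * p ^ m1 :=
          Nat.mul_le_mul_left _ (Nat.pow_le_pow_right hp.out.pos (by omega))
        _ ≤ p ^ n := h1

/-- The local structure of an action of an elementary abelian group near a fixed point. -/
theorem local_structure [hp : Fact p.Prime] [CharP k p] (h : LAct Ω φ)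
    (hc : ∀ j, Continuous (c j)) (hsep : ∀ x y, (∀ j, c j x = c j y) → x = y)
    (hap : ∀ a : K, a ^ p = 1) {n : ℕ} (hy : y ∈ Ω) (hfix : ∀ g, φ g y = y) (hn : SOD k Ω Ω n y)
    (heff : ∀ g : K, (∀ᶠ z in 𝓝 y, φ g z = z) → g = 1) :
    Nat.card K ≤ p ^ n ∧ (Nontrivial K → ∃ S : Subgroup K, Nat.card K = p * Nat.card S ∧
      ∃ᶠ x in 𝓝 y, x ∈ Ω ∧ ∀ g, φ g x = x ↔ g ∈ S) := by
  have hyT : y ∈ Fx Ω φ ⊤ := ⟨hy, fun g _ => hfix g⟩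
  obtain ⟨m, -, hs, -⟩ := spread_le h hc hsep hap (S := ⊥) bot_le hyT (by rwa [Fx_bot])
  have hm := hs.nonneg hyT
  lift m to ℕ using hm
  constructor
  · have := local_card h hc hsep hap hn heff hyT hs
    rw [Subgroup.card_top] at this
    exact le_trans (Nat.le_mul_of_pos_right _ (pow_pos hp.out.pos _)) this
  · intro hnt
    obtain ⟨S, -, -, -, -, hcard, hfr⟩ := local_drop h hc hsep hap hyT hn heff hs
      top_ne_bot
    rw [Subgroup.card_top] at hcard
    exact ⟨S, hcard, hfr.mono fun x hx => ⟨hx.1, fun g => hx.2 g trivial⟩⟩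

end Local
end SmithFlag

namespace SmithFlag

open Module Topology Filter

section Uniform

variable {k X Y : Type} [Field k]

/-- Pull-back of cochains along a map between two spaces. -/
def pl (φ : X → Y) : Fn k Y →ₗ[k] Fn k X := LinearMap.funLeft k k (List.map φ)

lemma pl_apply (φ : X → Y) (f : Fn k Y) (l : List X) : pl φ f l = f (l.map φ) := rfl

lemma del_pl (φ : X → Y) (f : Fn k Y) : del (pl φ f) = pl φ (del f) := by
  funext l
  induction l generalizing f with
  | nil => rfl
  | cons x l ih =>
    rw [pl_apply, List.map_cons, del_cons, del_cons, ← pl_apply φ (del _), ← ih]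
    rfl

lemma tr_pl (q : ℤ) (φ : X → Y) (f : Fn k Y) : tr q (pl φ f) = pl φ (tr q f) := by
  funext l
  simp [tr_apply, pl_apply]

/-- Cochains whose nonzero values have first vertex in `B`. -/
def HS (B : Set X) : Submodule k (Fn k X) where
  carrier := {f | f [] = 0 ∧ ∀ x l, x ∉ B → f (x :: l) = 0}
  add_mem' := by
    rintro f g ⟨hf, hf'⟩ ⟨hg, hg'⟩
    exact ⟨by simp [hf, hg], fun x l h => by simp [hf' x l h, hg' x l h]⟩
  zero_mem' := ⟨rfl, fun _ _ _ => rfl⟩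
  smul_mem' := by
    rintro c f ⟨hf, hf'⟩
    exact ⟨by simp [hf], fun x l h => by simp [hf' x l h]⟩

lemma HS_mono {B B' : Set X} (h : B ⊆ B') : (HS B : Submodule k (Fn k X)) ≤ HS B' :=
  fun _ hf => ⟨hf.1, fun x l hx => hf.2 x l fun h' => hx (h h')⟩

lemma hd_mem_HS (B : Set X) (f : Fn k X) : hd B f ∈ (HS B : Submodule k (Fn k X)) :=
  ⟨hd_nil B f, fun x l hx => by rw [hd_cons, if_neg hx]⟩

lemma prism_zero_head {r : X → X} {f : Fn k X} {x : X} {l : List X}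
    (h : ∀ l', (∀ y ∈ l', y ∈ x :: l ∨ ∃ z ∈ x :: l, y = r z) → f (x :: l') = 0) :
    prism r f (x :: l) = 0 := by
  have key : ∀ (l : List X) (g : Fn k X) (S : Set X), (∀ z ∈ l, z ∈ S ∧ r z ∈ S) →
      (∀ l', In l' S → g l' = 0) → prism r g l = 0 := by
    intro l
    induction l with
    | nil => intros; rfl
    | cons y l ih =>
      intro g S hS hg
      rw [prism_cons, hg, ih (insv y g) S (fun z hz => hS z (List.mem_cons_of_mem _ hz)), sub_zero]
      · intro l' hl'
        exact hg _ (in_cons.2 ⟨(hS y (by simp)).1, hl'⟩)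
      · refine in_cons.2 ⟨(hS y (by simp)).1, in_cons.2 ⟨(hS y (by simp)).2, ?_⟩⟩
        intro z hz
        obtain ⟨w, hw, rfl⟩ := List.mem_map.1 hz
        exact (hS w (List.mem_cons_of_mem _ hw)).2
  rw [prism_cons, h, key l (insv x f) {y | y ∈ x :: l ∨ ∃ z ∈ x :: l, y = r z}, sub_zero]
  · intro z hz
    exact ⟨Or.inl (List.mem_cons_of_mem _ hz), Or.inr ⟨z, List.mem_cons_of_mem _ hz, rfl⟩⟩
  · intro l' hl'
    exact h l' hl'
  · intro y hy
    rcases List.mem_cons.1 hy with rfl | hy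
    · exact Or.inr ⟨x, by simp, rfl⟩
    · obtain ⟨w, hw, rfl⟩ := List.mem_map.1 hy
      exact Or.inr ⟨w, List.mem_cons_of_mem _ hw, rfl⟩

/-- The commutator of the coboundary with the restriction of the first vertex. -/
noncomputable def jmp (Y : Set X) : End k (Fn k X) := del * hd Y - hd Y * del

lemma jmp_apply (Y : Set X) (f : Fn k X) : jmp Y f = del (hd Y f) - hd Y (del f) := rfl

lemma jmp_del (Y : Set X) (f : Fn k X) : jmp Y (del f) = - del (jmp Y f) := by
  rw [jmp_apply, jmp_apply, map_sub, del_del, del_del, map_zero]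
  abel

@[simp] lemma jmp_nil (Y : Set X) (f : Fn k X) : jmp Y f [] = 0 := by
  rw [jmp_apply, Pi.sub_apply, del_nil, hd_nil, sub_zero]

open Classical in
lemma jmp_cons (Y : Set X) (f : Fn k X) (x : X) (l : List X) :
    jmp Y f (x :: l) = hd Y f l - if x ∈ Y then f l else 0 := by
  have h1 : insv x (hd Y f) = if x ∈ Y then insv x f else 0 := by
    funext l
    rw [insv_apply, hd_cons]
    split_ifs <;> rfl
  rw [jmp_apply, Pi.sub_apply, del_cons, h1, hd_cons, del_cons]
  split_ifs
  · abel
  · simp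

lemma tr_jmp (q : ℤ) (Y : Set X) (f : Fn k X) : jmp Y (tr (q - 1) f) = tr q (jmp Y f) := by
  rw [jmp_apply, jmp_apply, map_sub, ← tr_hd, del_tr, del_tr, tr_hd]

variable [MetricSpace X] [MetricSpace Y]

/-- Cochains vanishing on uniformly small sequences. -/
def SZ : Submodule k (Fn k X) where
  carrier := {f | ∃ ε > 0, ∀ c l, In l (Metric.ball c ε) → f l = 0}
  add_mem' := by
    rintro f g ⟨ε, hε, hf⟩ ⟨ε', hε', hg⟩
    refine ⟨min ε ε', lt_min hε hε', fun c l hl => ?_⟩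
    rw [Pi.add_apply, hf c l (hl.mono (Metric.ball_subset_ball (min_le_left _ _))),
      hg c l (hl.mono (Metric.ball_subset_ball (min_le_right _ _))), add_zero]
  zero_mem' := ⟨1, one_pos, fun _ _ _ => rfl⟩
  smul_mem' := by
    rintro c f ⟨ε, hε, hf⟩
    exact ⟨ε, hε, fun x l hl => by rw [Pi.smul_apply, hf x l hl, smul_zero]⟩

lemma del_mem_SZ {f : Fn k X} (h : f ∈ (SZ : Submodule k (Fn k X))) :
    del f ∈ (SZ : Submodule k (Fn k X)) := by
  obtain ⟨ε, hε, hf⟩ := h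
  exact ⟨ε, hε, fun c l hl => del_zero_of (hf c) l hl⟩

lemma hd_mem_SZ (B : Set X) {f : Fn k X} (h : f ∈ (SZ : Submodule k (Fn k X))) :
    hd B f ∈ (SZ : Submodule k (Fn k X)) := by
  obtain ⟨ε, hε, hf⟩ := h
  refine ⟨ε, hε, fun c l hl => ?_⟩
  cases l with
  | nil => exact hd_nil _ _
  | cons x l =>
    rw [hd_cons, hf c _ hl]
    simp

lemma jmp_mem_SZ (B : Set X) {f : Fn k X} (h : f ∈ (SZ : Submodule k (Fn k X))) :
    jmp B f ∈ (SZ : Submodule k (Fn k X)) :=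
  sub_mem (del_mem_SZ (hd_mem_SZ B h)) (hd_mem_SZ B (del_mem_SZ h))

lemma pl_mem_SZ {φ : X → Y} (hφ : ∀ x y, dist (φ x) (φ y) ≤ dist x y) {f : Fn k Y}
    (h : f ∈ (SZ : Submodule k (Fn k Y))) : pl φ f ∈ (SZ : Submodule k (Fn k X)) := by
  obtain ⟨ε, hε, hf⟩ := h
  refine ⟨ε, hε, fun c l hl => hf (φ c) _ fun y hy => ?_⟩
  obtain ⟨x, hx, rfl⟩ := List.mem_map.1 hy
  exact (hφ x c).trans_lt (hl x hx)

/-- A cochain can be modified away from small sequences. -/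
lemma exists_cut {B : Set X} {u : Fn k X} (h0 : u [] = 0) {ε : ℝ} (hε : 0 < ε)
    (hu : ∀ c x l, In (x :: l) (Metric.ball c ε) → x ∉ B → u (x :: l) = 0) :
    ∃ u' ∈ (HS B : Submodule k (Fn k X)), u' - u ∈ (SZ : Submodule k (Fn k X)) ∧
      ∀ q, tr q u = u → tr q u' = u' := by
  classical
  refine ⟨fun l => if ∃ c, In l (Metric.ball c ε) then u l else 0, ⟨?_, ?_⟩, ⟨ε, hε, ?_⟩, ?_⟩
  · simp [h0]
  · intro x l hx
    dsimp only
    split_ifs with h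
    · obtain ⟨c, hc⟩ := h
      exact hu c x l hc hx
    · rfl
  · intro c l hl
    rw [Pi.sub_apply, if_pos ⟨c, hl⟩, sub_self]
  · intro q hq
    funext l
    have := congrFun hq l
    rw [tr_apply] at this ⊢
    by_cases hl : (l.length : ℤ) = q + 1
    · rw [if_pos hl]
    · rw [if_neg hl] at this ⊢
      rw [← this]
      simp

end Uniform

end SmithFlag

namespace SmithFlag

open Module Topology Filter

section Box

variable {k : Type} [Field k] {n : ℕ}

/-- Translation along the first coordinate. -/
def shift (t : ℝ) (x : Fin (n + 1) → ℝ) : Fin (n + 1) → ℝ := x + Pi.single 0 t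

lemma shift_zero (t : ℝ) (x : Fin (n + 1) → ℝ) : shift t x 0 = x 0 + t := by simp [shift]

lemma shift_succ (t : ℝ) (x : Fin (n + 1) → ℝ) (i : Fin n) : shift t x i.succ = x i.succ := by
  simp [shift]

lemma tail_shift (t : ℝ) (x : Fin (n + 1) → ℝ) : Fin.tail (shift t x) = Fin.tail x :=
  funext fun i => shift_succ t x i

lemma shift_shift (s t : ℝ) (x : Fin (n + 1) → ℝ) : shift s (shift t x) = shift (s + t) x := by
  rw [shift, shift, shift, Pi.single_add]
  abel

lemma dist_shift (t : ℝ) (x y : Fin (n + 1) → ℝ) : dist (shift t x) (shift t y) = dist x y :=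
  dist_add_right _ _ _

lemma dist_shift_self {t : ℝ} (ht : 0 ≤ t) (x : Fin (n + 1) → ℝ) : dist (shift t x) x ≤ t := by
  rw [shift, dist_eq_norm, add_sub_cancel_left]
  refine (pi_norm_le_iff_of_nonneg ht).2 fun i => ?_
  by_cases h : i = 0
  · subst h; simp [abs_of_nonneg ht]
  · simp [h, ht]

/-- The inclusion of a hyperplane. -/
def emb (e : ℝ) (y : Fin n → ℝ) : Fin (n + 1) → ℝ := Fin.cons e y

lemma emb_zero (e : ℝ) (y : Fin n → ℝ) : emb e y 0 = e := rfl

lemma tail_emb (e : ℝ) (y : Fin n → ℝ) : Fin.tail (emb e y) = y := rfl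

lemma dist_emb (e : ℝ) (x y : Fin n → ℝ) : dist (emb e x) (emb e y) ≤ dist x y := by
  refine (dist_pi_le_iff dist_nonneg).2 fun i => ?_
  refine Fin.cases ?_ (fun i => ?_) i
  · rw [emb_zero, emb_zero, dist_self]; exact dist_nonneg
  · exact dist_le_pi_dist x y i

lemma dist_tail (x y : Fin (n + 1) → ℝ) : dist (Fin.tail x) (Fin.tail y) ≤ dist x y :=
  (dist_pi_le_iff dist_nonneg).2 fun i => dist_le_pi_dist x y i.succ

lemma prism_mem_SZ_of {r : (Fin (n + 1) → ℝ) → Fin (n + 1) → ℝ}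
    {f : Fn k (Fin (n + 1) → ℝ)} {ε : ℝ} (hε : 0 < ε) (hr : ∀ x, dist (r x) x ≤ ε / 2)
    (hf : ∀ c l, In l (Metric.ball c ε) → f l = 0) : prism r f ∈ (SZ : Submodule k _) := by
  refine ⟨ε / 2, by positivity, fun c l hl => ?_⟩
  refine prism_zero_of (U := Metric.ball c ε) (fun x hx => ?_) (hf c) l hl
  have h1 : dist x c < ε / 2 := hx
  refine ⟨Metric.mem_ball.2 (by linarith), Metric.mem_ball.2 ?_⟩
  calc dist (r x) c ≤ dist (r x) x + dist x c := dist_triangle _ _ _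
    _ < ε := by linarith [hr x]

/-- A uniform cocycle is cohomologous to its translates. -/
lemma exists_push (f : Fn k (Fin (n + 1) → ℝ)) (hf : del f ∈ (SZ : Submodule k _)) {R : ℝ}
    (hR : 0 ≤ R) : ∃ h : Fn k (Fin (n + 1) → ℝ), h [] = 0 ∧
      del h - (pl (shift R) f - f) ∈ (SZ : Submodule k _) ∧
      ∀ x l, (∀ s, 0 ≤ s → s ≤ R → ∀ l', f (shift s x :: l') = 0) → h (x :: l) = 0 := by
  obtain ⟨ε, hε, hf⟩ := hf
  obtain ⟨N, hN⟩ := exists_nat_gt (R / (ε / 2))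
  have hNpos : (0 : ℝ) < N := lt_of_le_of_lt (by positivity) hN
  set t := R / N with ht
  have ht0 : 0 ≤ t := by positivity
  have ht1 : t ≤ ε / 2 := by
    rw [ht, div_le_iff₀ hNpos]
    rw [div_lt_iff₀ (by positivity)] at hN
    linarith
  have key : ∀ m : ℕ, ∃ h : Fn k (Fin (n + 1) → ℝ), h [] = 0 ∧
      del h - (pl (shift (m * t)) f - f) ∈ (SZ : Submodule k _) ∧
      ∀ x l, (∀ s, 0 ≤ s → s ≤ m * t → ∀ l', f (shift s x :: l') = 0) → h (x :: l) = 0 := by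
    intro m
    induction m with
    | zero =>
      refine ⟨0, rfl, ?_, fun _ _ _ => rfl⟩
      have : pl (shift (((0 : ℕ) : ℝ) * t)) f = f := by
        funext l
        rw [pl_apply]
        congr 1
        conv_rhs => rw [← List.map_id l]
        congr 1
        funext x
        simp [shift]
      rw [this, map_zero, sub_self, sub_self]
      exact zero_mem _
    | succ m ih =>
      obtain ⟨h, h0, h1, h2⟩ := ih
      refine ⟨h + prism (shift t) (pl (shift (m * t)) f), by simp [h0], ?_, ?_⟩
      · have e1 : pb (shift t) (pl (shift (m * t)) f) = pl (shift ((m + 1 : ℕ) * t)) f := by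
          funext l
          rw [pb_apply, pl_apply, pl_apply, List.map_map]
          congr 2
          funext x
          rw [Function.comp_apply, shift_shift]
          congr 1
          push_cast; ring
        have e2 := del_prism (shift t) (pl (shift (m * t)) f)
        rw [e1, del_pl] at e2
        have e3 : prism (shift t) (pl (shift (m * t)) (del f)) ∈
            (SZ : Submodule k (Fn k (Fin (n + 1) → ℝ))) := by
          refine prism_mem_SZ_of hε (fun x => (dist_shift_self ht0 x).trans ht1) fun c l hl => ?_
          refine hf (shift (m * t) c) _ fun y hy => ?_
          obtain ⟨x, hx, rfl⟩ := List.mem_map.1 hy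
          rw [Metric.mem_ball, dist_shift]
          exact hl x hx
        have e4 := sub_mem h1 e3
        rw [map_add, eq_sub_of_add_eq e2]
        convert e4 using 1
        abel
      · intro x l hx
        rw [Pi.add_apply, h2, zero_add]
        · refine prism_zero_head fun l' _ => ?_
          rw [pl_apply, List.map_cons]
          refine hx _ (by positivity) ?_ _
          push_cast
          nlinarith
        · intro s hs hs' l'
          refine hx s hs (hs'.trans ?_) l'
          push_cast
          nlinarith
  obtain ⟨h, h0, h1, h2⟩ := key N
  have : (N : ℝ) * t = R := by rw [ht]; field_simp
  rw [this] at h1 h2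
  exact ⟨h, h0, h1, h2⟩

end Box

end SmithFlag

namespace SmithFlag

open Module Topology Filter

section Box

variable {k : Type} [Field k] {n : ℕ}

/-- A half space. -/
def half (n : ℕ) (e : ℝ) : Set (Fin (n + 1) → ℝ) := {x | e ≤ x 0}

lemma abs_sub_lt_of_ball {c x y : Fin n → ℝ} {ε : ℝ} (hx : x ∈ Metric.ball c ε)
    (hy : y ∈ Metric.ball c ε) (i : Fin n) : |x i - y i| < 2 * ε := by
  have h1 : dist x y < ε + ε := by
    refine (dist_triangle_right x y c).trans_lt (add_lt_add hx hy)
  have h2 := dist_le_pi_dist x y i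
  rw [Real.dist_eq] at h2
  linarith

lemma jmp_half_zero {e ε : ℝ} {f : Fn k (Fin (n + 1) → ℝ)}
    {c x : Fin (n + 1) → ℝ} {l : List (Fin (n + 1) → ℝ)} (hl : In (x :: l) (Metric.ball c ε))
    (h0 : f [] = 0)
    (h : ∀ y l', l = y :: l' → |y 0 - e| < 2 * ε → |x 0 - e| < 2 * ε →
      (∀ i, |x i - y i| < 2 * ε) → f (y :: l') = 0) : jmp (half n e) f (x :: l) = 0 := by
  classical
  rw [jmp_cons]
  cases l with
  | nil => simp [h0]
  | cons y l' =>
    obtain ⟨hx, hl⟩ := in_cons.1 hl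
    obtain ⟨hy, hl⟩ := in_cons.1 hl
    have hxy := abs_sub_lt_of_ball hx hy
    have h00 := abs_lt.1 (hxy 0)
    rw [hd_cons]
    by_cases h1 : e ≤ x 0 <;> by_cases h2 : e ≤ y 0
    · simp [half, h1, h2]
    · have := h y l' rfl (abs_lt.2 ⟨by linarith, by linarith⟩) (abs_lt.2 ⟨by linarith, by linarith⟩)
        hxy
      simp [half, h1, h2, this]
    · have := h y l' rfl (abs_lt.2 ⟨by linarith, by linarith⟩) (abs_lt.2 ⟨by linarith, by linarith⟩)
        hxy
      simp [half, h1, h2, this]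
    · simp [half, h1, h2]

lemma exists_margin {a b : Fin n → ℝ} (h : ∀ i, a i < b i) :
    ∃ ε > 0, ∀ i, a i + ε ≤ b i := by
  obtain ⟨ε, hε⟩ : ∃ ε : ℝ, 0 < ε ∧ ∀ i, a i + ε ≤ b i := by
    have : ∀ᶠ ε : ℝ in 𝓝[>] 0, ∀ i, a i + ε ≤ b i := by
      refine eventually_all.2 fun i => ?_
      have h1 : ∀ᶠ ε : ℝ in 𝓝[>] 0, ε < b i - a i :=
        mem_nhdsWithin_of_mem_nhds (Iio_mem_nhds (sub_pos.2 (h i)))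
      filter_upwards [h1] with ε hε
      linarith
    obtain ⟨ε, h1, h2⟩ := (this.and self_mem_nhdsWithin).exists
    exact ⟨ε, h2, h1⟩
  exact ⟨ε, hε.1, hε.2⟩

/-- Cutting off the jump of a cochain across a hyperplane. -/
lemma exists_cut_jmp {a' b' a b : Fin (n + 1) → ℝ} {e : ℝ} (ha : ∀ i, a' i < a i)
    (hb : ∀ i, b i < b' i) (he : a 0 ≤ e) (he' : e ≤ b 0) {f : Fn k (Fin (n + 1) → ℝ)}
    (h0 : f [] = 0)
    (h : ∀ x l, ¬ (∀ i : Fin n, a i.succ ≤ x i.succ ∧ x i.succ ≤ b i.succ) → f (x :: l) = 0) :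
    ∃ u ∈ (HS (Set.Icc a' b') : Submodule k (Fn k (Fin (n + 1) → ℝ))),
      u - jmp (half n e) f ∈ (SZ : Submodule k (Fn k (Fin (n + 1) → ℝ))) ∧
      ∀ q, tr q (jmp (half n e) f) = jmp (half n e) f → tr q u = u := by
  obtain ⟨ε, hε, h1⟩ := exists_margin ha
  obtain ⟨ε', hε', h2⟩ := exists_margin hb
  refine exists_cut (jmp_nil _ _) (ε := min ε ε' / 2) (by positivity) fun c x l hl hx => ?_
  refine jmp_half_zero hl h0 fun y l' _ h3 h4 h5 => h y l' fun h6 => hx ?_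
  have h7 : 2 * (min ε ε' / 2) ≤ ε := by linarith [min_le_left ε ε']
  have h8 : 2 * (min ε ε' / 2) ≤ ε' := by linarith [min_le_right ε ε']
  have key : ∀ i, a' i ≤ x i ∧ x i ≤ b' i := by
    intro i
    refine Fin.cases ?_ (fun i => ?_) i
    · have := abs_lt.1 h4
      constructor <;> linarith [h1 0, h2 0]
    · have := abs_lt.1 (h5 i.succ)
      have := h6 i
      constructor <;> linarith [h1 i.succ, h2 i.succ]
  exact ⟨fun i => (key i).1, fun i => (key i).2⟩

/-- Desuspension of a compactly supported cocycle. -/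
lemma exists_desuspend {a' b' a b : Fin (n + 1) → ℝ} (ha : ∀ i, a' i < a i)
    (hb : ∀ i, b i < b' i) (hab : ∀ i, a i ≤ b i) {e : ℝ} (he : a' 0 < e) (he' : e < a 0)
    {f : Fn k (Fin (n + 1) → ℝ)} (hf : f ∈ (HS (Set.Icc a b) : Submodule k _))
    (hdf : del f ∈ (SZ : Submodule k (Fn k (Fin (n + 1) → ℝ)))) :
    ∃ g ∈ (HS (Set.Icc (Fin.tail a) (Fin.tail b)) : Submodule k (Fn k (Fin n → ℝ))),
      del g ∈ (SZ : Submodule k (Fn k (Fin n → ℝ))) ∧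
      ∃ u ∈ (HS (Set.Icc a' b') : Submodule k (Fn k (Fin (n + 1) → ℝ))),
        f - del u - jmp (half n e) (pl Fin.tail g) ∈
          (SZ : Submodule k (Fn k (Fin (n + 1) → ℝ))) := by
  classical
  set R : ℝ := b 0 - a' 0 with hR
  have hR0 : 0 ≤ R := by linarith [ha 0, hab 0]
  obtain ⟨h, h0, h1, h2⟩ := exists_push f hdf hR0
  have hfz : ∀ x l, ¬ (∀ i, a i ≤ x i ∧ x i ≤ b i) → f (x :: l) = 0 := by
    intro x l hx
    refine hf.2 x l fun hx' => hx fun i => ⟨hx'.1 i, hx'.2 i⟩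
  have h3 : ∀ x l, ¬ ((∀ i : Fin n, a i.succ ≤ x i.succ ∧ x i.succ ≤ b i.succ) ∧ x 0 ≤ b 0) →
      h (x :: l) = 0 := by
    intro x l hx
    refine h2 x l fun s hs _ l' => hfz _ _ fun hx' => hx ⟨fun i => ?_, ?_⟩
    · have := hx' i.succ
      rwa [shift_succ] at this
    · have := hx' 0
      rw [shift_zero] at this
      linarith
  set r : (Fin (n + 1) → ℝ) → Fin (n + 1) → ℝ := fun x => emb e (Fin.tail x) with hr
  have hr1 : ∀ x y, dist (r x) (r y) ≤ dist x y := fun x y =>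
    (dist_emb _ _ _).trans (dist_tail _ _)
  -- the coboundary of `h` is split off
  set z : Fn k (Fin (n + 1) → ℝ) := del h - (pl (shift R) f - f) with hz
  have hdh : del h = pl (shift R) f - f + z := by rw [hz]; abel
  clear_value z
  have e1 : hd (half n e) (del h) = - f + hd (half n e) z := by
    have e2 : hd (half n e) f = f := by
      funext l
      cases l with
      | nil => rw [hd_nil, hf.1]
      | cons x l =>
        rw [hd_cons]
        split_ifs with hx
        · rfl
        · refine (hfz x l fun hx' => hx ?_).symm
          exact he'.le.trans (hx' 0).1
    have e3 : hd (half n e) (pl (shift R) f) = 0 := by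
      funext l
      cases l with
      | nil => rw [hd_nil]; rfl
      | cons x l =>
        rw [hd_cons]
        split_ifs with hx
        · rw [pl_apply, List.map_cons]
          refine hfz _ _ fun hx' => ?_
          have := (hx' 0).2
          rw [shift_zero] at this
          have hx : e ≤ x 0 := hx
          linarith
        · rfl
    rw [hdh, map_add, map_sub, e2, e3, zero_sub]
  have e2 : f = jmp (half n e) h - del (hd (half n e) h) + hd (half n e) z := by
    rw [jmp_apply, e1]; abel
  have e3 := del_prism r h
  have e4 : jmp (half n e) h = jmp (half n e) (pb r h) + del (jmp (half n e) (prism r h)) -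
      jmp (half n e) (prism r (del h)) := by
    have : h = pb r h - del (prism r h) - prism r (del h) := by rw [sub_sub, e3]; abel
    conv_lhs => rw [this, map_sub, map_sub, jmp_del]
    abel
  have hz1 : jmp (half n e) (prism r (del h)) ∈ (SZ : Submodule k (Fn k (Fin (n + 1) → ℝ))) := by
    obtain ⟨ε, hε, hz'⟩ := h1
    set δ := min (ε / 6) (min ((a 0 - e) / 2) ((e - a' 0) / 2)) with hδ
    have hδ1 : δ ≤ ε / 6 := min_le_left _ _
    have hδ2 : δ ≤ (a 0 - e) / 2 := (min_le_right _ _).trans (min_le_left _ _)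
    have hδ3 : δ ≤ (e - a' 0) / 2 := (min_le_right _ _).trans (min_le_right _ _)
    have hδ0 : 0 < δ := lt_min (by positivity) (lt_min (by linarith) (by linarith))
    refine ⟨δ, hδ0, fun c l hl => ?_⟩
    cases l with
    | nil => exact jmp_nil _ _
    | cons x l =>
      refine jmp_half_zero hl (prism_nil _ _) ?_
      rintro y l' rfl hy hx _
      refine prism_zero_head fun l'' hl'' => ?_
      obtain ⟨hy1, hy2⟩ := abs_lt.1 hy
      have f1 : f (y :: l'') = 0 := by
        refine hfz _ _ fun hx' => ?_
        linarith [(hx' 0).1]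
      have f2 : pl (shift R) f (y :: l'') = 0 := by
        rw [pl_apply, List.map_cons]
        refine hfz _ _ fun hx' => ?_
        have := (hx' 0).2
        rw [shift_zero] at this
        linarith
      rw [hdh, Pi.add_apply, Pi.sub_apply, f1, f2, sub_zero, zero_add]
      refine hz' (r c) _ ?_
      obtain ⟨_, hl⟩ := in_cons.1 hl
      -- all vertices are close to the reflected centre
      have hyc : dist y (r y) ≤ 2 * δ := by
        refine (dist_pi_le_iff (by positivity)).2 fun i => ?_
        refine Fin.cases ?_ (fun i => ?_) i
        · rw [Real.dist_eq]
          exact hy.le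
        · rw [show r y i.succ = y i.succ from rfl, dist_self]
          positivity
      have hball : ∀ w ∈ y :: l', dist w y < 2 * δ ∧ dist (r w) (r c) < δ := by
        intro w hw
        have h1 : dist w c < δ := hl w hw
        have h2 : dist y c < δ := hl y (by simp)
        refine ⟨?_, (hr1 w c).trans_lt h1⟩
        linarith [dist_triangle_right w y c]
      have hbw : ∀ w ∈ y :: l', dist w (r c) < ε := by
        intro w hw
        have h1 := (hball w hw).1
        have h2 := (hball y (by simp)).2
        calc dist w (r c) ≤ dist w y + dist y (r y) + dist (r y) (r c) := dist_triangle4 _ _ _ _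
          _ < ε := by linarith
      refine in_cons.2 ⟨hbw y (by simp), fun w hw => ?_⟩
      rcases hl'' w hw with hw | ⟨w', hw', rfl⟩
      · exact hbw w hw
      · exact (hball w' hw').2.trans (by linarith)
  have hg : pb r h = pl Fin.tail (pl (emb e) h) := by
    funext l
    rw [pb_apply, pl_apply, pl_apply, List.map_map]
    rfl
  refine ⟨pl (emb e) h, ⟨h0, fun y l hy => ?_⟩, ?_, ?_⟩
  · rw [pl_apply, List.map_cons]
    refine h3 _ _ fun hx' => hy ?_
    exact ⟨fun i => (hx'.1 i).1, fun i => (hx'.1 i).2⟩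
  · rw [del_pl, hdh, map_add, map_sub]
    have f1 : pl (emb e) f = 0 := by
      funext l
      rw [pl_apply]
      cases l with
      | nil => exact hf.1
      | cons y l =>
        refine hfz _ _ fun hx' => ?_
        have := (hx' 0).1
        rw [emb_zero] at this
        linarith
    have f2 : pl (emb e) (pl (shift R) f) = 0 := by
      funext l
      rw [pl_apply, pl_apply]
      cases l with
      | nil => exact hf.1
      | cons y l =>
        refine hfz _ _ fun hx' => ?_
        have := (hx' 0).2
        rw [shift_zero, emb_zero] at this
        linarith
    rw [f1, f2, sub_zero, zero_add]
    exact pl_mem_SZ (dist_emb e) h1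
  · have hprism : ∀ x l, ¬ (∀ i : Fin n, a i.succ ≤ x i.succ ∧ x i.succ ≤ b i.succ) →
        prism r h (x :: l) = 0 := fun x l hx =>
      prism_zero_head fun l' _ => h3 x l' fun h => hx h.1
    obtain ⟨u, hu, hu', -⟩ := exists_cut_jmp (a' := a') (b' := b')
      (a := Function.update a 0 e) (b := b) (e := e) (f := prism r h)
      (by
        intro i
        refine Fin.cases (by simpa using he) (fun i => by simpa using ha i.succ) i)
      hb (by simp) (he'.le.trans (hab 0)) (prism_nil _ _) (by simpa using hprism)
    refine ⟨u - hd (half n e) h, sub_mem hu ⟨hd_nil _ _, fun x l hx => ?_⟩, ?_⟩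
    · rw [hd_cons]
      split_ifs with hx0
      · refine h3 x l fun hx' => hx ?_
        have hx0 : e ≤ x 0 := hx0
        have key : ∀ i, a' i ≤ x i ∧ x i ≤ b' i := by
          intro i
          refine Fin.cases ⟨by linarith, by linarith [hb 0, hx'.2]⟩ (fun i => ?_) i
          have := hx'.1 i
          constructor <;> linarith [ha i.succ, hb i.succ]
        exact ⟨fun i => (key i).1, fun i => (key i).2⟩
      · rfl
    · have := sub_mem (sub_mem (hd_mem_SZ (half n e) h1) hz1) (del_mem_SZ hu')
      convert this using 1
      rw [map_sub, map_sub, ← hg]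
      conv_lhs => rw [e2, e4]
      abel

end Box

end SmithFlag

namespace SmithFlag

open Module Topology Filter

section Box

variable {k : Type} [Field k]

lemma subsingleton_SZ {X : Type} [MetricSpace X] [Subsingleton X] [Inhabited X] {f : Fn k X} :
    f ∈ (SZ : Submodule k (Fn k X)) ↔ f = 0 := by
  constructor
  · rintro ⟨ε, hε, h⟩
    funext l
    refine h default l fun x _ => ?_
    rw [Subsingleton.elim x default]
    exact Metric.mem_ball_self hε
  · rintro rfl
    exact zero_mem _

/-- Indicator of the sequences of length one. -/
noncomputable def vtx (k X : Type) [Field k] : Fn k X := del fun l => if l = [] then 1 else 0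

lemma vtx_nil (X : Type) : vtx k X [] = 0 := rfl

lemma vtx_one {X : Type} (x : X) : vtx k X [x] = 1 := by
  rw [vtx, del_cons]
  simp

lemma tr_vtx (X : Type) : tr 0 (vtx k X) = vtx k X := by
  rw [vtx, ← del_tr]
  congr 1
  funext l
  rw [tr_apply]
  cases l <;> simp

lemma eq_del_insv {X : Type} {f : Fn k X} (h : del f = 0) (x : X) : f = del (insv x f) := by
  funext l
  have := congrFun h (x :: l)
  rw [del_cons] at this
  exact sub_eq_zero.1 this

lemma eq_del_add_vtx {X : Type} {f : Fn k X} (h : del f = 0) (x : X) :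
    ∃ u : Fn k X, u [] = 0 ∧ f = del u + f [x] • vtx k X := by
  refine ⟨insv x f - f [x] • (fun l => if l = [] then 1 else 0), ?_, ?_⟩
  · simp [insv_apply]
  · rw [map_sub, map_smul, ← eq_del_insv h]
    rw [vtx, sub_add_cancel]

lemma HS_top {X : Type} {B : Set X} (hB : ∀ x, x ∈ B) {f : Fn k X} (h : f [] = 0) :
    f ∈ (HS B : Submodule k (Fn k X)) := ⟨h, fun x _ hx => absurd (hB x) hx⟩

/-- Two cocycles with compact support in a box are proportional in cohomology. -/
lemma exists_cocycle_relation : ∀ (n : ℕ) (a b a' b' : Fin n → ℝ), (∀ i, a' i < a i) →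
    (∀ i, a i ≤ b i) → (∀ i, b i < b' i) → ∀ f₁ f₂ : Fn k (Fin n → ℝ),
    f₁ ∈ (HS (Set.Icc a b) : Submodule k (Fn k (Fin n → ℝ))) →
    f₂ ∈ (HS (Set.Icc a b) : Submodule k (Fn k (Fin n → ℝ))) →
    del f₁ ∈ (SZ : Submodule k (Fn k (Fin n → ℝ))) →
    del f₂ ∈ (SZ : Submodule k (Fn k (Fin n → ℝ))) →
    ∃ c₁ c₂ : k, (c₁ ≠ 0 ∨ c₂ ≠ 0) ∧ ∃ u ∈ (HS (Set.Icc a' b') : Submodule k (Fn k (Fin n → ℝ))),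
      c₁ • f₁ + c₂ • f₂ - del u ∈ (SZ : Submodule k (Fn k (Fin n → ℝ))) := by
  intro n
  induction n with
  | zero =>
    intro a b a' b' _ _ _ f₁ f₂ _ _ h1 h2
    rw [subsingleton_SZ] at h1 h2
    obtain ⟨u₁, hu₁, e₁⟩ := eq_del_add_vtx h1 default
    obtain ⟨u₂, hu₂, e₂⟩ := eq_del_add_vtx h2 default
    obtain ⟨c₁, c₂, hc, hc'⟩ : ∃ c₁ c₂ : k, (c₁ ≠ 0 ∨ c₂ ≠ 0) ∧
        c₁ * f₁ [default] + c₂ * f₂ [default] = 0 := by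
      by_cases h : f₁ [default] = 0
      · exact ⟨1, 0, Or.inl one_ne_zero, by rw [h]; ring⟩
      · exact ⟨f₂ [default], - f₁ [default], Or.inr (neg_ne_zero.2 h), by ring⟩
    refine ⟨c₁, c₂, hc, c₁ • u₁ + c₂ • u₂,
      HS_top (B := Set.Icc a' b') (fun x => ⟨fun i => i.elim0, fun i => i.elim0⟩)
        (by simp [hu₁, hu₂]), ?_⟩
    rw [subsingleton_SZ, map_add, map_smul, map_smul]
    have : c₁ • f₁ + c₂ • f₂ - (c₁ • del u₁ + c₂ • del u₂) =
        (c₁ * f₁ [default] + c₂ * f₂ [default]) • vtx k (Fin 0 → ℝ) := by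
      conv_lhs => rw [e₁, e₂]
      module
    rw [this, hc', zero_smul]
  | succ n ih =>
    intro a b a' b' ha hab hb f₁ f₂ hf₁ hf₂ h1 h2
    set e := (a' 0 + a 0) / 2 with he
    have he1 : a' 0 < e := by linarith [ha 0]
    have he2 : e < a 0 := by linarith [ha 0]
    obtain ⟨g₁, hg₁, hdg₁, u₁, hu₁, e₁⟩ := exists_desuspend ha hb hab he1 he2 hf₁ h1
    obtain ⟨g₂, hg₂, hdg₂, u₂, hu₂, e₂⟩ := exists_desuspend ha hb hab he1 he2 hf₂ h2
    set a'' : Fin (n + 1) → ℝ := fun i => (a' i + a i) / 2 with ha''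
    set b'' : Fin (n + 1) → ℝ := fun i => (b i + b' i) / 2 with hb''
    have A1 : ∀ i, a' i < a'' i := fun i => by
      change a' i < (a' i + a i) / 2; linarith [ha i]
    have A2 : ∀ i, a'' i < a i := fun i => by
      change (a' i + a i) / 2 < a i; linarith [ha i]
    have B1 : ∀ i, b'' i < b' i := fun i => by
      change (b i + b' i) / 2 < b' i; linarith [hb i]
    have B2 : ∀ i, b i < b'' i := fun i => by
      change b i < (b i + b' i) / 2; linarith [hb i]
    obtain ⟨c₁, c₂, hc, v, hv, e₃⟩ := ih (Fin.tail a) (Fin.tail b) (Fin.tail a'') (Fin.tail b'')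
      (fun i => A2 i.succ) (fun i => hab i.succ) (fun i => B2 i.succ) g₁ g₂ hg₁ hg₂ hdg₁ hdg₂
    obtain ⟨w, hw, hw', -⟩ := exists_cut_jmp (e := e) A1 B1 le_rfl
      (he2.le.trans ((hab 0).trans (B2 0).le)) (f := pl Fin.tail v) hv.1 (by
        intro x l hx
        exact hv.2 _ _ fun h => hx fun i => ⟨h.1 i, h.2 i⟩)
    refine ⟨c₁, c₂, hc, c₁ • u₁ + c₂ • u₂ - w,
      sub_mem (add_mem (Submodule.smul_mem _ _ hu₁) (Submodule.smul_mem _ _ hu₂)) hw, ?_⟩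
    have e₄ := jmp_mem_SZ (half n e) (pl_mem_SZ dist_tail e₃)
    have e₅ := add_mem (add_mem (add_mem (Submodule.smul_mem _ c₁ e₁)
      (Submodule.smul_mem _ c₂ e₂)) e₄) (del_mem_SZ hw')
    convert e₅ using 1
    simp only [map_add, map_sub, map_smul, ← del_pl, jmp_del]
    module

/-- Every box carries a cocycle which does not bound with compact support. -/
lemma exists_generator : ∀ (n : ℕ) (a b : Fin n → ℝ), (∀ i, a i < b i) →
    ∃ f ∈ (HS (Set.Icc a b) : Submodule k (Fn k (Fin n → ℝ))), tr n f = f ∧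
      del f ∈ (SZ : Submodule k (Fn k (Fin n → ℝ))) ∧
      ∀ a' b' : Fin n → ℝ, ∀ u ∈ (HS (Set.Icc a' b') : Submodule k (Fn k (Fin n → ℝ))),
        f - del u ∉ (SZ : Submodule k (Fn k (Fin n → ℝ))) := by
  intro n
  induction n with
  | zero =>
    intro a b _
    refine ⟨vtx k _, HS_top (B := Set.Icc a b) (fun x => ⟨fun i => i.elim0, fun i => i.elim0⟩)
      (vtx_nil _),
      tr_vtx _, ?_, ?_⟩
    · rw [vtx, del_del]
      exact zero_mem _
    · intro a' b' u hu h
      rw [subsingleton_SZ] at h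
      have := congrFun h [default]
      rw [Pi.sub_apply, vtx_one, del_cons, hu.1] at this
      simp at this
  | succ n ih =>
    intro a b hab
    set a₁ : Fin (n + 1) → ℝ := fun i => (2 * a i + b i) / 3 with ha₁
    set b₁ : Fin (n + 1) → ℝ := fun i => (a i + 2 * b i) / 3 with hb₁
    have A1 : ∀ i, a i < a₁ i := fun i => by
      change a i < (2 * a i + b i) / 3; linarith [hab i]
    have B1 : ∀ i, b₁ i < b i := fun i => by
      change (a i + 2 * b i) / 3 < b i; linarith [hab i]
    have C1 : ∀ i, a₁ i < b₁ i := fun i => by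
      change (2 * a i + b i) / 3 < (a i + 2 * b i) / 3; linarith [hab i]
    obtain ⟨g, hg, htr, hdg, hn⟩ := ih (Fin.tail a₁) (Fin.tail b₁) fun i => C1 i.succ
    set e := a₁ 0 with he
    obtain ⟨f, hf, hf', hf''⟩ := exists_cut_jmp (e := e) A1 B1 le_rfl (C1 0).le
      (f := pl Fin.tail g) hg.1 (by
        intro x l hx
        exact hg.2 _ _ fun h => hx fun i => ⟨h.1 i, h.2 i⟩)
    set G := pl (X := Fin (n + 1) → ℝ) Fin.tail g with hG
    have hdG : del G ∈ (SZ : Submodule k (Fn k (Fin (n + 1) → ℝ))) := by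
      rw [hG, del_pl]
      exact pl_mem_SZ dist_tail hdg
    have hJ : del (jmp (half n e) G) ∈ (SZ : Submodule k (Fn k (Fin (n + 1) → ℝ))) := by
      have := neg_mem (jmp_mem_SZ (half n e) hdG)
      rwa [jmp_del, neg_neg] at this
    refine ⟨f, hf, hf'' _ ?_, ?_, ?_⟩
    · rw [← tr_jmp, hG, tr_pl]
      have : ((n + 1 : ℕ) : ℤ) - 1 = n := by push_cast; ring
      rw [this, htr]
    · have := add_mem (del_mem_SZ hf') hJ
      rwa [map_sub, sub_add_cancel] at this
    · intro a' b' u hu hfu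
      set w := u - hd (half n e) G with hw
      have hdw : del w ∈ (SZ : Submodule k (Fn k (Fin (n + 1) → ℝ))) := by
        have h1 := sub_mem hf' hfu
        have h2 := sub_mem h1 (hd_mem_SZ (half n e) hdG)
        convert h2 using 1
        rw [hw, map_sub, jmp_apply]
        abel
      -- compare the two ends of a long line
      set S := max (- a' 0) (- e) + 1 with hS
      set T := max (b' 0) e + 1 with hT
      have hS1 : - S < a' 0 := by linarith [le_max_left (- a' 0) (- e)]
      have hS2 : - S < e := by linarith [le_max_right (- a' 0) (- e)]
      have hT1 : b' 0 < T := by linarith [le_max_left (b' 0) e]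
      have hT2 : e < T := by linarith [le_max_right (b' 0) e]
      have hR : 0 ≤ T + S := by linarith
      obtain ⟨h, h0, h1, h2⟩ := exists_push w hdw hR
      have h3 := pl_mem_SZ (dist_emb (- S)) h1
      have w0 : w [] = 0 := by rw [hw, Pi.sub_apply, hu.1, hd_nil, sub_zero]
      have f1 : pl (emb (- S)) w = 0 := by
        funext l
        cases l with
        | nil => exact w0
        | cons y l =>
          rw [pl_apply, List.map_cons, hw, Pi.sub_apply, hu.2, hd_cons, if_neg, sub_zero]
          · rfl
          · intro hx
            have hx : e ≤ - S := hx
            linarith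
          · intro hx
            have := hx.1 0
            rw [emb_zero] at this
            linarith
      have f2 : pl (emb (- S)) (pl (shift (T + S)) w) = - g := by
        funext l
        cases l with
        | nil =>
          rw [pl_apply, pl_apply, Pi.neg_apply, hg.1, neg_zero]
          exact w0
        | cons y l =>
          rw [pl_apply, pl_apply, List.map_cons, List.map_cons, hw, Pi.sub_apply, hu.2, hd_cons,
            if_pos, zero_sub, hG, pl_apply, Pi.neg_apply, List.map_cons, List.map_map,
            List.map_map, tail_shift, tail_emb]
          · congr 3
            conv_rhs => rw [← List.map_id l]
            congr 1
            funext x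
            rw [Function.comp_apply, Function.comp_apply, tail_shift, tail_emb, id]
          · change e ≤ _
            rw [shift_zero, emb_zero]
            linarith
          · intro hx
            have := hx.2 0
            rw [shift_zero, emb_zero] at this
            linarith
      rw [map_sub, map_sub, f1, f2, sub_zero, ← del_pl] at h3
      refine hn (fun i => min (a' i.succ) (a₁ i.succ)) (fun i => max (b' i.succ) (b₁ i.succ))
        (- pl (emb (- S)) h) (neg_mem ⟨h0, fun y l hy => ?_⟩) ?_
      · rw [pl_apply, List.map_cons]
        refine h2 _ _ fun s _ _ l' => ?_
        rw [hw, Pi.sub_apply, hu.2, hd_cons, hG, pl_apply, List.map_cons, hg.2]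
        · simp
        · intro hx
          rw [tail_shift, tail_emb] at hx
          exact hy ⟨fun i => (min_le_right _ _).trans (hx.1 i),
            fun i => (hx.2 i).trans (le_max_right _ _)⟩
        · intro hx
          refine hy ⟨fun i => (min_le_left _ _).trans ?_, fun i => le_trans ?_ (le_max_left _ _)⟩
          · have := hx.1 i.succ
            rwa [shift_succ] at this
          · have := hx.2 i.succ
            rwa [shift_succ] at this
      · convert h3 using 1
        rw [map_neg]
        abel

end Box

end SmithFlag

namespace SmithFlag

open Module Topology Filter

section NormalForm

variable {k X : Type} [Field k] [MetricSpace X] {Ω : Set X}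

lemma SZ_le_Zt (F : Set X) : (SZ : Submodule k (Fn k X)) ≤ Zt F := by
  rintro f ⟨ε, hε, hf⟩ x _
  exact ⟨Metric.ball x ε, Metric.ball_mem_nhds _ hε, hf x⟩

lemma mem_SZ_of_mem_Zt {g : Fn k X} (hg : g ∈ (Zt Ω : Submodule k (Fn k X))) {K : Set X}
    (hK : IsCompact K) (hKΩ : K ⊆ Ω) (h : ∀ l, In l Kᶜ → g l = 0) :
    g ∈ (SZ : Submodule k (Fn k X)) := by
  choose! U hU hU' using hg
  obtain ⟨δ, hδ, hδ'⟩ := lebesgue_number_lemma_of_metric (c := fun x : K => interior (U x)) hK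
    (fun _ => isOpen_interior) (fun x hx => Set.mem_iUnion.2
      ⟨⟨x, hx⟩, mem_interior_iff_mem_nhds.2 (hU x (hKΩ hx))⟩)
  refine ⟨δ / 2, by positivity, fun c l hl => ?_⟩
  by_cases hK' : In l Kᶜ
  · exact h l hK'
  · unfold In at hK'
    push Not at hK'
    obtain ⟨w, hw, hwK⟩ := hK'
    obtain ⟨⟨x, hx⟩, hx'⟩ := hδ' w (not_not.1 hwK)
    refine hU' x (hKΩ hx) l fun v hv => interior_subset (hx' ?_)
    have h1 : dist v c < δ / 2 := hl v hv
    have h2 : dist w c < δ / 2 := hl w hw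
    rw [Metric.mem_ball]
    linarith [dist_triangle_right v w c]

lemma HS_zero_off {B : Set X} {f : Fn k X} (hf : f ∈ (HS B : Submodule k (Fn k X))) (l : List X)
    (hl : In l Bᶜ) : f l = 0 := by
  cases l with
  | nil => exact hf.1
  | cons x l => exact hf.2 x l (in_cons.1 hl).1

lemma HS_le_AA {B W : Set X} (hB : IsCompact B) (hW : B ⊆ W) (hΩ : B ⊆ Ω) :
    (HS B : Submodule k (Fn k X)) ≤ AA Ω W := by
  intro f hf
  exact ⟨hf.1, B, hB, hW, hΩ, fun x hx =>
    ⟨Bᶜ, hB.isClosed.isOpen_compl.mem_nhds hx.2, HS_zero_off hf⟩⟩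

variable [LocallyCompactSpace X]

lemma exists_normal (hΩ : IsOpen Ω) {W : Set X} (hW : IsOpen W) {f : Fn k X}
    (hf : f ∈ (AA Ω W : Submodule k (Fn k X))) :
    ∃ K, IsCompact K ∧ K ⊆ W ∧ K ⊆ Ω ∧ hd K f ∈ (HS K : Submodule k (Fn k X)) ∧
      f - hd K f ∈ (Zt Ω : Submodule k (Fn k X)) := by
  obtain ⟨h0, L, hL, hLW, hLΩ, h⟩ := hf
  obtain ⟨K, hK, hLK, hKW⟩ := exists_compact_between hL (hW.inter hΩ) (Set.subset_inter hLW hLΩ)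
  refine ⟨K, hK, fun x hx => (hKW hx).1, fun x hx => (hKW hx).2, hd_mem_HS K f, ?_⟩
  intro x hx
  by_cases hxL : x ∈ L
  · refine ⟨interior K, isOpen_interior.mem_nhds (hLK hxL), fun l hl => ?_⟩
    cases l with
    | nil => rw [Pi.sub_apply, h0, hd_nil, sub_zero]
    | cons y l =>
      rw [Pi.sub_apply, hd_cons, if_pos (interior_subset (in_cons.1 hl).1), sub_self]
  · obtain ⟨U, hU, h⟩ := h x ⟨hx, hxL⟩
    refine ⟨U, hU, fun l hl => ?_⟩
    cases l with
    | nil => rw [Pi.sub_apply, h0, hd_nil, sub_zero]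
    | cons y l =>
      rw [Pi.sub_apply, hd_cons, h _ hl]
      simp

lemma del_mem_SZ_of_HS {K : Set X} (hK : IsCompact K) (hKΩ : K ⊆ Ω) {f : Fn k X}
    (hf : f ∈ (HS K : Submodule k (Fn k X))) (h : del f ∈ (Zt Ω : Submodule k (Fn k X))) :
    del f ∈ (SZ : Submodule k (Fn k X)) :=
  mem_SZ_of_mem_Zt h hK hKΩ (del_zero_of (HS_zero_off hf))

end NormalForm

section Box

variable {k : Type} [Field k] {n : ℕ} {Ω : Set (Fin n → ℝ)}

lemma local_relation (hΩ : IsOpen Ω) {a b a' b' : Fin n → ℝ} (ha : ∀ i, a' i < a i)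
    (hab : ∀ i, a i ≤ b i) (hb : ∀ i, b i < b' i) {W W' : Set (Fin n → ℝ)} (hW' : IsOpen W')
    (hWab : W' ⊆ Set.Icc a b) (hab' : Set.Icc a' b' ⊆ W) (habΩ : Set.Icc a' b' ⊆ Ω)
    {f₁ f₂ : Fn k (Fin n → ℝ)} (h₁ : f₁ ∈ (AA Ω W' : Submodule k (Fn k (Fin n → ℝ))))
    (h₂ : f₂ ∈ (AA Ω W' : Submodule k (Fn k (Fin n → ℝ))))
    (hd₁ : del f₁ ∈ (Zt Ω : Submodule k (Fn k (Fin n → ℝ))))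
    (hd₂ : del f₂ ∈ (Zt Ω : Submodule k (Fn k (Fin n → ℝ)))) :
    ∃ c₁ c₂ : k, (c₁ ≠ 0 ∨ c₂ ≠ 0) ∧ ∃ u ∈ (AA Ω W : Submodule k (Fn k (Fin n → ℝ))),
      c₁ • f₁ + c₂ • f₂ - del u ∈ (Zt Ω : Submodule k (Fn k (Fin n → ℝ))) := by
  have key : ∀ f : Fn k (Fin n → ℝ), f ∈ (AA Ω W' : Submodule k (Fn k (Fin n → ℝ))) →
      del f ∈ (Zt Ω : Submodule k (Fn k (Fin n → ℝ))) →
      ∃ g ∈ (HS (Set.Icc a b) : Submodule k (Fn k (Fin n → ℝ))),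
        del g ∈ (SZ : Submodule k (Fn k (Fin n → ℝ))) ∧
        f - g ∈ (Zt Ω : Submodule k (Fn k (Fin n → ℝ))) := by
    intro f hf hdf
    obtain ⟨K, hK, hKW, hKΩ, h1, h2⟩ := exists_normal hΩ hW' hf
    refine ⟨hd K f, HS_mono (hKW.trans hWab) h1, del_mem_SZ_of_HS hK hKΩ h1 ?_, h2⟩
    have := sub_mem hdf (del_mem_Zt h2)
    rwa [map_sub, sub_sub_cancel] at this
  obtain ⟨g₁, k1, k2, k3⟩ := key f₁ h₁ hd₁
  obtain ⟨g₂, m1, m2, m3⟩ := key f₂ h₂ hd₂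
  obtain ⟨c₁, c₂, hc, u, hu, e⟩ := exists_cocycle_relation n a b a' b' ha hab hb g₁ g₂ k1 m1 k2 m2
  refine ⟨c₁, c₂, hc, u, HS_le_AA isCompact_Icc hab' habΩ hu, ?_⟩
  have := add_mem (SZ_le_Zt Ω e) (add_mem (Submodule.smul_mem _ c₁ k3) (Submodule.smul_mem _ c₂ m3))
  convert this using 1
  module

lemma local_generator (k : Type) [Field k] (hΩ : IsOpen Ω) {a b : Fin n → ℝ}
    (hab : ∀ i, a i < b i) {W : Set (Fin n → ℝ)} (hW : Set.Icc a b ⊆ W) (hab' : Set.Icc a b ⊆ Ω) :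
    ∃ f ∈ (AA Ω W : Submodule k (Fn k (Fin n → ℝ))), tr n f = f ∧
      del f ∈ (Zt Ω : Submodule k (Fn k (Fin n → ℝ))) ∧
      ∀ W₀ a' b', IsOpen W₀ → W₀ ⊆ Set.Icc a' b' →
        ∀ u ∈ (AA Ω W₀ : Submodule k (Fn k (Fin n → ℝ))),
        f - del u ∉ (Zt Ω : Submodule k (Fn k (Fin n → ℝ))) := by
  obtain ⟨f, hf, htr, hdf, hn⟩ := exists_generator (k := k) n a b hab
  refine ⟨f, HS_le_AA isCompact_Icc hW hab' hf, htr, SZ_le_Zt Ω hdf, ?_⟩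
  intro W₀ a' b' hW₀ hW₀' u hu h
  obtain ⟨K, hK, hKW, hKΩ, h1, h2⟩ := exists_normal hΩ hW₀ hu
  refine hn a' b' (hd K u) (HS_mono (hKW.trans hW₀') h1) ?_
  refine mem_SZ_of_mem_Zt (Ω := Ω) (K := Set.Icc a b ∪ K) ?_ (isCompact_Icc.union hK)
    (Set.union_subset hab' hKΩ) ?_
  · have := add_mem h (del_mem_Zt h2)
    rwa [map_sub, sub_add_sub_cancel] at this
  · intro l hl
    rw [Pi.sub_apply, HS_zero_off hf l (hl.mono fun x hx h => hx (Or.inl h)),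
      del_zero_of (HS_zero_off h1) l (hl.mono fun x hx h => hx (Or.inr h)), sub_zero]

end Box

end SmithFlag

namespace SmithFlag

open Module Topology Filter

section Fundamental

variable {k : Type} [Field k]

/-- A functional killing the cocycles is a boundary. -/
lemma exists_primitive {X : Type} [MetricSpace X] {Ω W : Set X} {q : ℤ} {ℓ : Dual k (Fn k X)}
    (htr : ℓ ∘ₗ tr q = ℓ)
    (h : ∀ f ∈ (AA Ω W : Submodule k (Fn k X)), del f ∈ (Zt Ω : Submodule k (Fn k X)) → ℓ f = 0) :
    ∃ ℓ' : Dual k (Fn k X), (∀ f ∈ (Zt Ω : Submodule k (Fn k X)), ℓ' f = 0) ∧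
      ℓ' ∘ₗ tr (q + 1) = ℓ' ∧ ∀ f ∈ (AA Ω W : Submodule k (Fn k X)), ℓ' (del f) = ℓ f := by
  set D : (AA Ω W : Submodule k (Fn k X)) →ₗ[k] (Fn k X ⧸ (Zt Ω : Submodule k (Fn k X))) :=
    (Zt Ω : Submodule k (Fn k X)).mkQ ∘ₗ del ∘ₗ (AA Ω W).subtype with hD
  have h1 : ℓ ∘ₗ (AA Ω W).subtype ∈ LinearMap.range D.dualMap := by
    rw [LinearMap.range_dualMap_eq_dualAnnihilator_ker, Submodule.mem_dualAnnihilator]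
    intro f hf
    exact h f f.2 ((Submodule.Quotient.mk_eq_zero _).1 hf)
  obtain ⟨ψ, hψ⟩ := h1
  refine ⟨ψ ∘ₗ (Zt Ω : Submodule k (Fn k X)).mkQ ∘ₗ tr (q + 1), ?_, ?_, ?_⟩
  · intro f hf
    have : (Zt Ω : Submodule k (Fn k X)).mkQ (tr (q + 1) f) = 0 :=
      (Submodule.Quotient.mk_eq_zero _).2 (tr_mem_Zt (q + 1) hf)
    rw [LinearMap.comp_apply, LinearMap.comp_apply, this, map_zero]
  · ext f
    simp only [LinearMap.comp_apply, tr_tr]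
  · intro f hf
    have e1 : tr (q + 1) (del f) = del (tr q f) := by
      rw [← del_tr, add_sub_cancel_right]
    rw [LinearMap.comp_apply, LinearMap.comp_apply, e1]
    have := LinearMap.congr_fun hψ ⟨tr q f, tr_mem_AA q hf⟩
    refine this.trans ?_
    exact LinearMap.congr_fun htr f

variable {n : ℕ} {Ω : Set (Fin n → ℝ)}

lemma ball_subset_box (x : Fin n → ℝ) (s : ℝ) :
    Metric.ball x s ⊆ Set.Icc (fun i => x i - s) (fun i => x i + s) := by
  intro y hy
  have key : ∀ i, |y i - x i| < s := fun i => (dist_le_pi_dist y x i).trans_lt hy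
  exact ⟨fun i => by dsimp only; linarith [(abs_lt.1 (key i)).1],
    fun i => by dsimp only; linarith [(abs_lt.1 (key i)).2]⟩

lemma box_subset_closedBall (x : Fin n → ℝ) {s : ℝ} (hs : 0 ≤ s) :
    Set.Icc (fun i => x i - s) (fun i => x i + s) ⊆ Metric.closedBall x s := by
  intro y hy
  refine (dist_pi_le_iff hs).2 fun i => abs_le.2 ⟨?_, ?_⟩
  · have := hy.1 i; dsimp only at this; linarith
  · have := hy.2 i; dsimp only at this; linarith

/-- Open subsets of Euclidean space carry local fundamental classes. -/
theorem euclidean_SOD (k : Type) [Field k] (hΩ : IsOpen Ω) {y : Fin n → ℝ} (hy : y ∈ Ω) :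
    SOD k Ω Ω n y := by
  obtain ⟨r, hr, hrΩ⟩ := Metric.nhds_basis_closedBall.mem_iff.1 (hΩ.mem_nhds hy)
  set W₀ := Metric.ball y r with hW₀
  have hW₀Ω : W₀ ⊆ Ω := Metric.ball_subset_closedBall.trans hrΩ
  have hW₀box := ball_subset_box y r
  set V₀ := Metric.ball y (r / 2) with hV₀
  have hVW : V₀ ⊆ W₀ := Metric.ball_subset_ball (by linarith)
  -- a functional detecting the generator
  have hb : Set.Icc (fun i => y i - r / 4) (fun i => y i + r / 4) ⊆ V₀ :=
    (box_subset_closedBall y (by positivity)).trans (Metric.closedBall_subset_ball (by linarith))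
  obtain ⟨f₀, hf₀, htr₀, hdf₀, hn₀⟩ := local_generator k hΩ
    (a := fun i => y i - r / 4) (b := fun i => y i + r / 4) (fun i => by linarith) hb
    (hb.trans (hVW.trans hW₀Ω))
  have hf₀S : f₀ ∉ (AA Ω W₀ : Submodule k (Fn k (Fin n → ℝ))).map del ⊔ Zt Ω := by
    intro h
    obtain ⟨_, ⟨u, hu, rfl⟩, z, hz, e⟩ := Submodule.mem_sup.1 h
    refine hn₀ W₀ _ _ Metric.isOpen_ball hW₀box u hu ?_
    rw [← e, add_sub_cancel_left]
    exact hz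
  obtain ⟨Θ₀, hΘ₀, hΘS⟩ := Submodule.exists_le_ker_of_notMem hf₀S
  set Θ : Dual k (Fn k (Fin n → ℝ)) := Θ₀ ∘ₗ tr n with hΘ
  have hΘtr : Θ ∘ₗ tr n = Θ := by
    ext f
    simp only [hΘ, LinearMap.comp_apply, tr_tr]
  have hΘ1 : Θ f₀ ≠ 0 := by rw [hΘ, LinearMap.comp_apply, htr₀]; exact hΘ₀
  have hΘZ : ∀ f ∈ (Zt Ω : Submodule k (Fn k (Fin n → ℝ))), Θ f = 0 := fun f hf =>
    hΘS (Submodule.mem_sup_right (tr_mem_Zt _ hf))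
  have hΘd : ∀ f ∈ (AA Ω W₀ : Submodule k (Fn k (Fin n → ℝ))), Θ (del f) = 0 := fun f hf => by
    refine hΘS (Submodule.mem_sup_left ?_)
    rw [← del_tr]
    exact ⟨_, tr_mem_AA _ hf, rfl⟩
  refine ⟨Θ, ?_⟩
  filter_upwards [Metric.ball_mem_nhds y (half_pos hr)] with x hxV _
  have key : ∀ W, IsOpen W → x ∈ W → ∃ W', IsOpen W' ∧ x ∈ W' ∧ W' ⊆ W ∩ W₀ ∧
      ∃ g ∈ (AA Ω W' : Submodule k (Fn k (Fin n → ℝ))), tr n g = g ∧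
        del g ∈ (Zt Ω : Submodule k (Fn k (Fin n → ℝ))) ∧ Θ g ≠ 0 ∧
        ∀ f ∈ (AA Ω W' : Submodule k (Fn k (Fin n → ℝ))),
          del f ∈ (Zt Ω : Submodule k (Fn k (Fin n → ℝ))) →
          ∃ c : k, ∃ u ∈ (AA Ω (W ∩ W₀) : Submodule k (Fn k (Fin n → ℝ))),
            f - c • g - del u ∈ (Zt Ω : Submodule k (Fn k (Fin n → ℝ))) := by
    intro W hW hxW
    obtain ⟨s, hs, hsW⟩ := Metric.isOpen_iff.1 (hW.inter Metric.isOpen_ball) x ⟨hxW, hxV⟩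
    have hsWW : Metric.ball x s ⊆ W ∩ W₀ := fun z hz => ⟨(hsW hz).1, hVW (hsW hz).2⟩
    have hsub : ∀ t, 0 ≤ t → t < s →
        Set.Icc (fun i => x i - t) (fun i => x i + t) ⊆ Metric.ball x s := fun t ht hts =>
      (box_subset_closedBall x ht).trans (Metric.closedBall_subset_ball hts)
    have hbx : Set.Icc (fun i => x i - s / 4) (fun i => x i + s / 4) ⊆ Metric.ball x (s / 2) :=
      (box_subset_closedBall x (by positivity)).trans (Metric.closedBall_subset_ball (by linarith))
    have hss : Metric.ball x (s / 2) ⊆ Metric.ball x s := Metric.ball_subset_ball (by linarith)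
    obtain ⟨g, hg, htr, hdg, hn⟩ := local_generator k hΩ
      (a := fun i => x i - s / 4) (b := fun i => x i + s / 4) (fun i => by linarith) hbx
      (hbx.trans (hss.trans fun z hz => hW₀Ω (hsWW hz).2))
    have hgne : ∀ c : k, c ≠ 0 → ∀ u ∈ (AA Ω W₀ : Submodule k (Fn k (Fin n → ℝ))),
        c • g - del u ∉ (Zt Ω : Submodule k (Fn k (Fin n → ℝ))) := by
      intro c hc u hu h
      refine hn W₀ _ _ Metric.isOpen_ball hW₀box (c⁻¹ • u) (Submodule.smul_mem _ _ hu) ?_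
      have := Submodule.smul_mem _ c⁻¹ h
      rwa [smul_sub, smul_smul, inv_mul_cancel₀ hc, one_smul, ← map_smul] at this
    refine ⟨Metric.ball x (s / 2), Metric.isOpen_ball, Metric.mem_ball_self (by positivity),
      hss.trans hsWW, g, hg, htr, hdg, ?_, ?_⟩
    · intro hΘg
      have hbig : Set.Icc (fun i => y i - 3 * r / 4) (fun i => y i + 3 * r / 4) ⊆ W₀ :=
        (box_subset_closedBall y (by positivity)).trans
          (Metric.closedBall_subset_ball (by linarith))
      obtain ⟨c₁, c₂, hc, u, hu, e⟩ := local_relation hΩ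
        (a' := fun i => y i - 3 * r / 4) (b' := fun i => y i + 3 * r / 4)
        (a := fun i => y i - r / 2) (b := fun i => y i + r / 2)
        (fun i => by linarith) (fun i => by linarith) (fun i => by linarith)
        Metric.isOpen_ball (ball_subset_box y (r / 2)) hbig (hbig.trans hW₀Ω) hf₀
        (AA_mono (hss.trans fun z hz => (hsW hz).2) hg) hdf₀ hdg
      have h1 := hΘZ _ e
      rw [map_sub, map_add, map_smul, map_smul, hΘg, hΘd u hu, smul_zero, add_zero, sub_zero,
        smul_eq_mul, mul_eq_zero] at h1
      have hc1 : c₁ = 0 := h1.resolve_right hΘ1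
      have hc2 : c₂ ≠ 0 := hc.resolve_left (not_not.2 hc1)
      rw [hc1, zero_smul, zero_add] at e
      exact hgne c₂ hc2 u hu e
    · intro f hf hdf
      have hbig := hsub (3 * s / 4) (by positivity) (by linarith)
      obtain ⟨c₁, c₂, hc, u, hu, e⟩ := local_relation hΩ
        (a' := fun i => x i - 3 * s / 4) (b' := fun i => x i + 3 * s / 4)
        (a := fun i => x i - s / 2) (b := fun i => x i + s / 2)
        (fun i => by linarith) (fun i => by linarith) (fun i => by linarith)
        Metric.isOpen_ball (ball_subset_box x (s / 2)) (hbig.trans hsWW)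
        (hbig.trans fun z hz => hW₀Ω (hsWW hz).2) hg hf hdg hdf
      have hc2 : c₂ ≠ 0 := by
        rintro rfl
        rw [zero_smul, add_zero] at e
        exact hgne c₁ (hc.resolve_right (not_not.2 rfl)) u (AA_mono Set.inter_subset_right hu) e
      refine ⟨- (c₂⁻¹ * c₁), c₂⁻¹ • u, Submodule.smul_mem _ _ hu, ?_⟩
      have := Submodule.smul_mem _ c₂⁻¹ e
      convert this using 1
      rw [map_smul, smul_sub, smul_add, smul_smul, smul_smul, inv_mul_cancel₀ hc2]
      module
  have hxW₀ : x ∈ W₀ := hVW hxV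
  have rep : ∀ q (e : EE k Ω x), e ∈ PP Ω x (Zt Ω) q → dd k Ω x e = 0 →
      ∃ ℓ : Dual k (Fn k (Fin n → ℝ)), ∃ W, IsOpen W ∧ x ∈ W ∧
        (∀ f ∈ (Zt Ω : Submodule k (Fn k (Fin n → ℝ))), ℓ f = 0) ∧ ℓ ∘ₗ tr q = ℓ ∧
        cls Ω x ℓ = e ∧ ∀ f ∈ (AA Ω W : Submodule k (Fn k (Fin n → ℝ))), ℓ (del f) = 0 := by
    intro q e he hde
    obtain ⟨ℓ, h1, h2, rfl⟩ := exists_rep (fun f hf => tr_mem_Zt q hf) he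
    rw [mop_cls loc_del, cls_zero] at hde
    obtain ⟨W, hW, hxW, h⟩ := hde
    exact ⟨ℓ, W, hW, hxW, h1, h2, rfl, fun f hf => h f hf Submodule.mem_top⟩
  have prim : ∀ (q : ℤ) (ℓ : Dual k (Fn k (Fin n → ℝ))) (W : Set (Fin n → ℝ)), IsOpen W → x ∈ W →
      ℓ ∘ₗ tr q = ℓ → (∀ f ∈ (AA Ω W : Submodule k (Fn k (Fin n → ℝ))),
        del f ∈ (Zt Ω : Submodule k (Fn k (Fin n → ℝ))) → ℓ f = 0) →
      ∃ e ∈ PP Ω x (Zt Ω) (q + 1), dd k Ω x e = cls Ω x ℓ := by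
    intro q ℓ W hW hxW htr h
    obtain ⟨ℓ', h1, h2, h3⟩ := exists_primitive htr h
    refine ⟨cls Ω x ℓ', cls_mem_PP ⟨W, hW, hxW, fun f _ hf => h1 f hf⟩ h2, ?_⟩
    rw [mop_cls loc_del, cls_eq]
    refine ⟨W, hW, hxW, fun f hf _ => ?_⟩
    rw [LinearMap.sub_apply, LinearMap.comp_apply, h3 f hf, sub_self]
  constructor
  · exact cls_mem_PP ⟨W₀, Metric.isOpen_ball, hxW₀, fun f _ hf => hΘZ f hf⟩ hΘtr
  · rw [mop_cls loc_del, cls_zero]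
    exact ⟨W₀, Metric.isOpen_ball, hxW₀, fun f hf _ => hΘd f hf⟩
  · intro e he h
    obtain ⟨ℓ, ⟨W₁, hW₁, hxW₁, h1⟩, _, rfl⟩ := mem_PP.1 he
    rw [mop_cls loc_del, cls_eq] at h
    obtain ⟨W₂, hW₂, hxW₂, h2⟩ := h
    obtain ⟨W', _, _, hsub, g, hg, _, hdg, hΘg, _⟩ := key (W₁ ∩ W₂) (hW₁.inter hW₂) ⟨hxW₁, hxW₂⟩
    have h3 := h2 g (AA_mono (fun z hz => (hsub hz).1.2) hg) Submodule.mem_top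
    rw [LinearMap.sub_apply, LinearMap.comp_apply,
      h1 _ (del_mem_AA (AA_mono (fun z hz => (hsub hz).1.1) hg)) hdg, zero_sub, neg_eq_zero] at h3
    exact hΘg h3
  · intro q hq e he hde
    obtain ⟨ℓ, W, hW, hxW, h1, h2, rfl, h3⟩ := rep q e he hde
    obtain ⟨W', hW', hxW', hsub, g, hg, htr, hdg, hΘg, hrel⟩ := key W hW hxW
    refine prim q ℓ W' hW' hxW' h2 fun f hf hdf => ?_
    obtain ⟨c, u, hu, e⟩ := hrel f hf hdf
    have h4 := h1 _ e
    have h5 : ℓ g = 0 := by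
      have : tr q g = 0 := by
        rw [← htr]
        funext l
        rw [tr_apply, tr_apply]
        split_ifs with hl hl'
        · exact absurd (by linarith) hq
        · rfl
        · rfl
      rw [← h2, LinearMap.comp_apply, this, map_zero]
    rw [map_sub, map_sub, map_smul, h5, h3 u (AA_mono Set.inter_subset_left hu), smul_zero,
      sub_zero, sub_zero] at h4
    exact h4
  · intro e he hde
    obtain ⟨ℓ, W, hW, hxW, h1, h2, rfl, h3⟩ := rep n e he hde
    obtain ⟨W', hW', hxW', hsub, g, hg, htr, hdg, hΘg, hrel⟩ := key W hW hxW
    obtain ⟨y', hy', e⟩ := prim n (ℓ - (ℓ g / Θ g) • Θ) W' hW' hxW'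
      (by rw [LinearMap.sub_comp, LinearMap.smul_comp, h2, hΘtr]) fun f hf hdf => by
        obtain ⟨c, u, hu, e⟩ := hrel f hf hdf
        have h4 := h1 _ e
        have h5 := hΘZ _ e
        rw [map_sub, map_sub, map_smul, h3 u (AA_mono Set.inter_subset_left hu), sub_zero,
          sub_eq_zero, smul_eq_mul] at h4
        rw [map_sub, map_sub, map_smul, hΘd u (AA_mono Set.inter_subset_right hu), sub_zero,
          sub_eq_zero, smul_eq_mul] at h5
        rw [LinearMap.sub_apply, LinearMap.smul_apply, h4, h5, smul_eq_mul]
        field_simp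
        ring
    refine ⟨ℓ g / Θ g, y', hy', ?_⟩
    rw [e, map_sub, map_smul]
    abel

end Fundamental

end SmithFlag

namespace SmithFlag

open Module Topology Filter

section Chart

variable {M X G K : Type*} [TopologicalSpace M] [TopologicalSpace X] [Group G] [MulAction G M]
  [Group K]

open Classical in
/-- The action of a group preserving a subset `U` of the source of a chart, read in the chart. -/
noncomputable def chartAction (e : OpenPartialHomeomorph M X) (ι : K →* G) (U : Set M)
    (hU : U ⊆ e.source) (hinv : ∀ g, ∀ m ∈ U, ι g • m ∈ U) : K →* Equiv.Perm X :=
  have key : ∀ g, ∀ m ∈ U, (if e m ∈ e '' U then e (ι g • e.symm (e m)) else e m) = e (ι g • m) :=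
    fun g m hm => by rw [if_pos ⟨m, hm, rfl⟩, e.left_inv (hU hm)]
  letI : MulAction K X :=
    { smul := fun g x => if x ∈ e '' U then e (ι g • e.symm x) else x
      one_smul := fun x => by
        change (if x ∈ e '' U then e (ι 1 • e.symm x) else x) = x
        split_ifs with hx
        · obtain ⟨m, hm, rfl⟩ := hx
          rw [e.left_inv (hU hm), map_one, one_smul]
        · rfl
      mul_smul := fun a b x => by
        change (if x ∈ e '' U then e (ι (a * b) • e.symm x) else x) =
          if (if x ∈ e '' U then e (ι b • e.symm x) else x) ∈ e '' U then
            e (ι a • e.symm (if x ∈ e '' U then e (ι b • e.symm x) else x))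
          else (if x ∈ e '' U then e (ι b • e.symm x) else x)
        by_cases hx : x ∈ e '' U
        · obtain ⟨m, hm, rfl⟩ := hx
          rw [key _ m hm, key _ m hm, key _ _ (hinv b m hm), map_mul, mul_smul]
        · simp only [if_neg hx] }
  MulAction.toPermHom K X

variable {e : OpenPartialHomeomorph M X} {ι : K →* G} {U : Set M} {hU : U ⊆ e.source}
  {hinv : ∀ g, ∀ m ∈ U, ι g • m ∈ U}

lemma chartAction_apply_of_mem {m : M} (hm : m ∈ U) (g : K) :
    chartAction e ι U hU hinv g (e m) = e (ι g • m) := by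
  refine (if_pos ⟨m, hm, rfl⟩).trans ?_
  rw [e.left_inv (hU hm)]

lemma chartAction_apply_of_notMem {x : X} (hx : x ∉ e '' U) (g : K) :
    chartAction e ι U hU hinv g x = x :=
  if_neg hx

lemma chartAction_apply_eq_iff {m : M} (hm : m ∈ U) (g : K) :
    chartAction e ι U hU hinv g (e m) = e m ↔ ι g • m = m := by
  rw [chartAction_apply_of_mem hm]
  exact ⟨fun h => e.injOn (hU (hinv g m hm)) (hU hm) h, fun h => by rw [h]⟩

end Chart

/-- Actions read in a chart are continuous. -/
lemma continuousOn_chartAction {M G X K : Type*} [TopologicalSpace M] [TopologicalSpace X] [Group G]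
    [MulAction G M] [Group K] {e : OpenPartialHomeomorph M X} {ι : K →* G} {U : Set M}
    {hU : U ⊆ e.source} {hinv : ∀ g, ∀ m ∈ U, ι g • m ∈ U}
    (hcont : ∀ g : G, Continuous fun x : M => g • x) (g : K) :
    ContinuousOn (chartAction e ι U hU hinv g) (e '' U) := by
  have hc : ContinuousOn (fun x => e (ι g • e.symm x)) (e '' U) := by
    refine e.continuousOn.comp ((hcont (ι g)).comp_continuousOn
      (e.symm.continuousOn.mono ?_)) ?_
    · rintro _ ⟨m, hm, rfl⟩
      exact e.map_source (hU hm)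
    · rintro _ ⟨m, hm, rfl⟩
      change ι g • e.symm (e m) ∈ e.source
      rw [e.left_inv (hU hm)]
      exact hU (hinv g m hm)
  refine hc.congr ?_
  rintro _ ⟨m, hm, rfl⟩
  change _ = e (ι g • e.symm (e m))
  rw [chartAction_apply_of_mem hm, e.left_inv (hU hm)]

/-- Near a point of a manifold, the action of its stabilizer is a local action on a Euclidean
space. -/
theorem exists_local_model {n : ℕ} {M G : Type*} [TopologicalSpace M]
    [ChartedSpace (EuclideanSpace ℝ (Fin n)) M] [CommGroup G] [Finite G] [MulAction G M]
    (hcont : ∀ g : G, Continuous fun x : M => g • x) (y : M) :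
    ∃ (K : Type) (_ : CommGroup K) (_ : Finite K) (ι : K ≃* MulAction.stabilizer G y)
      (φ : K →* Equiv.Perm (Fin n → ℝ)) (Ω : Set (Fin n → ℝ)) (U : Set M) (e : M → Fin n → ℝ),
      LAct Ω φ ∧ IsOpen U ∧ y ∈ U ∧ (∀ m ∈ U, Filter.map e (𝓝 m) = 𝓝 (e m)) ∧
      (∀ m ∈ U, e m ∈ Ω) ∧ ∀ m ∈ U, ∀ g, φ g (e m) = e m ↔ (ι g : G) • m = m := by
  let e := (chartAt (EuclideanSpace ℝ (Fin n)) y).transHomeomorph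
    (EuclideanSpace.equiv (Fin n) ℝ).toHomeomorph
  have hye : y ∈ e.source := mem_chart_source _ y
  let ι : Shrink.{0} (MulAction.stabilizer G y) ≃* MulAction.stabilizer G y := Shrink.mulEquiv
  let ι' := (MulAction.stabilizer G y).subtype.comp ι.toMonoidHom
  let U : Set M := ⋂ g : Shrink.{0} (MulAction.stabilizer G y),
    (fun m => ι' g • m) ⁻¹' e.source
  have hU : U ⊆ e.source := fun m hm => by
    have := Set.mem_iInter.1 hm 1
    simpa using this
  have hinv : ∀ g, ∀ m ∈ U, ι' g • m ∈ U := fun g m hm => by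
    refine Set.mem_iInter.2 fun a => ?_
    have := Set.mem_iInter.1 hm (a * g)
    rwa [Set.mem_preimage, map_mul, mul_smul] at this
  have hyU : y ∈ U := Set.mem_iInter.2 fun g => by
    change ((ι g : MulAction.stabilizer G y) : G) • y ∈ e.source
    rwa [MulAction.mem_stabilizer_iff.1 (ι g).2]
  have : Finite (Shrink.{0} (MulAction.stabilizer G y)) := Finite.of_equiv _ ι.symm.toEquiv
  have hUo : IsOpen U := isOpen_iInter_of_finite fun g => e.open_source.preimage (hcont _)
  exact ⟨_, inferInstance, this, ι, chartAction e ι' U hU hinv, e '' U, U, e,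
    ⟨e.isOpen_image_of_subset_source hUo hU, continuousOn_chartAction hcont,
      fun g x hx => chartAction_apply_of_notMem hx g⟩, hUo, hyU,
    fun m hm => e.map_nhds_eq (hU hm), fun m hm => ⟨m, hm, rfl⟩,
    fun m hm g => chartAction_apply_eq_iff hm g⟩

end SmithFlag

namespace SmithFlag

open Module Topology Filter

section Global

variable {p : ℕ} {M G : Type*} [TopologicalSpace M] [CommGroup G] [Finite G] [MulAction G M]

/-- A homeomorphism of order `p` in the action which is trivial on open sets arbitrarily close to
`y` is trivial near `y`. -/
lemma eventually_fixed_of_frequently (n : ℕ) [ChartedSpace (EuclideanSpace ℝ (Fin n)) M]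
    [T2Space M] (hp : p.Prime) (hG : ∀ g : G, g ^ p = 1)
    (hcont : ∀ g : G, Continuous fun x : M => g • x) {g : G} {y : M}
    (hfr : ∃ᶠ x in 𝓝 y, ∀ᶠ z in 𝓝 x, g • z = z) : ∀ᶠ z in 𝓝 y, g • z = z := by
  have : Fact p.Prime := ⟨hp⟩
  have hgy : g • y = y := by
    have hcl : IsClosed {z : M | g • z = z} := isClosed_eq (hcont g) continuous_id
    exact hcl.mem_of_frequently_of_tendsto (hfr.mono fun x hx => hx.self_of_nhds) tendsto_id
  obtain ⟨K, _, _, ι, φ, Ω, U, e, hL, hUo, hyU, hmap, hmem, hfix⟩ :=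
    exists_local_model (n := n) hcont y
  set a := ι.symm ⟨g, hgy⟩ with ha
  have hιa : ((ι a : MulAction.stabilizer G y) : G) = g := by rw [ha, ι.apply_symm_apply]
  have hfix' : ∀ m ∈ U, φ a (e m) = e m ↔ g • m = m := fun m hm => by rw [hfix m hm, hιa]
  have htr : ∀ m ∈ U, (∀ᶠ z in 𝓝 (e m), φ a z = z) ↔ ∀ᶠ z in 𝓝 m, g • z = z := fun m hm => by
    rw [← hmap m hm, eventually_map]
    refine eventually_congr ?_
    filter_upwards [hUo.mem_nhds hm] with z hz using hfix' z hz
  refine (htr y hyU).1 (local_closed (k := ZMod p) (p := p) (c := fun (j : Fin n) x => x j)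
    hL (fun j => continuous_apply j) (fun x y h => funext h) ?_ (hmem y hyU)
    ((hfix' y hyU).2 hgy) (euclidean_SOD (ZMod p) hL.opn (hmem y hyU)) ?_)
  · rw [← ι.map_eq_one_iff, map_pow]
    exact Subtype.ext (by simpa using hG _)
  · rw [← hmap y hyU, frequently_map]
    refine (hfr.and_eventually (hUo.mem_nhds hyU)).mono ?_
    rintro x ⟨hx, hxU⟩
    exact (htr x hxU).2 hx

/-- In an effective action on a connected manifold, only the identity is trivial on a nonempty
open set. -/
lemma eq_one_of_eventually_fixed (n : ℕ) [ChartedSpace (EuclideanSpace ℝ (Fin n)) M]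
    [T2Space M] [ConnectedSpace M] (hp : p.Prime)
    (hG : ∀ g : G, g ^ p = 1) (hcont : ∀ g : G, Continuous fun x : M => g • x)
    (heff : ∀ g : G, (∀ x : M, g • x = x) → g = 1) {g : G} {y : M}
    (h : ∀ᶠ z in 𝓝 y, g • z = z) : g = 1 := by
  let V : Set M := {x | ∀ᶠ z in 𝓝 x, g • z = z}
  have hV : IsClopen V := by
    refine ⟨isClosed_of_closure_subset fun x hx => ?_, ?_⟩
    · exact eventually_fixed_of_frequently n hp hG hcont (mem_closure_iff_frequently.1 hx)
    · exact isOpen_setOfPred_eventually_nhds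
  have hVu : V = Set.univ := hV.eq_univ ⟨y, h⟩
  refine heff g fun x => ?_
  have hx : x ∈ V := hVu ▸ Set.mem_univ x
  exact (show ∀ᶠ z in 𝓝 x, g • z = z from hx).self_of_nhds

/-- Stabilizers near `y` are contained in the stabilizer of `y`. -/
lemma eventually_stabilizer_le [T2Space M] (hcont : ∀ g : G, Continuous fun x : M => g • x)
    (y : M) : ∀ᶠ m in 𝓝 y, MulAction.stabilizer G m ≤ MulAction.stabilizer G y := by
  have : ∀ᶠ m in 𝓝 y, ∀ g : G, g • y ≠ y → g • m ≠ m := by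
    refine eventually_all.2 fun g => ?_
    by_cases hg : g • y = y
    · exact Eventually.of_forall fun m h => absurd hg h
    · filter_upwards [(isOpen_ne_fun (hcont g) continuous_id).mem_nhds hg] with m hm _ using hm
  filter_upwards [this] with m hm g hg
  by_contra hgy
  exact hm g hgy hg

/-- The order of a stabilizer is bounded, and a nontrivial stabilizer contains a stabilizer of
index `p`. -/
theorem stabilizer_step (n : ℕ) [ChartedSpace (EuclideanSpace ℝ (Fin n)) M]
    [T2Space M] [ConnectedSpace M] (hp : p.Prime)
    (hG : ∀ g : G, g ^ p = 1) (hcont : ∀ g : G, Continuous fun x : M => g • x)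
    (heff : ∀ g : G, (∀ x : M, g • x = x) → g = 1) (y : M) :
    Nat.card (MulAction.stabilizer G y) ≤ p ^ n ∧
    (1 < Nat.card (MulAction.stabilizer G y) → ∃ m : M,
      MulAction.stabilizer G m ≤ MulAction.stabilizer G y ∧
      Nat.card (MulAction.stabilizer G y) = p * Nat.card (MulAction.stabilizer G m)) := by
  have : Fact p.Prime := ⟨hp⟩
  obtain ⟨K, _, _, ι, φ, Ω, U, e, hL, hUo, hyU, hmap, hmem, hfix⟩ :=
    exists_local_model (n := n) hcont y
  have hloc := local_structure (k := ZMod p) (p := p) (c := fun (j : Fin n) x => x j)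
    hL (fun j => continuous_apply j) (fun x y h => funext h)
    (fun a => by
      rw [← ι.map_eq_one_iff, map_pow]
      exact Subtype.ext (by simpa using hG _))
    (hmem y hyU) (fun g => (hfix y hyU g).2 (ι g).2)
    (euclidean_SOD (ZMod p) hL.opn (hmem y hyU))
    (fun g hg => by
      rw [← ι.map_eq_one_iff]
      refine Subtype.ext (eq_one_of_eventually_fixed n (y := y) hp hG hcont heff ?_)
      rw [← hmap y hyU, eventually_map] at hg
      filter_upwards [hg, hUo.mem_nhds hyU] with z hz hzU using (hfix z hzU g).1 hz)
  have hcard : Nat.card K = Nat.card (MulAction.stabilizer G y) := Nat.card_congr ι.toEquiv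
  rw [hcard] at hloc
  refine ⟨hloc.1, fun h1 => ?_⟩
  have hK : Nontrivial K := by
    rw [← hcard] at h1
    exact Finite.one_lt_card_iff_nontrivial.1 h1
  obtain ⟨S, hS, hfr⟩ := hloc.2 hK
  rw [← hmap y hyU, frequently_map] at hfr
  obtain ⟨m, ⟨-, hm⟩, hmU, hmy⟩ :=
    (hfr.and_eventually ((hUo.eventually_mem hyU).and (eventually_stabilizer_le hcont y))).exists
  refine ⟨m, hmy, ?_⟩
  rw [hS]
  have hSm : S.map ((MulAction.stabilizer G y).subtype.comp ι.toMonoidHom) =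
      MulAction.stabilizer G m := by
    ext g
    constructor
    · rintro ⟨s, hs, rfl⟩
      exact (hfix m hmU s).1 ((hm s).2 hs)
    · intro hg
      refine ⟨ι.symm ⟨g, hmy hg⟩, (hm _).1 ((hfix m hmU _).2 ?_), ?_⟩
      · rw [ι.apply_symm_apply]; exact hg
      · change ((ι (ι.symm ⟨g, hmy hg⟩) : MulAction.stabilizer G y) : G) = g
        rw [ι.apply_symm_apply]
  rw [← hSm]
  congr 1
  exact Nat.card_congr (S.equivMapOfInjective _
    (Subtype.val_injective.comp ι.injective)).toEquiv

end Global

end SmithFlag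

namespace SmithFlag

/-- A finite abelian group of order `p ^ r` is generated by `r` elements. -/
lemma exists_finset_closure_eq_top {p : ℕ} (hp : p.Prime) {A : Type*} [CommGroup A] [Finite A]
    {r : ℕ} (hr : Nat.card A = p ^ r) :
    ∃ S : Finset A, S.card ≤ r ∧ Subgroup.closure (S : Set A) = ⊤ := by
  classical
  suffices H : ∀ i ≤ r, ∃ S : Finset A, S.card ≤ i ∧
      p ^ i ≤ Nat.card (Subgroup.closure (S : Set A)) by
    obtain ⟨S, hS, hc⟩ := H r le_rfl
    exact ⟨S, hS, Subgroup.eq_top_of_le_card _ (hr ▸ hc)⟩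
  intro i
  induction i with
  | zero => exact fun _ => ⟨∅, by simp, by simp⟩
  | succ i ih =>
    intro hi
    obtain ⟨S, hS, hc⟩ := ih (by omega)
    by_cases htop : Subgroup.closure (S : Set A) = ⊤
    · refine ⟨S, by omega, ?_⟩
      rw [htop, Subgroup.card_top, hr]
      exact Nat.pow_le_pow_right hp.pos hi
    · obtain ⟨a, -, ha⟩ := SetLike.exists_of_lt (lt_top_iff_ne_top.2 htop)
      refine ⟨insert a S, (Finset.card_insert_le _ _).trans (by omega), ?_⟩
      have hlt : Subgroup.closure (S : Set A) <
          Subgroup.closure ((insert a S : Finset A) : Set A) := by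
        refine lt_of_le_of_ne (Subgroup.closure_mono (by simp)) fun h => ha ?_
        rw [h]
        exact Subgroup.subset_closure (by simp)
      obtain ⟨u, -, hu⟩ := (Nat.dvd_prime_pow hp).1
        (hr ▸ Subgroup.card_subgroup_dvd_card (Subgroup.closure (S : Set A)))
      obtain ⟨v, -, hv⟩ := (Nat.dvd_prime_pow hp).1 (hr ▸ Subgroup.card_subgroup_dvd_card
        (Subgroup.closure ((insert a S : Finset A) : Set A)))
      have hcl : Nat.card (Subgroup.closure (S : Set A)) <
          Nat.card (Subgroup.closure ((insert a S : Finset A) : Set A)) :=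
        Set.Finite.card_lt_card (Set.toFinite _) hlt
      rw [hu] at hc hcl
      rw [hv] at hcl ⊢
      have h1 := (Nat.pow_le_pow_iff_right hp.one_lt).1 hc
      have h2 := (Nat.pow_lt_pow_iff_right hp.one_lt).1 hcl
      exact Nat.pow_le_pow_right hp.pos (by omega)

/-- The rank of an elementary abelian group of order `p ^ r` is `r`. -/
lemma rank_eq_of_card {p : ℕ} (hp : p.Prime) {A : Type*} [CommGroup A] [Finite A]
    (hA : ∀ a : A, a ^ p = 1) {r : ℕ} (hr : Nat.card A = p ^ r) : Group.rank A = r := by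
  obtain ⟨S, hS, hc⟩ := exists_finset_closure_eq_top hp hr
  refine le_antisymm ((Group.rank_le hc).trans hS) ?_
  have := card_dvd_exponent_pow_rank' A hA
  rw [hr] at this
  exact (Nat.pow_dvd_pow_iff_le_right hp.one_lt).1 this

end SmithFlag

namespace SmithFlag

/-- The flag of stabilizers below a stabilizer of order `p ^ r`. -/
theorem exists_flag (n : ℕ) {p : ℕ} {M G : Type*} [TopologicalSpace M] [CommGroup G] [Finite G]
    [MulAction G M] [ChartedSpace (EuclideanSpace ℝ (Fin n)) M] [T2Space M] [ConnectedSpace M]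
    (hp : p.Prime) (hG : ∀ g : G, g ^ p = 1) (hcont : ∀ g : G, Continuous fun x : M => g • x)
    (heff : ∀ g : G, (∀ x : M, g • x = x) → g = 1) (r : ℕ) (y : M)
    (hy : Nat.card (MulAction.stabilizer G y) = p ^ r) :
    ∃ Hs : ℕ → Subgroup G, Hs r = MulAction.stabilizer G y ∧
      (∀ i < r, Hs i ≤ Hs (i + 1)) ∧ ∀ i ≤ r, Nat.card (Hs i) = p ^ i ∧
        Hs i ∈ Set.range fun x : M => MulAction.stabilizer G x := by
  induction r generalizing y with
  | zero =>
    refine ⟨fun _ => MulAction.stabilizer G y, rfl, fun i hi => le_rfl, fun i hi => ?_⟩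
    obtain rfl := Nat.le_zero.1 hi
    exact ⟨hy, y, rfl⟩
  | succ r ih =>
    obtain ⟨m, hle, hm⟩ := (stabilizer_step n hp hG hcont heff y).2
      (hy ▸ Nat.one_lt_pow (Nat.succ_ne_zero r) hp.one_lt)
    rw [hy, pow_succ'] at hm
    obtain ⟨Hs, h1, h2, h3⟩ := ih m (Nat.eq_of_mul_eq_mul_left hp.pos hm).symm
    refine ⟨Function.update Hs (r + 1) (MulAction.stabilizer G y), by simp, fun i hi => ?_,
      fun i hi => ?_⟩
    · rw [Function.update_of_ne (by omega)]
      obtain rfl | hi' := eq_or_ne i r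
      · rwa [Function.update_self, h1]
      · rw [Function.update_of_ne (by omega)]
        exact h2 i (by omega)
    · obtain rfl | hi' := eq_or_ne i (r + 1)
      · rw [Function.update_self]
        exact ⟨hy, y, rfl⟩
      · rw [Function.update_of_ne hi']
        exact h3 i (by omega)

end SmithFlag

/-- For a connected topological `n`-manifold `M`, an elementary abelian `p`-group `G`
acting continuously and effectively on `M`, and a maximal stabilizer subgroup `H`,
the rank of `H` is at most `n` and there is a complete flag of subgroups
`{1} = H_0 < H_1 < ⋯ < H_{rank H} = H` with `rank H_i = i`, all of whose members are
stabilizer subgroups of the `G`-action. -/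
theorem flag_of_stabilizers_below_maximal_stabilizer
    (n p : ℕ) (hp : p.Prime)
    (M : Type*) [TopologicalSpace M] [T2Space M]
    [SecondCountableTopology M] [ChartedSpace (EuclideanSpace ℝ (Fin n)) M]
    [ConnectedSpace M]
    (G : Type*) [CommGroup G] [Finite G] [MulAction G M]
    (hG : ∀ g : G, g ^ p = 1)
    (hcont : ∀ g : G, Continuous fun x : M => g • x)
    (heff : ∀ g : G, (∀ x : M, g • x = x) → g = 1)
    (H : Subgroup G)
    (hH : H ∈ Set.range fun x : M => MulAction.stabilizer G x)
    (hmax : ∀ K ∈ Set.range fun x : M => MulAction.stabilizer G x, H ≤ K → K = H) :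
    Group.rank H ≤ n ∧
    ∃ Hs : Fin (Group.rank H + 1) → Subgroup G,
      Hs 0 = ⊥ ∧ Hs (Fin.last _) = H ∧ StrictMono Hs ∧
      (∀ i, Group.rank (Hs i) = (i : ℕ)) ∧
      (∀ i, Hs i ∈ Set.range fun x : M => MulAction.stabilizer G x) := by
  have : Fact p.Prime := ⟨hp⟩
  have hsub : ∀ A : Subgroup G, ∀ a : A, a ^ p = 1 := fun A a =>
    Subtype.ext (by simpa using hG a)
  obtain ⟨y, hy⟩ := hH
  have hy : MulAction.stabilizer G y = H := hy
  obtain ⟨r, hr⟩ : ∃ r, Nat.card H = p ^ r := by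
    refine IsPGroup.iff_card.1 fun a => ⟨1, ?_⟩
    rw [pow_one]
    exact hsub H a
  have hrank : Group.rank H = r := SmithFlag.rank_eq_of_card hp (hsub H) hr
  have hle := (SmithFlag.stabilizer_step n hp hG hcont heff y).1
  rw [hy, hr, Nat.pow_le_pow_iff_right hp.one_lt] at hle
  obtain ⟨Hs, h1, h2, h3⟩ := SmithFlag.exists_flag n hp hG hcont heff r y (hy ▸ hr)
  have hi : ∀ i : Fin (Group.rank H + 1), (i : ℕ) ≤ r := fun i => by
    have := i.2
    omega
  refine ⟨hrank.trans_le hle, fun i => Hs i, ?_, ?_, Fin.strictMono_iff_lt_succ.2 fun i => ?_,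
    fun i => SmithFlag.rank_eq_of_card hp (hsub _) (h3 i (hi i)).1, fun i => (h3 i (hi i)).2⟩
  · exact Subgroup.card_eq_one.1 (by simpa using (h3 0 (Nat.zero_le r)).1)
  · change Hs (Group.rank H) = H
    rw [hrank, h1, hy]
  · have hir : (i : ℕ) < r := hrank ▸ i.2
    refine lt_of_le_of_ne (h2 i hir) fun h => ?_
    have h := congrArg (fun A : Subgroup G => Nat.card A) h
    change Nat.card (Hs i) = Nat.card (Hs (i + 1)) at h
    rw [(h3 i hir.le).1, (h3 (i + 1) hir).1] at h
    exact absurd (Nat.pow_right_injective hp.two_le h) (by omega)
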